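/- Let p ≥ 1 and let ν be a probability measure on ℝ^d with finite moment of order p. Let (X_t)_{t ≥ 0} be a stochastic process such that X_0 has law ν and such that for every t > 0 the pairs (X_0, X_t) and (X_t, X_0) have the same law. Assume that for every ε > 0 there exist ξ, M > 0 such that for all t ∈ [ε, ε^{-1}], E[‖X_t − X_0‖^{p(1+ξ)} exp(p(1+ξ)max(1, p−1)‖X_t − X_0‖²/(2(e^{2t} − 1)))] ≤ M. Then for every s > 0, W_p(ν, γ) ≤ ∫_0^∞ e^{-t} E[S_p(t)^{p/2}]^{1/p} dt, where S_p(t) = ‖E[(X_t − X_0)/s + X_0 | X_0]‖² + (max(1, p−1)/(e^{2t} − 1)) ‖E[(X_t − X_0)^{⊗2}/(2s) − I_d | X_0]‖² + Σ_{k ≥ 3} (max(1, p−1)^{k−1}/(4 s² (k−1)! (e^{2t} − 1)^{k−1})) ‖E[(X_t − X_0)^{⊗k} | X_0]‖². -/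

import Mathlib

open MeasureTheory ProbabilityTheory Real
open scoped ENNReal NNReal BigOperators Topology Classical

noncomputable section

/-- `ℝ^d` with the Euclidean norm. -/
abbrev Euc (d : ℕ) := EuclideanSpace ℝ (Fin d)

/-- The standard Gaussian measure on `ℝ^d`. -/
def stdGaussian (d : ℕ) : Measure (Euc d) :=
  volume.withDensity fun x =>
    ENNReal.ofReal ((2 * Real.pi) ^ (-(d : ℝ) / 2) * Real.exp (-‖x‖ ^ 2 / 2))

/-- The Wasserstein distance of order `p` between two measures, valued in `ℝ≥0∞`. -/
def wassersteinDist {E : Type*} [NormedAddCommGroup E] [MeasurableSpace E]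
    (p : ℝ) (μ ν : Measure E) : ℝ≥0∞ :=
  ⨅ (cpl : Measure (E × E)) (_ : IsProbabilityMeasure cpl)
    (_ : cpl.map Prod.fst = μ) (_ : cpl.map Prod.snd = ν),
    (∫⁻ q, ENNReal.ofReal (‖q.1 - q.2‖ ^ p) ∂cpl) ^ (1 / p)

/-- Degree `|α|` of a multi-index. -/
def mdeg {d : ℕ} (α : Fin d → ℕ) : ℕ := ∑ i, α i

/-- Factorial `α!` of a multi-index. -/
def mfact {d : ℕ} (α : Fin d → ℕ) : ℕ := ∏ i, (α i).factorial

/-- Monomial `x^α`. -/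
def monoE {d : ℕ} (α : Fin d → ℕ) (x : Euc d) : ℝ := ∏ i, x i ^ α i

/-- The family indexed by multi-indices of degree 2 associated with the identity matrix. -/
def idFam {d : ℕ} (α : Fin d → ℕ) : ℝ := if ∃ i : Fin d, α = Pi.single i 2 then 1 else 0

/-- Partial derivative in the `i`-th coordinate direction. -/
def pderivE {d : ℕ} (i : Fin d) (f : Euc d → ℝ) : Euc d → ℝ :=
  fun x => fderiv ℝ f x (EuclideanSpace.single i 1)

/-- Iterated partial derivative `∂^α`. -/
def mderivE {d : ℕ} (α : Fin d → ℕ) (f : Euc d → ℝ) : Euc d → ℝ :=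
  ((List.ofFn fun i : Fin d => (pderivE i)^[α i]).foldr (· ∘ ·) id) f

/-- `∂^α` applied componentwise to a vector field. -/
def mderivVec {d : ℕ} (α : Fin d → ℕ) (g : Euc d → Euc d) (x : Euc d) : Euc d :=
  (EuclideanSpace.equiv (Fin d) ℝ).symm fun i => mderivE α (fun y => g y i) x

/-- The Ornstein-Uhlenbeck semigroup `P_t`. -/
def OU {d : ℕ} (t : ℝ) (φ : Euc d → ℝ) (x : Euc d) : ℝ :=
  ∫ y, φ (Real.exp (-t) • x + Real.sqrt (1 - Real.exp (-2 * t)) • y) ∂(stdGaussian d)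

/-- The Ornstein-Uhlenbeck semigroup acting componentwise on a vector field. -/
def OUvec {d : ℕ} (t : ℝ) (g : Euc d → Euc d) (x : Euc d) : Euc d :=
  ∫ y, g (Real.exp (-t) • x + Real.sqrt (1 - Real.exp (-2 * t)) • y) ∂(stdGaussian d)

/-- The `k`-th probabilists' Hermite polynomial, as a function `ℝ → ℝ`. -/
def hermiteR (k : ℕ) (x : ℝ) : ℝ := Polynomial.aeval x (Polynomial.hermite k)

/-- The multivariate Hermite polynomial `H_α`. -/
def hermiteM {d : ℕ} (α : Fin d → ℕ) (x : Euc d) : ℝ := ∏ i, hermiteR (α i) (x i)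

/-- The Hilbert–Schmidt norm of the matrix `E[Y Yᵀ]`. -/
def covHS {Ω : Type*} [MeasurableSpace Ω] {d : ℕ} (P : Measure Ω) (Y : Ω → Euc d) : ℝ :=
  Real.sqrt (∑ k, ∑ l, (∫ ω, Y ω k * Y ω l ∂P) ^ 2)

/-- The Hilbert–Schmidt norm of the matrix `E[Y Yᵀ ‖Y‖^l]`. -/
def covHSw {Ω : Type*} [MeasurableSpace Ω] {d : ℕ} (P : Measure Ω) (Y : Ω → Euc d) (l : ℝ) : ℝ :=
  Real.sqrt (∑ k, ∑ k', (∫ ω, Y ω k * Y ω k' * ‖Y ω‖ ^ l ∂P) ^ 2)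

theorem rpow_two_pi_mul_integral (d : ℕ) (w : Euc d) :
    ∫ v : Euc d, Complex.exp (-(1 / 2 : ℂ) * ‖v‖ ^ 2 + Complex.I * inner ℝ w v) =
      ((2 * Real.pi) ^ ((d : ℝ) / 2) : ℝ) * Complex.exp (-‖w‖ ^ 2 / 2) := by
  rw [GaussianFourier.integral_cexp_neg_mul_sq_norm_add (by norm_num)]
  congr 1
  · rw [Complex.ofReal_cpow (by positivity)]
    simp only [finrank_euclideanSpace, Fintype.card_fin]
    push_cast
    congr 1
    ring
  · rw [Complex.I_sq]
    congr 1
    ring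

theorem integral_gaussian_density (d : ℕ) :
    ∫ x : Euc d, (2 * Real.pi) ^ (-(d : ℝ) / 2) * Real.exp (-‖x‖ ^ 2 / 2) = 1 := by
  rw [integral_const_mul]
  have h := GaussianFourier.integral_rexp_neg_mul_sq_norm (V := Euc d) (b := 1 / 2) (by norm_num)
  have h2 : ∀ x : Euc d, -‖x‖ ^ 2 / 2 = -(1 / 2) * ‖x‖ ^ 2 := fun x => by ring
  simp only [h2, h, finrank_euclideanSpace, Fintype.card_fin]
  rw [show π / (1 / 2) = 2 * π by ring, ← Real.rpow_add (by positivity), neg_div]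
  simp

theorem integrable_gaussian_density (d : ℕ) :
    Integrable fun x : Euc d => (2 * Real.pi) ^ (-(d : ℝ) / 2) * Real.exp (-‖x‖ ^ 2 / 2) := by
  refine Integrable.of_integral_ne_zero ?_
  rw [integral_gaussian_density]
  exact one_ne_zero

/-- The density definition agrees with Mathlib's standard Gaussian measure. -/
theorem stdGaussian_eq_mathlib (d : ℕ) :
    _root_.stdGaussian d = ProbabilityTheory.stdGaussian (Euc d) := by
  have hfin : IsFiniteMeasure (_root_.stdGaussian d) :=
    isFiniteMeasure_withDensity_ofReal (integrable_gaussian_density d).2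
  refine Measure.ext_of_charFun ?_
  ext t
  rw [charFun_stdGaussian, charFun_apply, _root_.stdGaussian,
    integral_withDensity_eq_integral_toReal_smul (by fun_prop) (by simp)]
  have h1 : ∀ x : Euc d,
      (ENNReal.ofReal ((2 * π) ^ (-(d : ℝ) / 2) * Real.exp (-‖x‖ ^ 2 / 2))).toReal •
        Complex.exp (inner ℝ x t * Complex.I) =
      (((2 * π) ^ (-(d : ℝ) / 2) : ℝ) : ℂ) *
        Complex.exp (-(1 / 2 : ℂ) * ‖x‖ ^ 2 + Complex.I * inner ℝ t x) := by
    intro x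
    rw [ENNReal.toReal_ofReal (by positivity), Complex.exp_add, Complex.real_smul, real_inner_comm,
      Complex.ofReal_mul, Complex.ofReal_exp]
    push_cast
    ring_nf
  simp only [h1]
  rw [integral_const_mul, rpow_two_pi_mul_integral, ← mul_assoc, ← Complex.ofReal_mul,
    ← Real.rpow_add (by positivity), neg_div]
  simp

/-- Cameron–Martin formula for the standard Gaussian measure. -/
theorem lintegral_stdGaussian_add {d : ℕ} (a : Euc d) {f : Euc d → ℝ≥0∞} (hf : Measurable f) :
    ∫⁻ z, f (z + a) ∂(ProbabilityTheory.stdGaussian (Euc d)) =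
      ∫⁻ z, ENNReal.ofReal (Real.exp (inner ℝ a z - ‖a‖ ^ 2 / 2)) * f z
        ∂(ProbabilityTheory.stdGaussian (Euc d)) := by
  rw [← stdGaussian_eq_mathlib, _root_.stdGaussian,
    lintegral_withDensity_eq_lintegral_mul _ (by fun_prop) (by fun_prop),
    lintegral_withDensity_eq_lintegral_mul _ (by fun_prop) (by fun_prop),
    ← lintegral_add_right_eq_self _ (-a)]
  refine lintegral_congr fun z => ?_
  simp only [Pi.mul_apply, neg_add_cancel_right]
  rw [← mul_assoc, ← ENNReal.ofReal_mul (by positivity), mul_assoc, ← Real.exp_add]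
  congr 4
  rw [← sub_eq_add_neg, norm_sub_sq_real, real_inner_comm]
  ring

theorem integral_stdGaussian_add {d : ℕ} {F : Type*} [NormedAddCommGroup F] [NormedSpace ℝ F]
    (a : Euc d) (f : Euc d → F) :
    ∫ z, f (z + a) ∂(ProbabilityTheory.stdGaussian (Euc d)) =
      ∫ z, Real.exp (inner ℝ a z - ‖a‖ ^ 2 / 2) • f z
        ∂(ProbabilityTheory.stdGaussian (Euc d)) := by
  rw [← stdGaussian_eq_mathlib, _root_.stdGaussian,
    integral_withDensity_eq_integral_toReal_smul (by fun_prop) (by simp),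
    integral_withDensity_eq_integral_toReal_smul (by fun_prop) (by simp),
    ← integral_add_right_eq_self _ (-a)]
  refine integral_congr_ae (Filter.Eventually.of_forall fun z => ?_)
  simp only [neg_add_cancel_right]
  rw [smul_smul, ENNReal.toReal_ofReal (by positivity), ENNReal.toReal_ofReal (by positivity),
    mul_assoc, ← Real.exp_add]
  congr 3
  rw [← sub_eq_add_neg, norm_sub_sq_real, real_inner_comm]
  ring

theorem integrable_stdGaussian_add {d : ℕ} {F : Type*} [NormedAddCommGroup F] [NormedSpace ℝ F]
    (a : Euc d) {f : Euc d → F}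
    (hf : Integrable (fun z => f (z + a)) (ProbabilityTheory.stdGaussian (Euc d))) :
    Integrable (fun z => Real.exp (inner ℝ a z - ‖a‖ ^ 2 / 2) • f z)
      (ProbabilityTheory.stdGaussian (Euc d)) := by
  rw [← stdGaussian_eq_mathlib, _root_.stdGaussian] at hf ⊢
  rw [integrable_withDensity_iff_integrable_smul' (by fun_prop) (by simp)] at hf ⊢
  refine (hf.comp_add_right (-a)).congr (Filter.Eventually.of_forall fun z => ?_)
  simp only [neg_add_cancel_right]
  rw [smul_smul, ENNReal.toReal_ofReal (by positivity), ENNReal.toReal_ofReal (by positivity),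
    mul_assoc, ← Real.exp_add]
  congr 3
  rw [← sub_eq_add_neg, norm_sub_sq_real, real_inner_comm]
  ring

theorem lintegral_exp_stdGaussian {d : ℕ} (a : Euc d) :
    ∫⁻ z, ENNReal.ofReal (Real.exp (inner ℝ a z - ‖a‖ ^ 2 / 2))
        ∂(ProbabilityTheory.stdGaussian (Euc d)) = 1 := by
  have h := lintegral_stdGaussian_add a (f := fun _ => 1) measurable_const
  simpa using h.symm

theorem integrable_exp_stdGaussian {d : ℕ} (a : Euc d) :
    Integrable (fun z => Real.exp (inner ℝ a z - ‖a‖ ^ 2 / 2))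
      (ProbabilityTheory.stdGaussian (Euc d)) := by
  refine ⟨by fun_prop, ?_⟩
  rw [hasFiniteIntegral_iff_ofReal (Filter.Eventually.of_forall fun z => by positivity),
    lintegral_exp_stdGaussian]
  simp

theorem integral_exp_stdGaussian {d : ℕ} (a : Euc d) :
    ∫ z, Real.exp (inner ℝ a z - ‖a‖ ^ 2 / 2) ∂(ProbabilityTheory.stdGaussian (Euc d)) = 1 := by
  have h := integral_stdGaussian_add a (fun _ => (1 : ℝ))
  simpa using h.symm

theorem integral_inner_stdGaussian {d : ℕ} (a b : Euc d) :
    ∫ z, inner ℝ a z * inner ℝ b z ∂(ProbabilityTheory.stdGaussian (Euc d)) = inner ℝ a b := by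
  have h := covarianceBilin_stdGaussian (E := Euc d)
  have h2 := covarianceBilin_apply (μ := ProbabilityTheory.stdGaussian (Euc d))
    (IsGaussian.memLp_two_id) a b
  rw [h, innerSL_apply_apply ℝ] at h2
  rw [h2]
  simp

theorem integrable_inner_mul_inner_stdGaussian {d : ℕ} (a b : Euc d) :
    Integrable (fun z => inner ℝ a z * inner ℝ b z) (ProbabilityTheory.stdGaussian (Euc d)) :=
  (IsGaussian.memLp_two_id.const_inner a).integrable_mul
    (IsGaussian.memLp_two_id.const_inner b)

theorem integral_norm_sq_stdGaussian (d : ℕ) :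
    ∫ z, ‖z‖ ^ 2 ∂(ProbabilityTheory.stdGaussian (Euc d)) = d := by
  have h : ∀ z : Euc d, ‖z‖ ^ 2 =
      ∑ i, inner ℝ (EuclideanSpace.single i (1 : ℝ)) z *
        inner ℝ (EuclideanSpace.single i (1 : ℝ)) z := fun z => by
    rw [EuclideanSpace.norm_sq_eq]
    simp [EuclideanSpace.inner_single_left, pow_two]
  simp only [h]
  rw [integral_finsetSum _ fun i _ => integrable_inner_mul_inner_stdGaussian _ _]
  simp [integral_inner_stdGaussian]

theorem memLp_id_stdGaussian (d : ℕ) (p : ℝ≥0∞) (hp : p ≠ ∞) :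
    MemLp (fun z => z) p (ProbabilityTheory.stdGaussian (Euc d)) :=
  IsGaussian.memLp_id _ p hp

theorem integral_cexp_inner_stdGaussian_prod {d : ℕ} (u v : Euc d) :
    ∫ q : Euc d × Euc d, Complex.exp ((inner ℝ q.1 u + inner ℝ q.2 v : ℝ) * Complex.I)
      ∂((ProbabilityTheory.stdGaussian (Euc d)).prod (ProbabilityTheory.stdGaussian (Euc d))) =
      Complex.exp (-(‖u‖ ^ 2 + ‖v‖ ^ 2) / 2) := by
  have h := integral_prod_mul (μ := ProbabilityTheory.stdGaussian (Euc d))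
    (ν := ProbabilityTheory.stdGaussian (Euc d))
    (fun x => Complex.exp ((inner ℝ x u : ℝ) * Complex.I))
    (fun x => Complex.exp ((inner ℝ x v : ℝ) * Complex.I))
  rw [← charFun_apply, ← charFun_apply, charFun_stdGaussian, charFun_stdGaussian,
    ← Complex.exp_add] at h
  convert h using 1
  · refine integral_congr_ae (Filter.Eventually.of_forall fun q => ?_)
    simp only [← Complex.exp_add]
    push_cast
    ring_nf
  · ring_nf

/-- A unit combination of two independent standard Gaussian vectors is standard Gaussian. -/
theorem stdGaussian_prod_map_combination {d : ℕ} (c s : ℝ) (h : c ^ 2 + s ^ 2 = 1) :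
    ((ProbabilityTheory.stdGaussian (Euc d)).prod (ProbabilityTheory.stdGaussian (Euc d))).map
      (fun q => c • q.1 + s • q.2) = ProbabilityTheory.stdGaussian (Euc d) := by
  have := Measure.isProbabilityMeasure_map
    (μ := (ProbabilityTheory.stdGaussian (Euc d)).prod (ProbabilityTheory.stdGaussian (Euc d)))
    (f := fun q => c • q.1 + s • q.2) (by fun_prop)
  refine Measure.ext_of_charFun ?_
  ext t
  rw [charFun_apply, integral_map (by fun_prop) (by fun_prop), charFun_stdGaussian]
  have h1 := integral_cexp_inner_stdGaussian_prod (c • t) (s • t)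
  simp only [inner_add_left, inner_smul_left, inner_smul_right, norm_smul] at h1 ⊢
  have h2 : (‖c‖ * ‖t‖) ^ 2 + (‖s‖ * ‖t‖) ^ 2 = ‖t‖ ^ 2 := by
    rw [mul_pow, mul_pow, ← add_mul, Real.norm_eq_abs, Real.norm_eq_abs, sq_abs, sq_abs, h, one_mul]
  convert h1 using 2
  · simp
  · rw [← Complex.ofReal_pow, ← Complex.ofReal_pow, ← Complex.ofReal_pow, ← Complex.ofReal_add, h2]

theorem two_mul_le_rpow_add_sub_rpow_sub {r y : ℝ} (hr0 : 0 < r) (hr1 : r < 1) (hy0 : 0 ≤ y)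
    (hy1 : y ≤ 1) : 2 * r * y ≤ (1 + y) ^ r - (1 - y) ^ r := by
  have hcont : ContinuousOn (fun y : ℝ => (1 + y) ^ r - (1 - y) ^ r - 2 * r * y) (Set.Icc 0 1) := by
    refine ContinuousOn.sub (ContinuousOn.sub ?_ ?_) (by fun_prop)
    · exact ContinuousOn.rpow_const (by fun_prop) fun x _ => Or.inr hr0.le
    · exact ContinuousOn.rpow_const (by fun_prop) fun x _ => Or.inr hr0.le
  have hderiv : ∀ x ∈ interior (Set.Icc (0 : ℝ) 1),
      HasDerivWithinAt (fun y : ℝ => (1 + y) ^ r - (1 - y) ^ r - 2 * r * y)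
        (r * (1 + x) ^ (r - 1) + r * (1 - x) ^ (r - 1) - 2 * r)
        (interior (Set.Icc (0 : ℝ) 1)) x := by
    intro x hx
    rw [interior_Icc] at hx
    refine HasDerivAt.hasDerivWithinAt ?_
    have h1 : HasDerivAt (fun y : ℝ => (1 + y) ^ r) (1 * r * (1 + x) ^ (r - 1)) x :=
      ((hasDerivAt_id x).const_add 1).rpow_const (Or.inl (by simp; linarith [hx.1]))
    have h2 : HasDerivAt (fun y : ℝ => (1 - y) ^ r) (-1 * r * (1 - x) ^ (r - 1)) x :=
      ((hasDerivAt_id x).const_sub 1).rpow_const (Or.inl (by simp; linarith [hx.2]))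
    have h3 : HasDerivAt (fun y : ℝ => 2 * r * y) (2 * r * 1) x := (hasDerivAt_id x).const_mul _
    exact ((h1.sub h2).sub h3).congr_deriv (by ring)
  have hmono := monotoneOn_of_hasDerivWithinAt_nonneg (convex_Icc (0 : ℝ) 1) hcont hderiv ?_
  · have := hmono (Set.left_mem_Icc.2 zero_le_one) ⟨hy0, hy1⟩ hy0
    simp at this
    linarith
  · intro x hx
    rw [interior_Icc] at hx
    have hp : 0 < 1 + x := by linarith [hx.1]
    have hm : 0 < 1 - x := by linarith [hx.2]
    have h1 : 1 ≤ (1 + x) ^ (r - 1) * (1 - x) ^ (r - 1) := by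
      rw [← Real.mul_rpow hp.le hm.le]
      refine Real.one_le_rpow_of_pos_of_le_one_of_nonpos (by positivity) ?_ (by linarith)
      nlinarith [hx.1]
    have h2 : 2 ≤ (1 + x) ^ (r - 1) + (1 - x) ^ (r - 1) := by
      have a0 : 0 < (1 + x) ^ (r - 1) := by positivity
      have b0 : 0 < (1 - x) ^ (r - 1) := by positivity
      nlinarith [sq_nonneg ((1 + x) ^ (r - 1) - (1 - x) ^ (r - 1))]
    nlinarith

theorem one_add_mul_sq_le_rpow {q y : ℝ} (hq1 : 1 < q) (hq2 : q < 2) (hy0 : 0 ≤ y)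
    (hy1 : y ≤ 1) : 1 + q / 2 * ((q - 1) * y ^ 2) ≤ ((1 + y) ^ q + (1 - y) ^ q) / 2 := by
  have hcont : ContinuousOn
      (fun y : ℝ => (1 + y) ^ q + (1 - y) ^ q - q * (q - 1) * y ^ 2) (Set.Icc 0 1) := by
    refine ContinuousOn.sub (ContinuousOn.add ?_ ?_) (by fun_prop)
    · exact ContinuousOn.rpow_const (by fun_prop) fun x _ => Or.inr (by linarith)
    · exact ContinuousOn.rpow_const (by fun_prop) fun x _ => Or.inr (by linarith)
  have hderiv : ∀ x ∈ interior (Set.Icc (0 : ℝ) 1),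
      HasDerivWithinAt (fun y : ℝ => (1 + y) ^ q + (1 - y) ^ q - q * (q - 1) * y ^ 2)
        (q * ((1 + x) ^ (q - 1) - (1 - x) ^ (q - 1) - 2 * (q - 1) * x))
        (interior (Set.Icc (0 : ℝ) 1)) x := by
    intro x hx
    rw [interior_Icc] at hx
    refine HasDerivAt.hasDerivWithinAt ?_
    have h1 : HasDerivAt (fun y : ℝ => (1 + y) ^ q) (1 * q * (1 + x) ^ (q - 1)) x :=
      ((hasDerivAt_id x).const_add 1).rpow_const (Or.inl (by simp; linarith [hx.1]))
    have h2 : HasDerivAt (fun y : ℝ => (1 - y) ^ q) (-1 * q * (1 - x) ^ (q - 1)) x :=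
      ((hasDerivAt_id x).const_sub 1).rpow_const (Or.inl (by simp; linarith [hx.2]))
    have h3 : HasDerivAt (fun y : ℝ => q * (q - 1) * y ^ 2) (q * (q - 1) * (2 * x)) x := by
      simpa using ((hasDerivAt_id x).pow 2).const_mul (q * (q - 1))
    exact ((h1.add h2).sub h3).congr_deriv (by ring)
  have hmono := monotoneOn_of_hasDerivWithinAt_nonneg (convex_Icc (0 : ℝ) 1) hcont hderiv ?_
  · have := hmono (Set.left_mem_Icc.2 zero_le_one) ⟨hy0, hy1⟩ hy0
    simp at this
    linarith
  · intro x hx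
    rw [interior_Icc] at hx
    have := two_mul_le_rpow_add_sub_rpow_sub (r := q - 1) (by linarith) (by linarith)
      hx.1.le hx.2.le
    have hq : 0 ≤ q := by linarith
    exact mul_nonneg hq (by linarith)

/-- Bonami's two-point inequality, for nonnegative functions on the two-point space. -/
theorem two_point_inequality {q u w : ℝ} (hq1 : 1 < q) (hq2 : q < 2) (hu : 0 ≤ u) (hw : 0 ≤ w) :
    ((u + w) / 2) ^ 2 + (q - 1) * ((u - w) / 2) ^ 2 ≤ (((u ^ q + w ^ q) / 2) ^ (1 / q)) ^ 2 := by
  wlog hle : w ≤ u generalizing u w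
  · have := this hw hu (le_of_not_ge hle)
    rw [add_comm u w, add_comm (u ^ q)]
    convert this using 3
    ring
  rcases hu.eq_or_lt with rfl | hu0
  · obtain rfl : w = 0 := le_antisymm hle hw
    simp
    positivity
  set a := (u + w) / 2 with ha
  set b := (u - w) / 2 with hb
  have ha0 : 0 < a := by rw [ha]; linarith
  have hb0 : 0 ≤ b := by rw [hb]; linarith
  set y := b / a with hy
  have hy0 : 0 ≤ y := by positivity
  have hy1 : y ≤ 1 := by
    rw [hy, div_le_one ha0, ha, hb]
    linarith
  have hby : b = a * y := by rw [hy]; field_simp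
  have hu' : u = a * (1 + y) := by rw [mul_add, ← hby, ha, hb]; ring
  have hw' : w = a * (1 - y) := by rw [mul_sub, ← hby, ha, hb]; ring
  have h1 := one_add_mul_sq_le_rpow hq1 hq2 hy0 hy1
  have hqy : 0 ≤ (q - 1) * y ^ 2 := mul_nonneg (by linarith) (sq_nonneg _)
  have h2 : (1 + (q - 1) * y ^ 2) ^ (q / 2) ≤ 1 + q / 2 * ((q - 1) * y ^ 2) :=
    rpow_one_add_le_one_add_mul_self (by linarith) (by linarith) (by linarith)
  have h3 := h2.trans h1
  have h4 : a ^ 2 + (q - 1) * b ^ 2 = a ^ 2 * (1 + (q - 1) * y ^ 2) := by rw [hby]; ring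
  have h5 : (u ^ q + w ^ q) / 2 = a ^ q * (((1 + y) ^ q + (1 - y) ^ q) / 2) := by
    rw [hu', hw', Real.mul_rpow ha0.le (by linarith), Real.mul_rpow ha0.le (by linarith)]
    ring
  rw [h4, h5]
  have hq0 : q ≠ 0 := by linarith
  have hs : 0 ≤ ((1 + y) ^ q + (1 - y) ^ q) / 2 := le_trans (by positivity) h3
  rw [Real.mul_rpow (by positivity) hs, ← Real.rpow_mul ha0.le, mul_one_div_cancel hq0,
    Real.rpow_one, mul_pow]
  refine mul_le_mul_of_nonneg_left ?_ (by positivity)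
  have h6 := Real.rpow_le_rpow (by positivity) h3 (show 0 ≤ 1 / q * 2 by positivity)
  rw [← Real.rpow_mul (by positivity)] at h6
  rw [show q / 2 * (1 / q * 2) = 1 by field_simp, Real.rpow_one, Real.rpow_mul hs] at h6
  exact_mod_cast h6

theorem two_point_bilinear {q ρ f₁ f₂ u w : ℝ} (hq1 : 1 < q) (hq2 : q < 2) (hρ : ρ ^ 2 = q - 1)
    (hu : 0 ≤ u) (hw : 0 ≤ w) :
    (1 + ρ) / 4 * (f₁ * u + f₂ * w) + (1 - ρ) / 4 * (f₁ * w + f₂ * u) ≤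
      ((f₁ ^ (2 : ℝ) + f₂ ^ (2 : ℝ)) / 2) ^ (1 / 2 : ℝ) * ((u ^ q + w ^ q) / 2) ^ (1 / q) := by
  have h := two_point_inequality hq1 hq2 hu hw
  have hB : 0 ≤ ((u ^ q + w ^ q) / 2) ^ (1 / q) := by positivity
  rw [← Real.sqrt_eq_rpow, Real.rpow_two, Real.rpow_two]
  refine le_trans (Real.le_sqrt_of_sq_le ?_) (le_of_eq (?_ : Real.sqrt
    ((f₁ ^ 2 + f₂ ^ 2) / 2 * (((u ^ q + w ^ q) / 2) ^ (1 / q)) ^ 2) = _))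
  · refine le_trans ?_ (mul_le_mul_of_nonneg_left h (by positivity))
    rw [← hρ]
    nlinarith [sq_nonneg ((f₁ + f₂) * ρ * (u - w) - (f₁ - f₂) * (u + w))]
  · rw [Real.sqrt_mul (by positivity), Real.sqrt_sq hB]

/-- A measure satisfies the `(2, q)` hypercontractive bilinear inequality with respect to a pair
of maps. -/
def HypercontractivePair {H E : Type*} [MeasurableSpace H] [MeasurableSpace E] (μ : Measure H)
    (A B : H → E) (q : ℝ) : Prop :=
  ∀ f g : E → ℝ≥0∞, Measurable f → Measurable g →
    ∫⁻ h, f (A h) * g (B h) ∂μ ≤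
      (∫⁻ h, f (A h) ^ (2 : ℝ) ∂μ) ^ (1 / 2 : ℝ) * (∫⁻ h, g (B h) ^ q ∂μ) ^ (1 / q)

theorem HypercontractivePair.dirac_zero {H E : Type*} [NormedAddCommGroup H]
    [InnerProductSpace ℝ H] [MeasurableSpace H] [BorelSpace H] [NormedAddCommGroup E]
    [NormedSpace ℝ E] [MeasurableSpace E] [BorelSpace E] {A B : H →L[ℝ] E} {q : ℝ} (hq : 1 < q) :
    HypercontractivePair (Measure.dirac (0 : H)) A B q := by
  intro f g hf hg
  rw [lintegral_dirac' _ (by fun_prop), lintegral_dirac' _ (by fun_prop),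
    lintegral_dirac' _ (by fun_prop), ← ENNReal.rpow_mul, ← ENNReal.rpow_mul,
    mul_one_div_cancel (by norm_num), mul_one_div_cancel (by linarith)]
  simp

section

variable {H E : Type*} [NormedAddCommGroup H] [InnerProductSpace ℝ H] [MeasurableSpace H]
  [BorelSpace H] [SecondCountableTopology H]
  [NormedAddCommGroup E] [NormedSpace ℝ E] [MeasurableSpace E] [BorelSpace E]
  [SecondCountableTopology E]
  {A B : H →L[ℝ] E} {q : ℝ}

theorem HypercontractivePair.conv (hq : 1 < q) {μ₁ μ₂ : Measure H} [IsProbabilityMeasure μ₁]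
    [IsProbabilityMeasure μ₂]
    (h₁ : HypercontractivePair μ₁ A B q) (h₂ : HypercontractivePair μ₂ A B q) :
    HypercontractivePair (μ₁ ∗ μ₂) A B q := by
  intro f g hf hg
  rw [Measure.lintegral_conv (by fun_prop), Measure.lintegral_conv (by fun_prop),
    Measure.lintegral_conv (by fun_prop)]
  simp only [map_add]
  have hF : Measurable fun a : E => (∫⁻ y, f (a + A y) ^ (2 : ℝ) ∂μ₂) ^ (1 / 2 : ℝ) :=
    (Measurable.lintegral_prod_right' (f := fun z : E × H => f (z.1 + A z.2) ^ (2 : ℝ))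
      (by fun_prop)).pow_const _
  have hG : Measurable fun b : E => (∫⁻ y, g (b + B y) ^ q ∂μ₂) ^ (1 / q) :=
    (Measurable.lintegral_prod_right' (f := fun z : E × H => g (z.1 + B z.2) ^ q)
      (by fun_prop)).pow_const _
  refine (lintegral_mono fun x =>
    h₂ (fun e => f (A x + e)) (fun e => g (B x + e)) (by fun_prop) (by fun_prop)).trans ?_
  refine (h₁ _ _ hF hG).trans (le_of_eq ?_)
  simp only [← ENNReal.rpow_mul]
  norm_num [show 1 / q * q = 1 by field_simp]
  have : q⁻¹ * q = 1 := by field_simp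
  simp [this]

theorem HypercontractivePair.exists_charFun_pow (hq : 1 < q) {μ : Measure H}
    [IsProbabilityMeasure μ] (h : HypercontractivePair μ A B q) (n : ℕ) :
    ∃ μ' : Measure H, IsProbabilityMeasure μ' ∧ HypercontractivePair μ' A B q ∧
      ∀ t, charFun μ' t = charFun μ t ^ n := by
  induction n with
  | zero => exact ⟨Measure.dirac 0, inferInstance, .dirac_zero hq, fun t => by simp [charFun_dirac]⟩
  | succ n ih =>
    obtain ⟨μ', h1, h2, h3⟩ := ih
    exact ⟨μ' ∗ μ, inferInstance, h2.conv hq h, fun t => by rw [charFun_conv, h3, pow_succ]⟩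

theorem HypercontractivePair.exists_charFun_prod (hq : 1 < q) {ι : Type*} (s : Finset ι)
    (φ : ι → H → ℂ)
    (hφ : ∀ i, ∃ μ : Measure H, IsProbabilityMeasure μ ∧ HypercontractivePair μ A B q ∧
      ∀ t, charFun μ t = φ i t) :
    ∃ μ' : Measure H, IsProbabilityMeasure μ' ∧ HypercontractivePair μ' A B q ∧
      ∀ t, charFun μ' t = ∏ i ∈ s, φ i t := by
  induction s using Finset.induction_on with
  | empty =>
    exact ⟨Measure.dirac 0, inferInstance, .dirac_zero hq, fun t => by simp [charFun_dirac]⟩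
  | insert i s hi ih =>
    obtain ⟨μ', h1, h2, h3⟩ := ih
    obtain ⟨μ, k1, k2, k3⟩ := hφ i
    exact ⟨μ' ∗ μ, inferInstance, h2.conv hq k2, fun t => by
      rw [charFun_conv, h3, k3, Finset.prod_insert hi, mul_comm]⟩

end

theorem ennreal_two_point_bilinear {q ρ : ℝ} (hq1 : 1 < q) (hq2 : q < 2) (hρ0 : 0 ≤ ρ)
    (hρ : ρ ^ 2 = q - 1) (f₁ f₂ u w : ℝ≥0∞) :
    ENNReal.ofReal ((1 + ρ) / 4) * (f₁ * u + f₂ * w) +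
      ENNReal.ofReal ((1 - ρ) / 4) * (f₁ * w + f₂ * u) ≤
      ((f₁ ^ (2 : ℝ) + f₂ ^ (2 : ℝ)) / 2) ^ (1 / 2 : ℝ) * ((u ^ q + w ^ q) / 2) ^ (1 / q) := by
  have hρ1 : ρ < 1 := by nlinarith
  have hq0 : 0 < q := by linarith
  by_cases hfz : f₁ = 0 ∧ f₂ = 0
  · simp [hfz.1, hfz.2]
  by_cases hgz : u = 0 ∧ w = 0
  · simp [hgz.1, hgz.2]
  have hfz' : (f₁ ^ (2 : ℝ) + f₂ ^ (2 : ℝ)) / 2 ≠ 0 := by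
    simpa [ENNReal.div_eq_zero_iff] using hfz
  have hgz' : (u ^ q + w ^ q) / 2 ≠ 0 := by
    simpa [ENNReal.div_eq_zero_iff, hq0, hq0.le, not_lt.2 hq0.le] using hgz
  by_cases hft : f₁ = ⊤ ∨ f₂ = ⊤
  · have : (f₁ ^ (2 : ℝ) + f₂ ^ (2 : ℝ)) / 2 = ⊤ := by
      rcases hft with h | h <;> simp [h, ENNReal.top_div]
    rw [this, ENNReal.top_rpow_of_pos (by norm_num), ENNReal.top_mul]
    · exact le_top
    · simp only [one_div, ne_eq, ENNReal.rpow_eq_zero_iff, not_or, not_and]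
      exact ⟨fun h => absurd h hgz', fun _ => by simp [hq0.le]⟩
  by_cases hgt : u = ⊤ ∨ w = ⊤
  · have : (u ^ q + w ^ q) / 2 = ⊤ := by
      rcases hgt with h | h <;> simp [h, ENNReal.top_div, ENNReal.top_rpow_of_pos hq0]
    rw [this, ENNReal.top_rpow_of_pos (by positivity), ENNReal.mul_top]
    · exact le_top
    · simp only [one_div, ne_eq, ENNReal.rpow_eq_zero_iff, not_or, not_and]
      exact ⟨fun h => absurd h hfz', fun _ => by norm_num⟩
  push Not at hft hgt
  lift f₁ to ℝ≥0 using hft.1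
  lift f₂ to ℝ≥0 using hft.2
  lift u to ℝ≥0 using hgt.1
  lift w to ℝ≥0 using hgt.2
  have hc₁ : 0 ≤ (1 + ρ) / 4 := by linarith
  have hc₂ : 0 ≤ (1 - ρ) / 4 := by linarith
  have h := two_point_bilinear (f₁ := f₁) (f₂ := f₂) hq1 hq2 hρ u.coe_nonneg w.coe_nonneg
  generalize (1 + ρ) / 4 = c₁, (1 - ρ) / 4 = c₂ at h hc₁ hc₂ ⊢
  have h' := ENNReal.ofReal_le_ofReal h
  have e : ∀ x : ℝ≥0, ENNReal.ofReal (x : ℝ) = x := fun x => by simp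
  have e2 : ∀ (x : ℝ≥0) (r : ℝ), 0 ≤ r → ENNReal.ofReal ((x : ℝ) ^ r) = (x : ℝ≥0∞) ^ r := by
    intro x r hr
    rw [← ENNReal.ofReal_rpow_of_nonneg x.coe_nonneg hr, e]
  have e3 : ∀ x : ℝ, ENNReal.ofReal (x / 2) = ENNReal.ofReal x / 2 := fun x => by
    rw [ENNReal.ofReal_div_of_pos (by norm_num)]; norm_num
  rw [ENNReal.ofReal_add (by positivity) (by positivity),
    ENNReal.ofReal_mul hc₁, ENNReal.ofReal_mul hc₂, ENNReal.ofReal_mul (by positivity),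
    ENNReal.ofReal_add (by positivity) (by positivity),
    ENNReal.ofReal_add (by positivity) (by positivity),
    ENNReal.ofReal_mul (by positivity), ENNReal.ofReal_mul (by positivity),
    ENNReal.ofReal_mul (by positivity), ENNReal.ofReal_mul (by positivity),
    ← ENNReal.ofReal_rpow_of_nonneg (by positivity) (by positivity),
    ← ENNReal.ofReal_rpow_of_nonneg (by positivity) (by positivity),
    e3, e3, ENNReal.ofReal_add (by positivity) (by positivity),
    ENNReal.ofReal_add (by positivity) (by positivity), e2 _ _ (by norm_num), e2 _ _ (by norm_num),
    e2 _ _ hq0.le, e2 _ _ hq0.le, e, e, e, e] at h'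
  exact h'

/-- The law of a pair of `ρ`-correlated random signs. -/
def correlatedSigns {H : Type*} [MeasurableSpace H] (ρ : ℝ) (h : ℝ → ℝ → H) : Measure H :=
  ENNReal.ofReal ((1 + ρ) / 4) • (Measure.dirac (h 1 1) + Measure.dirac (h (-1) (-1))) +
    ENNReal.ofReal ((1 - ρ) / 4) • (Measure.dirac (h 1 (-1)) + Measure.dirac (h (-1) 1))

theorem isProbabilityMeasure_correlatedSigns {H : Type*} [MeasurableSpace H] {ρ : ℝ}
    (hρ0 : 0 ≤ ρ) (hρ1 : ρ ≤ 1) (h : ℝ → ℝ → H) :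
    IsProbabilityMeasure (correlatedSigns ρ h) := by
  constructor
  simp only [correlatedSigns, Measure.coe_add, Measure.coe_smul, Pi.add_apply, Pi.smul_apply,
    measure_univ, smul_eq_mul]
  rw [← add_mul, ← ENNReal.ofReal_add (by linarith) (by linarith),
    show (1 + ρ) / 4 + (1 - ρ) / 4 = 1 / 2 by ring, one_add_one_eq_two, one_div,
    ENNReal.ofReal_inv_of_pos (by norm_num)]
  simp [ENNReal.inv_mul_cancel]

theorem lintegral_correlatedSigns {H : Type*} [MeasurableSpace H] (ρ : ℝ) (h : ℝ → ℝ → H)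
    {φ : H → ℝ≥0∞} (hφ : Measurable φ) :
    ∫⁻ x, φ x ∂(correlatedSigns ρ h) =
      ENNReal.ofReal ((1 + ρ) / 4) * (φ (h 1 1) + φ (h (-1) (-1))) +
        ENNReal.ofReal ((1 - ρ) / 4) * (φ (h 1 (-1)) + φ (h (-1) 1)) := by
  simp [correlatedSigns, lintegral_dirac' _ hφ, mul_add]

theorem hypercontractivePair_correlatedSigns {H E : Type*} [MeasurableSpace H] [MeasurableSpace E]
    {q ρ : ℝ} (hq1 : 1 < q) (hq2 : q < 2) (hρ0 : 0 ≤ ρ) (hρ : ρ ^ 2 = q - 1)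
    {A B : H → E} (hA : Measurable A) (hB : Measurable B) (h : ℝ → ℝ → H) (a : ℝ → E)
    (hAh : ∀ x y, A (h x y) = a x) (hBh : ∀ x y, B (h x y) = a y) :
    HypercontractivePair (correlatedSigns ρ h) A B q := by
  intro f g hf hg
  have hρ1 : ρ < 1 := by nlinarith
  rw [lintegral_correlatedSigns _ _ (by fun_prop), lintegral_correlatedSigns _ _ (by fun_prop),
    lintegral_correlatedSigns _ _ (by fun_prop)]
  simp only [hAh, hBh]
  refine (ennreal_two_point_bilinear hq1 hq2 hρ0 hρ _ _ _ _).trans (le_of_eq ?_)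
  have key : ∀ x y : ℝ≥0∞, (x + y) / 2 =
      ENNReal.ofReal ((1 + ρ) / 4) * (x + y) + ENNReal.ofReal ((1 - ρ) / 4) * (x + y) := by
    intro x y
    rw [← add_mul, ← ENNReal.ofReal_add (by linarith) (by linarith),
      show (1 + ρ) / 4 + (1 - ρ) / 4 = 2⁻¹ by ring, ENNReal.ofReal_inv_of_pos (by norm_num),
      div_eq_mul_inv, mul_comm]
    simp
  rw [key, key, add_comm (g (a (-1)) ^ q) (g (a 1) ^ q)]

theorem tendsto_mul_cos_div_sqrt_sub_one (x : ℝ) :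
    Filter.Tendsto (fun n : ℕ => (n : ℝ) * (Real.cos (x / √n) - 1)) Filter.atTop
      (𝓝 (-(x ^ 2) / 2)) := by
  have h0 : Filter.Tendsto (fun n : ℕ => x ^ 4 / (n : ℝ)) Filter.atTop (𝓝 0) :=
    tendsto_const_div_atTop_nhds_zero_nat _
  rw [tendsto_iff_norm_sub_tendsto_zero]
  refine squeeze_zero' (Filter.Eventually.of_forall fun _ => norm_nonneg _) ?_ h0
  filter_upwards [Filter.eventually_ge_atTop (max 1 ⌈x ^ 2⌉₊)] with n hn
  have hn1 : (1 : ℝ) ≤ n := by exact_mod_cast (le_max_left _ _).trans hn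
  have hn2 : x ^ 2 ≤ n := Nat.ceil_le.1 ((le_max_right _ _).trans hn)
  have hn0 : (0 : ℝ) < n := by linarith
  have hs : √(n : ℝ) ^ 2 = n := Real.sq_sqrt hn0.le
  have hy : |x / √n| ≤ 1 := by
    rw [← sq_le_one_iff_abs_le_one, div_pow, hs, div_le_one hn0]
    exact hn2
  have hb := Real.cos_bound hy
  have e4 : |x / √n| ^ 4 = x ^ 4 / n ^ 2 := by
    rw [show 4 = 2 * 2 from rfl, pow_mul, sq_abs, div_pow, hs, div_pow, ← pow_mul]
  rw [e4, div_pow, hs] at hb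
  have e : (n : ℝ) * (Real.cos (x / √n) - 1) - -(x ^ 2) / 2 =
      n * (Real.cos (x / √n) - (1 - x ^ 2 / n / 2)) := by
    field_simp
    ring
  rw [e, Real.norm_eq_abs, abs_mul, abs_of_pos hn0]
  refine (mul_le_mul_of_nonneg_left hb hn0.le).trans ?_
  have : 0 ≤ x ^ 4 / (n : ℝ) := by positivity
  calc (n : ℝ) * (x ^ 4 / n ^ 2 * (5 / 96)) = x ^ 4 / n * (5 / 96) := by field_simp
    _ ≤ x ^ 4 / n := by linarith

theorem charFun_correlatedSigns {H : Type*} [NormedAddCommGroup H] [InnerProductSpace ℝ H]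
    [MeasurableSpace H] [BorelSpace H] [SecondCountableTopology H] {ρ : ℝ}
    (hρ0 : 0 ≤ ρ) (hρ1 : ρ ≤ 1) (h : ℝ → ℝ → H) (t : H) (a b : ℝ)
    (hh : ∀ x y, inner ℝ (h x y) t = x * a + y * b) :
    charFun (correlatedSigns ρ h) t =
      ((1 + ρ) / 2 * Real.cos (a + b) + (1 - ρ) / 2 * Real.cos (a - b) : ℝ) := by
  rw [charFun_apply, correlatedSigns]
  have hi : ∀ x : H, Integrable (fun y : H => Complex.exp ((inner ℝ y t : ℝ) * Complex.I))
      (Measure.dirac x) := fun x => by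
    refine Integrable.of_bound (by fun_prop) 1 (Filter.Eventually.of_forall fun y => ?_)
    rw [Complex.norm_exp_ofReal_mul_I]
  rw [integral_add_measure, integral_smul_measure, integral_smul_measure,
    integral_add_measure (hi _) (hi _), integral_add_measure (hi _) (hi _)]
  · simp only [integral_dirac, hh]
    rw [ENNReal.toReal_ofReal (by linarith), ENNReal.toReal_ofReal (by linarith)]
    push_cast
    rw [Complex.cos, Complex.cos, Complex.real_smul, Complex.real_smul]
    push_cast
    ring_nf
  · exact ((hi _).add_measure (hi _)).smul_measure ENNReal.ofReal_ne_top
  · exact ((hi _).add_measure (hi _)).smul_measure ENNReal.ofReal_ne_top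

/-- The law of a pair of `ρ`-correlated standard Gaussian vectors. -/
def correlatedGaussian (d : ℕ) (ρ : ℝ) : Measure (WithLp 2 (Euc d × Euc d)) :=
  ((ProbabilityTheory.stdGaussian (Euc d)).prod (ProbabilityTheory.stdGaussian (Euc d))).map
    fun q => WithLp.toLp 2 (ρ • q.1 + √(1 - ρ ^ 2) • q.2, q.1)

instance (d : ℕ) (ρ : ℝ) : IsProbabilityMeasure (correlatedGaussian d ρ) :=
  Measure.isProbabilityMeasure_map (by fun_prop)

theorem charFun_correlatedGaussian {d : ℕ} {ρ : ℝ} (hρ : ρ ^ 2 ≤ 1)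
    (t : WithLp 2 (Euc d × Euc d)) :
    charFun (correlatedGaussian d ρ) t =
      Complex.exp (-(‖t.fst‖ ^ 2 + ‖t.snd‖ ^ 2 + 2 * ρ * inner ℝ t.fst t.snd : ℝ) / 2) := by
  rw [correlatedGaussian, charFun_apply, integral_map (by fun_prop) (by fun_prop)]
  have hs : √(1 - ρ ^ 2) ^ 2 = 1 - ρ ^ 2 := Real.sq_sqrt (by linarith)
  have h := integral_cexp_inner_stdGaussian_prod (ρ • t.fst + t.snd) (√(1 - ρ ^ 2) • t.fst)
  have e : ∀ q : Euc d × Euc d,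
      inner ℝ (WithLp.toLp 2 (ρ • q.1 + √(1 - ρ ^ 2) • q.2, q.1)) t =
      inner ℝ q.1 (ρ • t.fst + t.snd) + inner ℝ q.2 (√(1 - ρ ^ 2) • t.fst) := by
    intro q
    rw [WithLp.prod_inner_apply]
    simp only [WithLp.ofLp_fst, WithLp.ofLp_snd, inner_add_left, inner_add_right,
      inner_smul_left, inner_smul_right]
    simp
    ring
  simp only [e, h]
  rw [← Complex.ofReal_pow, ← Complex.ofReal_pow]
  congr 2
  rw [← Complex.ofReal_add]
  congr 2
  rw [norm_add_sq_real, norm_smul, norm_smul, mul_pow, mul_pow, inner_smul_left]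
  simp only [Real.norm_eq_abs, sq_abs, hs]
  simp
  ring

theorem tendsto_lintegral_of_le_of_tendsto {Ω : Type*} [MeasurableSpace Ω] [TopologicalSpace Ω]
    [OpensMeasurableSpace Ω] {μ : ℕ → ProbabilityMeasure Ω} {μ₀ : ProbabilityMeasure Ω}
    (h : Filter.Tendsto μ Filter.atTop (𝓝 μ₀)) {F : Ω → ℝ≥0} {C : ℝ≥0} (hF : Continuous F)
    (hC : ∀ x, F x ≤ C) :
    Filter.Tendsto (fun n => ∫⁻ x, F x ∂(μ n : Measure Ω)) Filter.atTop
      (𝓝 (∫⁻ x, F x ∂(μ₀ : Measure Ω))) :=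
  ProbabilityMeasure.tendsto_iff_forall_lintegral_tendsto.1 h
    (BoundedContinuousFunction.mkOfBound ⟨F, hF⟩ C fun x y => by
      rw [NNReal.dist_eq, abs_sub_le_iff]
      have h1 := NNReal.coe_le_coe.2 (hC x)
      have h2 := NNReal.coe_le_coe.2 (hC y)
      simp only [ContinuousMap.coe_mk]
      exact ⟨by linarith [(F y).coe_nonneg], by linarith [(F x).coe_nonneg]⟩)

theorem hypercontractive_boundedContinuous {d : ℕ} {q ρ : ℝ} (hq1 : 1 < q) (hq2 : q < 2)
    (hρ0 : 0 ≤ ρ) (hρ : ρ ^ 2 = q - 1) {f g : Euc d → ℝ≥0} {Cf Cg : ℝ≥0}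
    (hfc : Continuous f) (hgc : Continuous g) (hf : ∀ x, f x ≤ Cf) (hg : ∀ x, g x ≤ Cg) :
    ∫⁻ h, f h.fst * g h.snd ∂(correlatedGaussian d ρ) ≤
      (∫⁻ h, (f h.fst : ℝ≥0∞) ^ (2 : ℝ) ∂(correlatedGaussian d ρ)) ^ (1 / 2 : ℝ) *
        (∫⁻ h, (g h.snd : ℝ≥0∞) ^ q ∂(correlatedGaussian d ρ)) ^ (1 / q) := by
  have hρ1 : ρ < 1 := by nlinarith
  have hq0 : 0 < q := by linarith
  let A := WithLp.fstL 2 ℝ (Euc d) (Euc d)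
  let B := WithLp.sndL 2 ℝ (Euc d) (Euc d)
  let φ : ℕ → Fin d → WithLp 2 (Euc d × Euc d) → ℂ := fun n i t =>
    (((1 + ρ) / 2 * Real.cos ((t.fst i + t.snd i) / √n) +
      (1 - ρ) / 2 * Real.cos ((t.fst i - t.snd i) / √n) : ℝ) : ℂ)
  have hφ : ∀ n i, ∃ μ : Measure (WithLp 2 (Euc d × Euc d)), IsProbabilityMeasure μ ∧
      HypercontractivePair μ A B q ∧ ∀ t, charFun μ t = φ n i t ^ n := by
    intro n i
    let e : Euc d := (1 / √n : ℝ) • EuclideanSpace.single i 1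
    let h : ℝ → ℝ → WithLp 2 (Euc d × Euc d) := fun x y => WithLp.toLp 2 (x • e, y • e)
    have := isProbabilityMeasure_correlatedSigns hρ0 hρ1.le h
    have hh := hypercontractivePair_correlatedSigns hq1 hq2 hρ0 hρ (A := A) (B := B)
      (by fun_prop) (by fun_prop) h (fun x => x • e) (fun _ _ => rfl) (fun _ _ => rfl)
    obtain ⟨μ, h1, h2, h3⟩ := hh.exists_charFun_pow hq1 n
    refine ⟨μ, h1, h2, fun t => ?_⟩
    rw [h3, charFun_correlatedSigns hρ0 hρ1.le h t (t.fst i / √n) (t.snd i / √n)]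
    · simp only [φ, add_div, sub_div]
    · intro x y
      rw [WithLp.prod_inner_apply]
      simp only [h, e, inner_smul_left]
      simp [EuclideanSpace.inner_single_left]
      ring
  choose μ hμ1 hμ2 hμ3 using fun n =>
    HypercontractivePair.exists_charFun_prod (A := A) (B := B) hq1 Finset.univ
      (fun i t => φ n i t ^ n) (hφ n)
  have hlim : ∀ t, Filter.Tendsto (fun n => charFun (μ n) t) Filter.atTop
      (𝓝 (charFun (correlatedGaussian d ρ) t)) := by
    intro t
    simp only [hμ3]
    rw [charFun_correlatedGaussian (by nlinarith)]
    have h1 : ∀ i, Filter.Tendsto (fun n => φ n i t ^ n) Filter.atTop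
        (𝓝 ((Real.exp (-(t.fst i ^ 2 + t.snd i ^ 2 + 2 * ρ * (t.fst i * t.snd i)) / 2) : ℝ) : ℂ)) := by
      intro i
      simp only [φ, ← Complex.ofReal_pow]
      refine (Complex.continuous_ofReal.tendsto _).comp ?_
      have h2 := ((tendsto_mul_cos_div_sqrt_sub_one (t.fst i + t.snd i)).const_mul
        ((1 + ρ) / 2)).add ((tendsto_mul_cos_div_sqrt_sub_one (t.fst i - t.snd i)).const_mul
        ((1 - ρ) / 2))
      have h3 := Real.tendsto_one_add_pow_exp_of_tendsto
        (g := fun n : ℕ => (1 + ρ) / 2 * (Real.cos ((t.fst i + t.snd i) / √n) - 1) +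
          (1 - ρ) / 2 * (Real.cos ((t.fst i - t.snd i) / √n) - 1))
        (h2.congr fun n => by ring)
      convert h3 using 2
      · ring
      · congr 1; ring
    have h4 := tendsto_finsetProd Finset.univ fun i _ => h1 i
    convert h4 using 2
    rw [← Complex.ofReal_prod, ← Real.exp_sum, Complex.ofReal_exp]
    congr 1
    rw [EuclideanSpace.norm_sq_eq, EuclideanSpace.norm_sq_eq, PiLp.inner_apply]
    simp only [Real.norm_eq_abs, sq_abs, ← Finset.sum_div, Finset.sum_neg_distrib,
      Finset.sum_add_distrib, ← Finset.mul_sum]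
    push_cast
    congr 4
    refine congrArg _ (funext fun i => ?_)
    simp [mul_comm]
  have hw : Filter.Tendsto (β := ProbabilityMeasure (WithLp 2 (Euc d × Euc d)))
      (fun n => ⟨μ n, hμ1 n⟩) Filter.atTop (𝓝 ⟨correlatedGaussian d ρ, inferInstance⟩) :=
    ProbabilityMeasure.tendsto_of_tendsto_charFun hlim
  have l1 := tendsto_lintegral_of_le_of_tendsto hw (F := fun h => f h.fst * g h.snd)
    (C := Cf * Cg) (by fun_prop) (fun x => mul_le_mul' (hf _) (hg _))
  have l2 := tendsto_lintegral_of_le_of_tendsto hw (F := fun h => f h.fst ^ (2 : ℝ))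
    (C := Cf ^ (2 : ℝ)) ((NNReal.continuous_rpow_const (by norm_num)).comp (by fun_prop))
      (fun x => NNReal.rpow_le_rpow (hf _) (by norm_num))
  have l3 := tendsto_lintegral_of_le_of_tendsto hw (F := fun h => g h.snd ^ q)
    (C := Cg ^ q) ((NNReal.continuous_rpow_const hq0.le).comp (by fun_prop))
      (fun x => NNReal.rpow_le_rpow (hg _) hq0.le)
  simp only [ENNReal.coe_rpow_of_nonneg _ hq0.le, ENNReal.coe_mul,
    ENNReal.coe_rpow_of_nonneg _ (zero_le_two (α := ℝ)), ProbabilityMeasure.coe_mk] at l1 l2 l3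
  have fin : ∀ (F : WithLp 2 (Euc d × Euc d) → ℝ≥0) (C : ℝ≥0) (r : ℝ), 0 ≤ r → (∀ x, F x ≤ C) →
      (∫⁻ h, (F h : ℝ≥0∞) ^ r ∂(correlatedGaussian d ρ)) ^ (1 / r) ≠ ⊤ := by
    intro F C r hr hF
    refine ENNReal.rpow_ne_top_of_nonneg (by positivity) (ne_top_of_le_ne_top
      (ENNReal.rpow_ne_top_of_nonneg hr (ENNReal.coe_ne_top (r := C)))
      ((lintegral_mono fun x => ENNReal.rpow_le_rpow (ENNReal.coe_le_coe.2 (hF x)) hr).trans ?_))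
    simp
  refine le_of_tendsto_of_tendsto' l1 (ENNReal.Tendsto.mul (l2.ennrpow_const _) ?_
    (l3.ennrpow_const _) ?_) fun n => hμ2 n (fun x => f x) (fun x => g x)
      (by fun_prop) (by fun_prop)
  · exact Or.inr (fin (fun h => g h.snd) Cg q hq0.le fun _ => hg _)
  · exact Or.inr (fin (fun h => f h.fst) Cf 2 (by norm_num) fun _ => hf _)

/-- Approximation in `L^r` norm and almost everywhere by bounded continuous functions. -/
theorem exists_seq_continuous_approx {d : ℕ} {r : ℝ} (hr : 1 ≤ r) (μ : Measure (Euc d))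
    [IsProbabilityMeasure μ] {f : Euc d → ℝ≥0∞} (hf : Measurable f)
    (hfin : ∫⁻ x, f x ^ r ∂μ ≠ ⊤) :
    ∃ (F : ℕ → Euc d → ℝ≥0) (C : ℕ → ℝ≥0), (∀ n, Continuous (F n)) ∧ (∀ n x, F n x ≤ C n) ∧
      (∀ᵐ x ∂μ, Filter.Tendsto (fun n => (F n x : ℝ≥0∞)) Filter.atTop (𝓝 (f x))) ∧
      ∀ n, (∫⁻ x, (F n x : ℝ≥0∞) ^ r ∂μ) ^ (1 / r) ≤
        (∫⁻ x, f x ^ r ∂μ) ^ (1 / r) + ((n : ℝ≥0∞) + 1)⁻¹ := by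
  have hr0 : 0 < r := by linarith
  have hft : ∀ᵐ x ∂μ, f x ≠ ⊤ := by
    filter_upwards [ae_lt_top (by fun_prop) hfin] with x hx h
    rw [h, ENNReal.top_rpow_of_pos hr0] at hx
    exact lt_irrefl _ hx
  have hp0 : ENNReal.ofReal r ≠ 0 := by simpa using hr0
  have hnorm : ∀ g : Euc d → ℝ, eLpNorm g (ENNReal.ofReal r) μ =
      (∫⁻ x, ‖g x‖ₑ ^ r ∂μ) ^ (1 / r) := fun g => by
    rw [eLpNorm_eq_lintegral_rpow_enorm_toReal hp0 (by simp), ENNReal.toReal_ofReal hr0.le]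
  have hm : AEStronglyMeasurable (fun x => (f x).toReal) μ :=
    hf.ennreal_toReal.aestronglyMeasurable
  have hfe : eLpNorm (fun x => (f x).toReal) (ENNReal.ofReal r) μ =
      (∫⁻ x, f x ^ r ∂μ) ^ (1 / r) := by
    rw [hnorm]
    congr 1
    refine lintegral_congr_ae ?_
    filter_upwards [hft] with x hx
    rw [Real.enorm_eq_ofReal ENNReal.toReal_nonneg, ENNReal.ofReal_toReal hx]
  have hmem : MemLp (fun x => (f x).toReal) (ENNReal.ofReal r) μ := by
    refine ⟨hm, ?_⟩
    rw [hfe]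
    exact (ENNReal.rpow_ne_top_of_nonneg (by positivity) hfin).lt_top
  have hex : ∀ n : ℕ, ∃ g : BoundedContinuousFunction (Euc d) ℝ,
      eLpNorm ((fun x => (f x).toReal) - ⇑g) (ENNReal.ofReal r) μ ≤ ((n : ℝ≥0∞) + 1)⁻¹ := fun n =>
    let ⟨g, hg, _⟩ := hmem.exists_boundedContinuous_eLpNorm_sub_le (by simp)
      (show ((n : ℝ≥0∞) + 1)⁻¹ ≠ 0 by simp)
    ⟨g, hg⟩
  choose g hg using hex
  have htm : TendstoInMeasure μ (fun n => ⇑(g n)) Filter.atTop (fun x => (f x).toReal) := by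
    refine tendstoInMeasure_of_tendsto_eLpNorm hp0 (fun n => by fun_prop) hm ?_
    refine tendsto_of_tendsto_of_tendsto_of_le_of_le tendsto_const_nhds
      (ENNReal.tendsto_inv_nat_nhds_zero.comp (Filter.tendsto_add_atTop_nat 1)) (fun _ => zero_le)
      fun n => ?_
    rw [eLpNorm_sub_comm]
    simpa using hg n
  obtain ⟨ns, hns, hae⟩ := htm.exists_seq_tendsto_ae
  refine ⟨fun n x => (g (ns n) x).toNNReal, fun n => ‖g (ns n)‖.toNNReal, fun n => ?_,
    fun n x => ?_, ?_, fun n => ?_⟩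
  · exact continuous_real_toNNReal.comp (g (ns n)).continuous
  · exact Real.toNNReal_le_toNNReal ((le_abs_self _).trans ((g (ns n)).norm_coe_le_norm x))
  · filter_upwards [hae, hft] with x hx hx'
    have := ENNReal.tendsto_ofReal hx
    rw [ENNReal.ofReal_toReal hx'] at this
    exact this
  · calc (∫⁻ x, (((g (ns n) x).toNNReal : ℝ≥0) : ℝ≥0∞) ^ r ∂μ) ^ (1 / r)
        ≤ (∫⁻ x, ‖g (ns n) x‖ₑ ^ r ∂μ) ^ (1 / r) := by
          gcongr with x
          exact (ENNReal.ofReal_le_ofReal (le_abs_self _)).trans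
            (Real.enorm_eq_ofReal_abs _).ge
      _ = eLpNorm (g (ns n)) (ENNReal.ofReal r) μ := (hnorm _).symm
      _ = eLpNorm ((fun x => (f x).toReal) - ((fun x => (f x).toReal) - ⇑(g (ns n))))
            (ENNReal.ofReal r) μ := by rw [sub_sub_cancel]
      _ ≤ _ := eLpNorm_sub_le hm (hm.sub (by fun_prop)) (by simpa using hr)
      _ ≤ _ := by
        rw [hfe]
        gcongr
        refine (hg _).trans ?_
        gcongr
        exact hns.le_apply

theorem correlatedGaussian_map_fst {d : ℕ} {ρ : ℝ} (hρ : ρ ^ 2 ≤ 1) :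
    (correlatedGaussian d ρ).map (fun h => h.fst) = ProbabilityTheory.stdGaussian (Euc d) := by
  rw [correlatedGaussian, Measure.map_map (by fun_prop) (by fun_prop)]
  exact stdGaussian_prod_map_combination ρ √(1 - ρ ^ 2)
    (by rw [Real.sq_sqrt (by linarith)]; ring)

theorem correlatedGaussian_map_snd {d : ℕ} {ρ : ℝ} :
    (correlatedGaussian d ρ).map (fun h => h.snd) = ProbabilityTheory.stdGaussian (Euc d) := by
  rw [correlatedGaussian, Measure.map_map (by fun_prop) (by fun_prop)]
  exact Measure.map_fst_prod.trans (by simp)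

/-- Gaussian hypercontractivity, in bilinear form. -/
theorem hypercontractive_correlatedGaussian {d : ℕ} {q ρ : ℝ} (hq1 : 1 < q) (hq2 : q < 2)
    (hρ0 : 0 ≤ ρ) (hρ : ρ ^ 2 = q - 1) {f g : Euc d → ℝ≥0∞} (hf : Measurable f)
    (hg : Measurable g) :
    ∫⁻ h, f h.fst * g h.snd ∂(correlatedGaussian d ρ) ≤
      (∫⁻ x, f x ^ (2 : ℝ) ∂(ProbabilityTheory.stdGaussian (Euc d))) ^ (1 / 2 : ℝ) *
        (∫⁻ x, g x ^ q ∂(ProbabilityTheory.stdGaussian (Euc d))) ^ (1 / q) := by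
  have hq0 : 0 < q := by linarith
  have hm1 := correlatedGaussian_map_fst (d := d) (ρ := ρ) (by linarith)
  have hm2 := correlatedGaussian_map_snd (d := d) (ρ := ρ)
  have mf : Measurable fun h : WithLp 2 (Euc d × Euc d) => h.fst := by fun_prop
  have ms : Measurable fun h : WithLp 2 (Euc d × Euc d) => h.snd := by fun_prop
  have zero : ∀ {r : ℝ}, 0 < r → ∀ {u : Euc d → ℝ≥0∞}, Measurable u →
      ∫⁻ x, u x ^ r ∂(ProbabilityTheory.stdGaussian (Euc d)) = 0 →
      ∀ᵐ x ∂(ProbabilityTheory.stdGaussian (Euc d)), u x = 0 := by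
    intro r hr u hu h
    filter_upwards [(lintegral_eq_zero_iff (by fun_prop)).1 h] with x hx
    simpa [hr, hr.le, not_lt.2 hr.le] using hx
  by_cases hf0 : ∫⁻ x, f x ^ (2 : ℝ) ∂(ProbabilityTheory.stdGaussian (Euc d)) = 0
  · have h1 := zero two_pos hf hf0
    rw [← hm1] at h1
    rw [lintegral_congr_ae (g := fun _ => 0)]
    · simp
    · filter_upwards [ae_of_ae_map mf.aemeasurable h1] with h hh
      simp [hh]
  by_cases hg0 : ∫⁻ x, g x ^ q ∂(ProbabilityTheory.stdGaussian (Euc d)) = 0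
  · have h1 := zero hq0 hg hg0
    rw [← hm2] at h1
    rw [lintegral_congr_ae (g := fun _ => 0)]
    · simp
    · filter_upwards [ae_of_ae_map ms.aemeasurable h1] with h hh
      simp [hh]
  by_cases hft : ∫⁻ x, f x ^ (2 : ℝ) ∂(ProbabilityTheory.stdGaussian (Euc d)) = ⊤
  · rw [hft, ENNReal.top_rpow_of_pos (by norm_num), ENNReal.top_mul]
    · exact le_top
    · exact fun h => hg0 ((ENNReal.rpow_eq_zero_iff_of_pos (by positivity)).1 h)
  by_cases hgt : ∫⁻ x, g x ^ q ∂(ProbabilityTheory.stdGaussian (Euc d)) = ⊤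
  · rw [hgt, ENNReal.top_rpow_of_pos (by positivity), ENNReal.mul_top]
    · exact le_top
    · exact fun h => hf0 ((ENNReal.rpow_eq_zero_iff_of_pos (by norm_num)).1 h)
  obtain ⟨F, CF, hF1, hF2, hF3, hF4⟩ := exists_seq_continuous_approx one_le_two _ hf hft
  obtain ⟨G, CG, hG1, hG2, hG3, hG4⟩ := exists_seq_continuous_approx hq1.le _ hg hgt
  have fin : ∀ {r : ℝ}, 0 < r → ∀ {u : Euc d → ℝ≥0∞}, Measurable u →
      ∫⁻ x, u x ^ r ∂(ProbabilityTheory.stdGaussian (Euc d)) ≠ ⊤ →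
      ∀ᵐ x ∂(ProbabilityTheory.stdGaussian (Euc d)), u x ≠ ⊤ := by
    intro r hr u hu h
    filter_upwards [ae_lt_top (by fun_prop) h] with x hx h
    rw [h, ENNReal.top_rpow_of_pos hr] at hx
    exact lt_irrefl _ hx
  have hf' := (fin two_pos hf hft).and hF3
  have hg' := (fin hq0 hg hgt).and hG3
  rw [← hm1] at hf'
  rw [← hm2] at hg'
  have h1 : ∫⁻ h, f h.fst * g h.snd ∂(correlatedGaussian d ρ) =
      ∫⁻ h, Filter.liminf (fun n => (F n h.fst : ℝ≥0∞) * G n h.snd) Filter.atTop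
        ∂(correlatedGaussian d ρ) := by
    refine lintegral_congr_ae ?_
    filter_upwards [ae_of_ae_map mf.aemeasurable hf', ae_of_ae_map ms.aemeasurable hg'] with h a b
    exact ((ENNReal.Tendsto.mul a.2 (Or.inr b.1) b.2 (Or.inr a.1)).liminf_eq).symm
  have hinv : Filter.Tendsto (fun n : ℕ => ((n : ℝ≥0∞) + 1)⁻¹) Filter.atTop (𝓝 0) := by
    simpa [Function.comp_def] using
      ENNReal.tendsto_inv_nat_nhds_zero.comp (Filter.tendsto_add_atTop_nat 1)
  have hlim : Filter.Tendsto (fun n : ℕ =>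
      ((∫⁻ x, f x ^ (2 : ℝ) ∂(ProbabilityTheory.stdGaussian (Euc d))) ^ (1 / 2 : ℝ) +
        ((n : ℝ≥0∞) + 1)⁻¹) * ((∫⁻ x, g x ^ q ∂(ProbabilityTheory.stdGaussian (Euc d))) ^ (1 / q) +
        ((n : ℝ≥0∞) + 1)⁻¹)) Filter.atTop
      (𝓝 ((∫⁻ x, f x ^ (2 : ℝ) ∂(ProbabilityTheory.stdGaussian (Euc d))) ^ (1 / 2 : ℝ) *
        (∫⁻ x, g x ^ q ∂(ProbabilityTheory.stdGaussian (Euc d))) ^ (1 / q))) := by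
    have a := (tendsto_const_nhds (x := (∫⁻ x, f x ^ (2 : ℝ)
      ∂(ProbabilityTheory.stdGaussian (Euc d))) ^ (1 / 2 : ℝ))).add hinv
    have b := (tendsto_const_nhds (x := (∫⁻ x, g x ^ q
      ∂(ProbabilityTheory.stdGaussian (Euc d))) ^ (1 / q))).add hinv
    rw [add_zero] at a b
    exact ENNReal.Tendsto.mul a (Or.inr (ENNReal.rpow_ne_top_of_nonneg (by positivity) hgt)) b
      (Or.inr (ENNReal.rpow_ne_top_of_nonneg (by norm_num) hft))
  rw [h1, ← hlim.liminf_eq]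
  refine (lintegral_liminf_le fun n => ?_).trans (Filter.liminf_le_liminf
    (Filter.Eventually.of_forall fun n => ?_))
  · have := (hF1 n).measurable
    have := (hG1 n).measurable
    fun_prop
  · refine (hypercontractive_boundedContinuous hq1 hq2 hρ0 hρ (hF1 n) (hG1 n) (hF2 n)
      (hG2 n)).trans (mul_le_mul' ?_ ?_)
    · have := (hF1 n).measurable
      rw [← lintegral_map (f := fun x => (F n x : ℝ≥0∞) ^ (2 : ℝ)) (by fun_prop) mf, hm1]
      exact hF4 n
    · have := (hG1 n).measurable
      rw [← lintegral_map (f := fun x => (G n x : ℝ≥0∞) ^ q) (by fun_prop) ms, hm2]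
      exact hG4 n

/-- Gaussian hypercontractivity of the Mehler semigroup from `L²` to `L^p`. -/
theorem hypercontractive_mehler {d : ℕ} {p : ℝ} (hp : 2 < p) {W : Euc d → ℝ≥0∞}
    (hW : Measurable W) :
    (∫⁻ z, (∫⁻ z', W ((1 / √(p - 1)) • z + √(1 - (1 / √(p - 1)) ^ 2) • z')
        ∂(ProbabilityTheory.stdGaussian (Euc d))) ^ p
        ∂(ProbabilityTheory.stdGaussian (Euc d))) ^ (1 / p) ≤
      (∫⁻ z, W z ^ (2 : ℝ) ∂(ProbabilityTheory.stdGaussian (Euc d))) ^ (1 / 2 : ℝ) := by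
  set ρ : ℝ := 1 / √(p - 1) with hρdef
  set γ := ProbabilityTheory.stdGaussian (Euc d) with hγ
  set A := (∫⁻ z, W z ^ (2 : ℝ) ∂γ) ^ (1 / 2 : ℝ)
  let T : Euc d → ℝ≥0∞ := fun z => ∫⁻ z', W (ρ • z + √(1 - ρ ^ 2) • z') ∂γ
  have hT : Measurable T :=
    Measurable.lintegral_prod_right'
      (f := fun q : Euc d × Euc d => W (ρ • q.1 + √(1 - ρ ^ 2) • q.2))
      (by fun_prop)
  have hp1 : 0 < p - 1 := by linarith
  have hp0 : 0 < p := by linarith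
  set q := p / (p - 1) with hq
  have hρ2 : ρ ^ 2 = q - 1 := by
    rw [hρdef, div_pow, Real.sq_sqrt hp1.le, hq]; field_simp; ring
  have hq1 : 1 < q := by rw [hq, one_lt_div hp1]; linarith
  have hq2 : q < 2 := by rw [hq, div_lt_iff₀ hp1]; linarith
  have hstep : ∀ n : ℕ, (∫⁻ z, min (T z) n ^ p ∂γ) ≤ A ^ p := by
    intro n
    have hg : Measurable fun z => min (T z) (n : ℝ≥0∞) := hT.min measurable_const
    have h := hypercontractive_correlatedGaussian hq1 hq2 (by positivity) hρ2 hW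
      (hg.pow_const (p - 1))
    have e1 : ∫⁻ h, W h.fst * min (T h.snd) n ^ (p - 1) ∂(correlatedGaussian d ρ) =
        ∫⁻ z, T z * min (T z) n ^ (p - 1) ∂γ := by
      rw [correlatedGaussian, lintegral_map (by fun_prop) (by fun_prop),
        lintegral_prod _ (by fun_prop)]
      refine lintegral_congr fun z => ?_
      exact lintegral_mul_const (μ := γ) (min (T z) n ^ (p - 1))
        (f := fun z' => W (ρ • z + √(1 - ρ ^ 2) • z')) (by fun_prop)
    rw [e1] at h
    simp only [← ENNReal.rpow_mul] at h
    rw [show (p - 1) * q = p by rw [hq]; field_simp, ← hγ] at h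
    have h2 : (∫⁻ z, min (T z) n ^ p ∂γ) ≤ ∫⁻ z, T z * min (T z) n ^ (p - 1) ∂γ := by
      refine lintegral_mono fun z => ?_
      calc min (T z) (n : ℝ≥0∞) ^ p = min (T z) n ^ ((1 : ℝ) + (p - 1)) := by ring_nf
        _ = min (T z) n * min (T z) n ^ (p - 1) := by
          rw [ENNReal.rpow_add_of_nonneg _ _ zero_le_one hp1.le, ENNReal.rpow_one]
        _ ≤ _ := by gcongr; exact min_le_left _ _
    have h3 := h2.trans h
    set m := ∫⁻ z, min (T z) n ^ p ∂γ with hm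
    have hmt : m ≠ ⊤ := by
      refine ne_top_of_le_ne_top (ENNReal.rpow_ne_top_of_nonneg hp0.le
        (ENNReal.natCast_ne_top n)) ((lintegral_mono fun z =>
          ENNReal.rpow_le_rpow (min_le_right (T z) (n : ℝ≥0∞)) hp0.le).trans ?_)
      simp
    by_cases hm0 : m = 0
    · rw [hm0]; exact zero_le
    have hk : m ^ (1 / p) * m ^ (1 / q) ≤ A * m ^ (1 / q) := by
      rw [← ENNReal.rpow_add _ _ hm0 hmt, show 1 / p + 1 / q = 1 by rw [hq]; field_simp; ring,
        ENNReal.rpow_one]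
      exact h3
    have hk' := (ENNReal.mul_le_mul_iff_left (by simp [hm0, hmt, ENNReal.rpow_eq_zero_iff])
      (ENNReal.rpow_ne_top_of_nonneg (by positivity) hmt)).1 hk
    calc m = (m ^ (1 / p)) ^ p := by
          rw [← ENNReal.rpow_mul, one_div_mul_cancel hp0.ne', ENNReal.rpow_one]
      _ ≤ A ^ p := ENNReal.rpow_le_rpow hk' hp0.le
  have hlim : Filter.Tendsto (fun n : ℕ => ∫⁻ z, min (T z) n ^ p ∂γ) Filter.atTop
      (𝓝 (∫⁻ z, T z ^ p ∂γ)) := by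
    refine lintegral_tendsto_of_tendsto_of_monotone
      (fun n => ((hT.min measurable_const).pow_const p).aemeasurable)
      (Filter.Eventually.of_forall fun z n m hnm => ?_) (Filter.Eventually.of_forall fun z => ?_)
    · exact ENNReal.rpow_le_rpow (min_le_min le_rfl (by exact_mod_cast hnm)) hp0.le
    · refine (ENNReal.continuous_rpow_const.tendsto _).comp ?_
      have := (tendsto_const_nhds (x := T z)).min ENNReal.tendsto_nat_nhds_top
      simpa using this
  have hle := le_of_tendsto' hlim hstep
  calc (∫⁻ z, T z ^ p ∂γ) ^ (1 / p) ≤ (A ^ p) ^ (1 / p) :=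
        ENNReal.rpow_le_rpow hle (by positivity)
    _ = A := by rw [← ENNReal.rpow_mul, mul_one_div_cancel hp0.ne', ENNReal.rpow_one]

theorem eLpNorm_ofReal_rpow {α F : Type*} [MeasurableSpace α] [NormedAddCommGroup F]
    {μ : Measure α} {p : ℝ} (hp : 0 < p) (f : α → F) :
    eLpNorm f (ENNReal.ofReal p) μ ^ p = ∫⁻ x, ‖f x‖ₑ ^ p ∂μ := by
  rw [eLpNorm_eq_lintegral_rpow_enorm_toReal (by simpa using hp) (by simp),
    ENNReal.toReal_ofReal hp.le, ← ENNReal.rpow_mul, one_div_mul_cancel hp.ne', ENNReal.rpow_one]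

theorem lintegral_rpow_le_lintegral_rpow {α : Type*} [MeasurableSpace α] {μ : Measure α}
    [IsProbabilityMeasure μ] {p : ℝ} (hp : 1 ≤ p) {f : α → ℝ≥0∞} (hf : Measurable f) :
    (∫⁻ x, f x ∂μ) ^ p ≤ ∫⁻ x, f x ^ p ∂μ := by
  have hp0 : 0 < p := by linarith
  have h := eLpNorm_le_eLpNorm_of_exponent_le (μ := μ) (f := f) (p := 1) (q := ENNReal.ofReal p)
    (by simpa using hp) hf.aestronglyMeasurable
  rw [eLpNorm_one_eq_lintegral_enorm, eLpNorm_eq_lintegral_rpow_enorm_toReal (by simpa using hp0)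
    (by simp), ENNReal.toReal_ofReal hp0.le] at h
  simp only [enorm_eq_self] at h
  calc _ ≤ _ := ENNReal.rpow_le_rpow h hp0.le
    _ = _ := by rw [← ENNReal.rpow_mul, one_div_mul_cancel hp0.ne', ENNReal.rpow_one]

theorem eLpNorm_integral_kernel_le {α β F : Type*} [MeasurableSpace α] [MeasurableSpace β]
    [NormedAddCommGroup F] [NormedSpace ℝ F] {μ : Measure α}
    [SFinite μ] {k : Kernel α β} [IsMarkovKernel k] {p : ℝ} (hp : 1 ≤ p) {f : α × β → F}
    (hf : StronglyMeasurable f) :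
    eLpNorm (fun a => ∫ b, f (a, b) ∂(k a)) (ENNReal.ofReal p) μ ≤
      eLpNorm f (ENNReal.ofReal p) (μ ⊗ₘ k) := by
  have hp0 : 0 < p := by linarith
  rw [← ENNReal.rpow_le_rpow_iff hp0, eLpNorm_ofReal_rpow hp0, eLpNorm_ofReal_rpow hp0,
    Measure.lintegral_compProd (hf.enorm.pow_const p)]
  refine lintegral_mono fun a => ?_
  refine (ENNReal.rpow_le_rpow (enorm_integral_le_lintegral_enorm _) hp0.le).trans ?_
  exact lintegral_rpow_le_lintegral_rpow hp
    (hf.comp_measurable measurable_prodMk_left).enorm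

/-- Truncation of a vector at radius `R`. -/
def truncVec {d : ℕ} (R : ℝ) (y : Euc d) : Euc d := if ‖y‖ ≤ R then y else 0

theorem measurable_truncVec {d : ℕ} (R : ℝ) : Measurable (truncVec (d := d) R) :=
  Measurable.ite (measurableSet_le measurable_norm measurable_const) measurable_id measurable_const

theorem norm_truncVec_le {d : ℕ} {R : ℝ} (hR : 0 ≤ R) (y : Euc d) : ‖truncVec R y‖ ≤ R := by
  unfold truncVec
  split_ifs with h
  · exact h
  · simpa using hR

theorem integral_norm_add_smul_sub_integral_sq {d : ℕ} {μ : Measure (Euc d)}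
    [IsProbabilityMeasure μ] {T : Euc d → Euc d} (hT : Measurable T) {R : ℝ}
    (hR : ∀ y, ‖T y‖ ≤ R) (m : Euc d) (s : ℝ) :
    ∫⁻ y, ‖m + s • (T y - ∫ y, T y ∂μ)‖ₑ ^ (2 : ℝ) ∂μ ≤
      ‖m‖ₑ ^ (2 : ℝ) + ENNReal.ofReal ((s * (2 * R)) ^ 2) := by
  set b := ∫ y, T y ∂μ with hb
  have hR0 : 0 ≤ R := (norm_nonneg _).trans (hR 0)
  have hbR : ‖b‖ ≤ R := by
    simpa using norm_integral_le_of_norm_le_const (μ := μ) (Filter.Eventually.of_forall hR)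
  have hTi : Integrable T μ :=
    Integrable.of_bound (by fun_prop) R (Filter.Eventually.of_forall hR)
  have hd : ∀ y, ‖T y - b‖ ≤ 2 * R := fun y => (norm_sub_le _ _).trans (by linarith [hR y])
  have hi2 : Integrable (fun y => ‖T y - b‖ ^ 2) μ := by
    refine Integrable.of_bound (by fun_prop) ((2 * R) ^ 2) (Filter.Eventually.of_forall fun y => ?_)
    rw [norm_pow, norm_norm]
    exact pow_le_pow_left₀ (norm_nonneg _) (hd y) 2
  have hi1 : Integrable (fun y => inner ℝ m (T y - b)) μ :=
    (hTi.sub (integrable_const b)).const_inner m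
  have hexp : ∀ y, ‖m + s • (T y - b)‖ ^ 2 =
      ‖m‖ ^ 2 + (2 * s) * inner ℝ m (T y - b) + s ^ 2 * ‖T y - b‖ ^ 2 := fun y => by
    rw [norm_add_sq_real, inner_smul_right, norm_smul, mul_pow, Real.norm_eq_abs, sq_abs]
    ring
  have e2 : ∀ x : Euc d, ‖x‖ₑ ^ (2 : ℝ) = ENNReal.ofReal (‖x‖ ^ 2) := fun x => by
    rw [← ofReal_norm, ENNReal.ofReal_rpow_of_nonneg (norm_nonneg _) (by norm_num)]
    norm_num
  simp only [e2, hexp]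
  have hiA : Integrable (fun y => ‖m‖ ^ 2 + (2 * s) * inner ℝ m (T y - b)) μ :=
    (integrable_const _).add (hi1.const_mul _)
  have hiB : Integrable (fun y => ‖m‖ ^ 2 + (2 * s) * inner ℝ m (T y - b) +
      s ^ 2 * ‖T y - b‖ ^ 2) μ := hiA.add (hi2.const_mul _)
  rw [← ofReal_integral_eq_lintegral_ofReal hiB (Filter.Eventually.of_forall fun y => by
      simp only [Pi.zero_apply]; rw [← hexp]; positivity),
      ← ENNReal.ofReal_add (by positivity) (by positivity)]
  refine ENNReal.ofReal_le_ofReal ?_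
  have h0 : ∫ y, inner ℝ m (T y - b) ∂μ = 0 := by
    refine (integral_inner (f := fun y => T y - b) (hTi.sub (integrable_const b)) m).trans ?_
    rw [integral_sub hTi (integrable_const b)]
    simp [hb]
  rw [integral_add hiA (hi2.const_mul _), integral_add (integrable_const _) (hi1.const_mul _),
    integral_const_mul, integral_const_mul, h0, mul_pow]
  have h1 : ∫ y, ‖T y - b‖ ^ 2 ∂μ ≤ (2 * R) ^ 2 := by
    refine (integral_mono hi2 (integrable_const _) fun y =>
      pow_le_pow_left₀ (norm_nonneg _) (hd y) 2).trans ?_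
    simp
  simp only [integral_const, probReal_univ, smul_eq_mul, one_mul, mul_zero, add_zero]
  gcongr

/-- A joint law of an initial point, a current point and a bounded error term, such that up to the
error term the displacement is at most `B` in `L^p` and the error has second moment at most `V`. -/
structure ChainState {d : ℕ} (p : ℝ) (ν₀ ν₁ : Measure (Euc d)) (B V K : ℝ≥0∞)
    (Q : Measure (Euc d × Euc d × Euc d)) : Prop where
  isProb : IsProbabilityMeasure Q
  map_init : Q.map (fun w => w.1) = ν₀
  map_cur : Q.map (fun w => w.2.1) = ν₁
  disp : eLpNorm (fun w => w.2.1 - w.1 - w.2.2) (ENNReal.ofReal p) Q ≤ B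
  sq : ∫⁻ w, ‖w.2.2‖ₑ ^ (2 : ℝ) ∂Q ≤ V
  bdd : ∀ᵐ w ∂Q, ‖w.2.2‖ₑ ≤ K

theorem ChainState.init {d : ℕ} (p : ℝ) (ν : Measure (Euc d)) [IsProbabilityMeasure ν] :
    ∃ Q, ChainState p ν ν 0 0 0 Q := by
  have hm : Measurable fun x : Euc d => (x, x, (0 : Euc d)) := by fun_prop
  refine ⟨ν.map fun x => (x, x, 0), Measure.isProbabilityMeasure_map hm.aemeasurable, ?_, ?_, ?_,
    ?_, ?_⟩
  · rw [Measure.map_map (by fun_prop) hm]; exact Measure.map_id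
  · rw [Measure.map_map (by fun_prop) hm]; exact Measure.map_id
  · rw [eLpNorm_map_measure (by fun_prop) hm.aemeasurable]
    simp [Function.comp_def]
  · rw [lintegral_map (by fun_prop) hm]
    simp
  · rw [ae_map_iff hm.aemeasurable (measurableSet_le (by fun_prop) measurable_const)]
    simp

theorem eLpNorm_combination_le {α F : Type*} [MeasurableSpace α] [NormedAddCommGroup F]
    [NormedSpace ℝ F] {μ : Measure α} {p : ℝ≥0∞} (hp : 1 ≤ p) {f₁ f₂ f₃ f₄ f₅ : α → F}
    (m₁ : AEStronglyMeasurable f₁ μ) (m₂ : AEStronglyMeasurable f₂ μ)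
    (m₃ : AEStronglyMeasurable f₃ μ) (m₄ : AEStronglyMeasurable f₄ μ)
    (m₅ : AEStronglyMeasurable f₅ μ) (c s : ℝ) {B N τ J : ℝ≥0∞}
    (n₁ : eLpNorm f₁ p μ ≤ B) (n₂ : eLpNorm f₂ p μ ≤ N) (n₃ : eLpNorm f₃ p μ ≤ τ)
    (n₄ : eLpNorm f₄ p μ ≤ τ) (n₅ : eLpNorm f₅ p μ ≤ J) :
    eLpNorm (f₁ + (c - 1) • f₂ + s • (f₃ + (-1 : ℝ) • f₄ + f₅)) p μ ≤
      B + ‖c - 1‖ₑ * N + ‖s‖ₑ * (2 * τ + J) := by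
  refine (eLpNorm_add_le (by fun_prop) (by fun_prop) hp).trans (add_le_add
    ((eLpNorm_add_le (by fun_prop) (by fun_prop) hp).trans (add_le_add n₁ ?_)) ?_)
  · rw [eLpNorm_const_smul]
    gcongr
  · rw [eLpNorm_const_smul]
    gcongr
    refine (eLpNorm_add_le (by fun_prop) (by fun_prop) hp).trans (add_le_add
      ((eLpNorm_add_le (by fun_prop) (by fun_prop) hp).trans ?_) n₅)
    rw [eLpNorm_const_smul, two_mul]
    refine add_le_add n₃ ?_
    simpa using n₄

set_option maxHeartbeats 1000000 in
theorem ChainState.step {d : ℕ} {p : ℝ} (hp : 1 ≤ p) {ν₀ : Measure (Euc d)} {B V K : ℝ≥0∞}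
    {Q : Measure (Euc d × Euc d × Euc d)} {μ : Measure (Euc d × Euc d)} [IsProbabilityMeasure μ]
    {k : Kernel (Euc d) (Euc d)} [IsMarkovKernel k] (hμ : (μ.map Prod.fst) ⊗ₘ k = μ)
    (hsnd : MemLp Prod.snd (ENNReal.ofReal p) μ)
    (h : ChainState p ν₀ (μ.map Prod.fst) B V K Q) {R : ℝ} (hR : 0 ≤ R) (c s : ℝ) :
    ∃ Q', ChainState p ν₀ (μ.map fun w => c • w.1 + s • w.2)
      (B + ‖c - 1‖ₑ * eLpNorm Prod.fst (ENNReal.ofReal p) μ +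
        ‖s‖ₑ * (2 * eLpNorm (fun w => w.2 - truncVec R w.2) (ENNReal.ofReal p) μ +
          eLpNorm (fun y => ∫ y', y' ∂(k y)) (ENNReal.ofReal p) (μ.map Prod.fst)))
      (V + ENNReal.ofReal ((s * (2 * R)) ^ 2)) (K + ENNReal.ofReal (|s| * (2 * R))) Q' := by
  have hQ := h.isProb
  have hp0 : 0 < p := by linarith
  have hP1 : 1 ≤ ENNReal.ofReal p := by simpa using hp
  have hTm := measurable_truncVec (d := d) R
  let b : Euc d → Euc d := fun y => ∫ y', truncVec R y' ∂(k y)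
  have hbm : Measurable b := (hTm.stronglyMeasurable.integral_kernel (κ := k)).measurable
  have hbR : ∀ y, ‖b y‖ ≤ R := fun y => by
    simpa using norm_integral_le_of_norm_le_const (μ := k y)
      (Filter.Eventually.of_forall (norm_truncVec_le hR))
  let k' : Kernel (Euc d × Euc d × Euc d) (Euc d) := k.comap (fun w => w.2.1) (by fun_prop)
  let Ψ : (Euc d × Euc d × Euc d) × Euc d → Euc d × Euc d × Euc d := fun w =>
    (w.1.1, c • w.1.2.1 + s • w.2, w.1.2.2 + s • (truncVec R w.2 - b w.1.2.1))
  have hΨ : Measurable Ψ := by fun_prop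
  have hprob : IsProbabilityMeasure (Q ⊗ₘ k') := inferInstance
  have hpair : (Q ⊗ₘ k').map (fun w => (w.1.2.1, w.2)) = μ := by
    refine Measure.ext_of_lintegral _ fun f hf => ?_
    rw [lintegral_map hf (by fun_prop), Measure.lintegral_compProd (by fun_prop)]
    conv_rhs => rw [← hμ, Measure.lintegral_compProd hf, ← h.map_cur,
      lintegral_map hf.lintegral_kernel_prod_right' (by fun_prop)]
    rfl
  have hmp : MeasurePreserving (fun w : (Euc d × Euc d × Euc d) × Euc d => (w.1.2.1, w.2))
      (Q ⊗ₘ k') μ := ⟨by fun_prop, hpair⟩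
  have hmf : MeasurePreserving (fun w : (Euc d × Euc d × Euc d) × Euc d => w.1) (Q ⊗ₘ k') Q :=
    ⟨by fun_prop, Measure.fst_compProd Q k'⟩
  refine ⟨(Q ⊗ₘ k').map Ψ, Measure.isProbabilityMeasure_map hΨ.aemeasurable, ?_, ?_, ?_, ?_, ?_⟩
  · rw [Measure.map_map (by fun_prop) hΨ]
    conv_rhs => rw [← h.map_init, ← hmf.map_eq, Measure.map_map (by fun_prop) (by fun_prop)]
    rfl
  · rw [Measure.map_map (by fun_prop) hΨ]
    conv_rhs => rw [← hpair, Measure.map_map (by fun_prop) (by fun_prop)]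
    rfl
  · rw [eLpNorm_map_measure (by fun_prop) hΨ.aemeasurable]
    have hint : ∀ᵐ y ∂(μ.map Prod.fst), Integrable (fun y' => y') (k y) := by
      have hi : Integrable (Prod.snd : Euc d × Euc d → Euc d) (μ.map Prod.fst ⊗ₘ k) := by
        rw [hμ]; exact hsnd.integrable hP1
      exact ((Measure.integrable_compProd_iff (by fun_prop)).1 hi).1
    rw [← h.map_cur] at hint
    have hint' := ae_of_ae_map hmf.aemeasurable
      (hmf.map_eq.symm ▸ ae_of_ae_map (by fun_prop) hint)
    let f₁ : (Euc d × Euc d × Euc d) × Euc d → Euc d := fun w => w.1.2.1 - w.1.1 - w.1.2.2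
    let f₂ : (Euc d × Euc d × Euc d) × Euc d → Euc d := fun w => w.1.2.1
    let f₃ : (Euc d × Euc d × Euc d) × Euc d → Euc d := fun w => w.2 - truncVec R w.2
    let f₄ : (Euc d × Euc d × Euc d) × Euc d → Euc d := fun w =>
      ∫ y', y' - truncVec R y' ∂(k w.1.2.1)
    let f₅ : (Euc d × Euc d × Euc d) × Euc d → Euc d := fun w => ∫ y', y' ∂(k w.1.2.1)
    have m₄' : Measurable fun y => ∫ y', y' - truncVec R y' ∂(k y) :=
      (StronglyMeasurable.integral_kernel (κ := k) (f := fun y' => y' - truncVec R y')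
        (by fun_prop : Measurable _).stronglyMeasurable).measurable
    have m₅' : Measurable fun y => ∫ y', y' ∂(k y) :=
      (StronglyMeasurable.integral_kernel (κ := k) (f := fun y' => y')
        stronglyMeasurable_id).measurable
    have m₁ : Measurable f₁ := by fun_prop
    have m₂ : Measurable f₂ := by fun_prop
    have m₃ : Measurable f₃ := by fun_prop
    have m₄ : Measurable f₄ := m₄'.comp (by fun_prop)
    have m₅ : Measurable f₅ := m₅'.comp (by fun_prop)
    have heq : (fun w : Euc d × Euc d × Euc d => w.2.1 - w.1 - w.2.2) ∘ Ψ =ᵐ[Q ⊗ₘ k']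
        f₁ + (c - 1) • f₂ + s • (f₃ + (-1 : ℝ) • f₄ + f₅) := by
      filter_upwards [hint'] with w hw
      have hTi : Integrable (truncVec R) (k w.1.2.1) :=
        Integrable.of_bound (by fun_prop) R (Filter.Eventually.of_forall (norm_truncVec_le hR))
      simp only [Function.comp_apply, Ψ, Pi.add_apply, Pi.smul_apply, f₁, f₂, f₃, f₄, f₅, b]
      rw [integral_sub hw hTi]
      module
    rw [eLpNorm_congr_ae heq]
    have n₁ : eLpNorm f₁ (ENNReal.ofReal p) (Q ⊗ₘ k') ≤ B := by
      have hg := eLpNorm_comp_measurePreserving (p := ENNReal.ofReal p)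
        (g := fun w : Euc d × Euc d × Euc d => w.2.1 - w.1 - w.2.2) (by fun_prop) hmf
      exact hg.le.trans h.disp
    have n₂ : eLpNorm f₂ (ENNReal.ofReal p) (Q ⊗ₘ k') = eLpNorm Prod.fst (ENNReal.ofReal p) μ := by
      have hg := eLpNorm_comp_measurePreserving (p := ENNReal.ofReal p)
        (g := (Prod.fst : Euc d × Euc d → Euc d)) measurable_fst.aestronglyMeasurable hmp
      exact hg
    have n₃ : eLpNorm f₃ (ENNReal.ofReal p) (Q ⊗ₘ k') =
        eLpNorm (fun w => w.2 - truncVec R w.2) (ENNReal.ofReal p) μ := by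
      have hg := eLpNorm_comp_measurePreserving (p := ENNReal.ofReal p)
        (g := fun w : Euc d × Euc d => w.2 - truncVec R w.2) (by fun_prop) hmp
      exact hg
    have hcur : MeasurePreserving (fun w : (Euc d × Euc d × Euc d) × Euc d => w.1.2.1) (Q ⊗ₘ k')
        (μ.map Prod.fst) := (MeasurePreserving.mk (by fun_prop) h.map_cur).comp hmf
    have n₄ : eLpNorm f₄ (ENNReal.ofReal p) (Q ⊗ₘ k') ≤
        eLpNorm (fun w => w.2 - truncVec R w.2) (ENNReal.ofReal p) μ := by
      have hg := eLpNorm_comp_measurePreserving (p := ENNReal.ofReal p)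
        m₄'.aestronglyMeasurable hcur
      refine hg.le.trans ?_
      have hJ := eLpNorm_integral_kernel_le (μ := μ.map Prod.fst) (k := k) hp
        (f := fun w : Euc d × Euc d => w.2 - truncVec R w.2)
        (by fun_prop : Measurable _).stronglyMeasurable
      rwa [hμ] at hJ
    have n₅ : eLpNorm f₅ (ENNReal.ofReal p) (Q ⊗ₘ k') =
        eLpNorm (fun y => ∫ y', y' ∂(k y)) (ENNReal.ofReal p) (μ.map Prod.fst) := by
      have hg := eLpNorm_comp_measurePreserving (p := ENNReal.ofReal p)
        m₅'.aestronglyMeasurable hcur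
      exact hg
    exact eLpNorm_combination_le hP1 m₁.aestronglyMeasurable m₂.aestronglyMeasurable
      m₃.aestronglyMeasurable m₄.aestronglyMeasurable m₅.aestronglyMeasurable c s n₁ n₂.le n₃.le
      n₄ n₅.le
  · rw [lintegral_map (by fun_prop) hΨ, Measure.lintegral_compProd (by fun_prop)]
    calc _ ≤ ∫⁻ w, ‖w.2.2‖ₑ ^ (2 : ℝ) + ENNReal.ofReal ((s * (2 * R)) ^ 2) ∂Q :=
          lintegral_mono fun w =>
            integral_norm_add_smul_sub_integral_sq (μ := k w.2.1) hTm (norm_truncVec_le hR) _ _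
      _ = ∫⁻ w, ‖w.2.2‖ₑ ^ (2 : ℝ) ∂Q + ENNReal.ofReal ((s * (2 * R)) ^ 2) := by
          rw [lintegral_add_right _ measurable_const]; simp
      _ ≤ _ := by gcongr; exact h.sq
  · rw [ae_map_iff hΨ.aemeasurable (measurableSet_le (by fun_prop) measurable_const)]
    filter_upwards [ae_of_ae_map hmf.aemeasurable (hmf.map_eq.symm ▸ h.bdd)] with w hw
    refine (enorm_add_le _ _).trans (add_le_add hw ?_)
    rw [← ofReal_norm, norm_smul, Real.norm_eq_abs]
    refine ENNReal.ofReal_le_ofReal ?_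
    gcongr
    exact (norm_sub_le _ _).trans (by linarith [norm_truncVec_le hR w.2, hbR w.1.2.1])

theorem ChainState.mono {d : ℕ} {p : ℝ} {ν₀ ν₁ : Measure (Euc d)} {B V K B' V' K' : ℝ≥0∞}
    {Q : Measure (Euc d × Euc d × Euc d)} (h : ChainState p ν₀ ν₁ B V K Q) (hB : B ≤ B')
    (hV : V ≤ V') (hK : K ≤ K') : ChainState p ν₀ ν₁ B' V' K' Q :=
  ⟨h.isProb, h.map_init, h.map_cur, h.disp.trans hB, h.sq.trans hV,
    h.bdd.mono fun _ hw => hw.trans hK⟩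

theorem ChainState.wassersteinDist_le {d : ℕ} {p r : ℝ} (hp : 1 ≤ p) (hpr : p ≤ r) (hr : 2 ≤ r)
    {ν₀ ν₁ : Measure (Euc d)} {B V K : ℝ≥0∞} {Q : Measure (Euc d × Euc d × Euc d)}
    (h : ChainState p ν₀ ν₁ B V K Q) :
    wassersteinDist p ν₀ ν₁ ≤ B + (K ^ (r - 2) * V) ^ (1 / r) := by
  have hQ := h.isProb
  have hp0 : 0 < p := by linarith
  have hr0 : 0 < r := by linarith
  have hm : eLpNorm (fun w : Euc d × Euc d × Euc d => w.2.2) (ENNReal.ofReal p) Q ≤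
      (K ^ (r - 2) * V) ^ (1 / r) := by
    refine (eLpNorm_le_eLpNorm_of_exponent_le (ENNReal.ofReal_le_ofReal hpr)
      (by fun_prop)).trans ?_
    rw [← ENNReal.rpow_le_rpow_iff hr0, eLpNorm_ofReal_rpow hr0, ← ENNReal.rpow_mul,
      one_div_mul_cancel hr0.ne', ENNReal.rpow_one]
    calc ∫⁻ w, ‖w.2.2‖ₑ ^ r ∂Q ≤ ∫⁻ w, K ^ (r - 2) * ‖w.2.2‖ₑ ^ (2 : ℝ) ∂Q := by
          refine lintegral_mono_ae (h.bdd.mono fun w hw => ?_)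
          rw [show r = (r - 2) + 2 by ring, ENNReal.rpow_add_of_nonneg _ _ (by linarith)
            (by norm_num), add_sub_cancel_right]
          gcongr
      _ = K ^ (r - 2) * ∫⁻ w, ‖w.2.2‖ₑ ^ (2 : ℝ) ∂Q := lintegral_const_mul _ (by fun_prop)
      _ ≤ _ := by gcongr; exact h.sq
  have hmeas : Measurable fun w : Euc d × Euc d × Euc d => (w.1, w.2.1) := by fun_prop
  have hcost : (∫⁻ q, ENNReal.ofReal (‖q.1 - q.2‖ ^ p)
      ∂(Q.map fun w => (w.1, w.2.1))) ^ (1 / p) =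
      eLpNorm (fun w : Euc d × Euc d × Euc d => w.2.1 - w.1) (ENNReal.ofReal p) Q := by
    rw [lintegral_map (by fun_prop) hmeas, eLpNorm_eq_lintegral_rpow_enorm_toReal
      (by simpa using hp0) (by simp), ENNReal.toReal_ofReal hp0.le]
    congr 1
    refine lintegral_congr fun w => ?_
    rw [← ENNReal.ofReal_rpow_of_nonneg (norm_nonneg _) hp0.le, ofReal_norm, enorm_sub_rev]
  calc wassersteinDist p ν₀ ν₁ ≤ _ := by
        refine iInf_le_of_le (Q.map fun w => (w.1, w.2.1)) (iInf_le_of_le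
          (Measure.isProbabilityMeasure_map hmeas.aemeasurable) (iInf_le_of_le ?_
          (iInf_le_of_le ?_ le_rfl)))
        · rw [Measure.map_map measurable_fst hmeas]; exact h.map_init
        · rw [Measure.map_map measurable_snd hmeas]; exact h.map_cur
    _ = _ := hcost
    _ = eLpNorm ((fun w : Euc d × Euc d × Euc d => w.2.1 - w.1 - w.2.2) + fun w => w.2.2)
        (ENNReal.ofReal p) Q := by
      congr 1; ext1 w; simp
    _ ≤ _ := (eLpNorm_add_le (by fun_prop) (by fun_prop) (by simpa using hp)).trans
      (add_le_add h.disp hm)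

/-- The rotation of angle `θ` in the plane spanned by two copies of a space. -/
def rotPair {d : ℕ} (θ : ℝ) (q : Euc d × Euc d) : Euc d × Euc d :=
  (Real.cos θ • q.1 + Real.sin θ • q.2, -Real.sin θ • q.1 + Real.cos θ • q.2)

theorem measurable_rotPair {d : ℕ} : Measurable fun w : ℝ × Euc d × Euc d => rotPair w.1 w.2 := by
  have : Continuous fun w : ℝ × Euc d × Euc d => rotPair w.1 w.2 := by
    unfold rotPair; fun_prop
  exact this.measurable

theorem measurable_rotPair_right {d : ℕ} (θ : ℝ) : Measurable (rotPair (d := d) θ) := by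
  have : Continuous fun q : Euc d × Euc d => rotPair θ q := by
    unfold rotPair; fun_prop
  exact this.measurable

/-- The law of a rotated pair of independent points with laws `ν` and the standard Gaussian. -/
def rotKernel {d : ℕ} (ν : Measure (Euc d)) [IsProbabilityMeasure ν] :
    Kernel ℝ (Euc d × Euc d) :=
  ((Kernel.id : Kernel ℝ ℝ) ×ₖ Kernel.const ℝ (ν.prod (ProbabilityTheory.stdGaussian (Euc d)))).map
    fun w => rotPair w.1 w.2

/-- The `L^p` norm of `‖x‖ + ‖z‖` under the product of `ν` and the standard Gaussian. -/
def pairNorm {d : ℕ} (ν : Measure (Euc d)) (p : ℝ) : ℝ≥0∞ :=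
  eLpNorm (fun q : Euc d × Euc d => ‖q.1‖ + ‖q.2‖) (ENNReal.ofReal p)
    (ν.prod (ProbabilityTheory.stdGaussian (Euc d)))

/-- The `L^p` norm of the part of `‖x‖ + ‖z‖` above level `R`. -/
def pairTail {d : ℕ} (ν : Measure (Euc d)) (p R : ℝ) : ℝ≥0∞ :=
  eLpNorm (fun q : Euc d × Euc d => if R < ‖q.1‖ + ‖q.2‖ then ‖q.1‖ + ‖q.2‖ else 0)
    (ENNReal.ofReal p) (ν.prod (ProbabilityTheory.stdGaussian (Euc d)))

theorem tendsto_pairTail {d : ℕ} (ν : Measure (Euc d)) {p : ℝ} (hp : 0 < p)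
    (hN : pairNorm ν p < ∞) :
    Filter.Tendsto (fun n : ℕ => pairTail ν p n) Filter.atTop (𝓝 0) := by
  have hp' : ENNReal.ofReal p ≠ 0 := by simpa using hp
  simp only [pairTail, eLpNorm_eq_lintegral_rpow_enorm_toReal hp' ENNReal.ofReal_ne_top,
    ENNReal.toReal_ofReal hp.le]
  have h : Filter.Tendsto (fun n : ℕ => ∫⁻ q : Euc d × Euc d,
      ‖(if (n : ℝ) < ‖q.1‖ + ‖q.2‖ then ‖q.1‖ + ‖q.2‖ else 0 : ℝ)‖ₑ ^ p
      ∂(ν.prod (ProbabilityTheory.stdGaussian (Euc d)))) Filter.atTop (𝓝 (∫⁻ _, 0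
        ∂(ν.prod (ProbabilityTheory.stdGaussian (Euc d))))) := by
    refine tendsto_lintegral_of_dominated_convergence
      (fun q : Euc d × Euc d => ‖‖q.1‖ + ‖q.2‖‖ₑ ^ p) (fun n => ?_) (fun n => ?_) ?_ ?_
    · exact ((Measurable.ite (measurableSet_lt measurable_const (by fun_prop)) (by fun_prop)
        measurable_const).enorm.pow_const p)
    · refine Filter.Eventually.of_forall fun q => ?_
      dsimp only
      split_ifs
      · exact le_rfl
      · simp [hp]
    · rw [← eLpNorm_ofReal_rpow hp]
      exact (ENNReal.rpow_lt_top_of_nonneg hp.le hN.ne).ne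
    · refine Filter.Eventually.of_forall fun q => tendsto_const_nhds.congr' ?_
      obtain ⟨m, hm⟩ := exists_nat_ge (‖q.1‖ + ‖q.2‖)
      filter_upwards [Filter.eventually_ge_atTop m] with n hn
      have : (m : ℝ) ≤ n := by exact_mod_cast hn
      rw [if_neg (not_lt.2 (hm.trans this))]
      simp [hp]
  rw [lintegral_zero] at h
  have := h.ennrpow_const (1 / p)
  rwa [ENNReal.zero_rpow_of_pos (by positivity)] at this

section Rotation

variable {d : ℕ} (ν : Measure (Euc d)) [IsProbabilityMeasure ν]

theorem rotKernel_apply (θ : ℝ) :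
    rotKernel ν θ = (ν.prod (ProbabilityTheory.stdGaussian (Euc d))).map (rotPair θ) := by
  rw [rotKernel, Kernel.map_apply _ measurable_rotPair, Kernel.prod_apply, Kernel.id_apply,
    Kernel.const_apply, Measure.dirac_prod, Measure.map_map measurable_rotPair (by fun_prop)]
  rfl

instance : IsMarkovKernel (rotKernel ν) := by
  unfold rotKernel; exact Kernel.IsMarkovKernel.map _ measurable_rotPair

/-- The conditional mean of the tangent vector at angle `θ` given the current position. -/
def rotDrift (w : ℝ × Euc d) : Euc d := ∫ y', y' ∂(rotKernel ν).condKernel w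

/-- The `L^p` norm of the drift at angle `θ`. -/
def rotDriftNorm (p θ : ℝ) : ℝ≥0∞ :=
  eLpNorm (fun y => rotDrift ν (θ, y)) (ENNReal.ofReal p) ((rotKernel ν θ).map Prod.fst)

theorem measurable_rotDrift : Measurable (rotDrift ν) :=
  (StronglyMeasurable.integral_kernel (κ := (rotKernel ν).condKernel) (f := fun y' => y')
    stronglyMeasurable_id).measurable

theorem measurable_rotDriftNorm {p : ℝ} (hp : 0 < p) : Measurable (rotDriftNorm ν p) := by
  have h : rotDriftNorm ν p =
      fun θ => (∫⁻ y, ‖rotDrift ν (θ, y)‖ₑ ^ p ∂((rotKernel ν).fst θ)) ^ (1 / p) := by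
    ext1 θ
    rw [rotDriftNorm, eLpNorm_eq_lintegral_rpow_enorm_toReal (by simpa using hp) (by simp),
      ENNReal.toReal_ofReal hp.le, Kernel.fst_apply]
  rw [h]
  exact ((((measurable_rotDrift ν).enorm.pow_const p)).lintegral_kernel_prod_right').pow_const _

theorem rotKernel_disintegrate (θ : ℝ) :
    (rotKernel ν θ).map Prod.fst ⊗ₘ ((rotKernel ν).condKernel.sectR θ) = rotKernel ν θ := by
  rw [← Kernel.fst_apply, ← Kernel.compProd_apply_eq_compProd_sectR, Kernel.disintegrate]

theorem rotKernel_map_combination (θ δ : ℝ) :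
    (rotKernel ν θ).map (fun w => Real.cos δ • w.1 + Real.sin δ • w.2) =
      (rotKernel ν (θ + δ)).map Prod.fst := by
  rw [rotKernel_apply, rotKernel_apply,
    Measure.map_map (by fun_prop) (measurable_rotPair_right _),
    Measure.map_map (by fun_prop) (measurable_rotPair_right _)]
  congr 1
  ext1 q
  simp only [Function.comp_apply, rotPair, Real.cos_add, Real.sin_add]
  module

theorem rotKernel_zero_map_fst : (rotKernel ν 0).map Prod.fst = ν := by
  rw [rotKernel_apply, Measure.map_map (by fun_prop) (measurable_rotPair_right _)]
  have h : Prod.fst ∘ rotPair (d := d) 0 = Prod.fst := by ext1 q; simp [rotPair]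
  rw [h]
  exact Measure.fst_prod

theorem rotKernel_pi_div_two_map_fst :
    (rotKernel ν (Real.pi / 2)).map Prod.fst = ProbabilityTheory.stdGaussian (Euc d) := by
  rw [rotKernel_apply, Measure.map_map (by fun_prop) (measurable_rotPair_right _)]
  have h : Prod.fst ∘ rotPair (d := d) (Real.pi / 2) = Prod.snd := by ext1 q; simp [rotPair]
  rw [h]
  exact Measure.snd_prod

theorem norm_rotPair_fst_le (θ : ℝ) (q : Euc d × Euc d) : ‖(rotPair θ q).1‖ ≤ ‖q.1‖ + ‖q.2‖ := by
  refine (norm_add_le _ _).trans ?_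
  rw [norm_smul, norm_smul]
  exact add_le_add (mul_le_of_le_one_left (norm_nonneg _) (Real.abs_cos_le_one θ))
    (mul_le_of_le_one_left (norm_nonneg _) (Real.abs_sin_le_one θ))

theorem norm_rotPair_snd_le (θ : ℝ) (q : Euc d × Euc d) : ‖(rotPair θ q).2‖ ≤ ‖q.1‖ + ‖q.2‖ := by
  refine (norm_add_le _ _).trans ?_
  rw [norm_smul, norm_smul, norm_neg]
  exact add_le_add (mul_le_of_le_one_left (norm_nonneg _) (Real.abs_sin_le_one θ))
    (mul_le_of_le_one_left (norm_nonneg _) (Real.abs_cos_le_one θ))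

theorem eLpNorm_rotKernel {F : Type*} [NormedAddCommGroup F] [MeasurableSpace F] [BorelSpace F]
    [SecondCountableTopology F] {f : Euc d × Euc d → F} (hf : Measurable f) (p : ℝ≥0∞) (θ : ℝ) :
    eLpNorm f p (rotKernel ν θ) =
      eLpNorm (fun q => f (rotPair θ q)) p (ν.prod (ProbabilityTheory.stdGaussian (Euc d))) := by
  rw [rotKernel_apply, eLpNorm_map_measure hf.aestronglyMeasurable
    (measurable_rotPair_right θ).aemeasurable]
  rfl

theorem eLpNorm_fst_rotKernel_le (p θ : ℝ) :
    eLpNorm Prod.fst (ENNReal.ofReal p) (rotKernel ν θ) ≤ pairNorm ν p := by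
  rw [eLpNorm_rotKernel ν measurable_fst]
  exact eLpNorm_mono_real fun q => norm_rotPair_fst_le θ q

theorem eLpNorm_snd_rotKernel_le (p θ : ℝ) :
    eLpNorm Prod.snd (ENNReal.ofReal p) (rotKernel ν θ) ≤ pairNorm ν p := by
  rw [eLpNorm_rotKernel ν measurable_snd]
  exact eLpNorm_mono_real fun q => norm_rotPair_snd_le θ q

theorem eLpNorm_tail_rotKernel_le (p θ R : ℝ) :
    eLpNorm (fun w : Euc d × Euc d => w.2 - truncVec R w.2) (ENNReal.ofReal p) (rotKernel ν θ) ≤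
      pairTail ν p R := by
  have := measurable_truncVec (d := d) R
  rw [eLpNorm_rotKernel ν (by fun_prop)]
  refine eLpNorm_mono_real fun q => ?_
  have h := norm_rotPair_snd_le θ q
  unfold truncVec
  split_ifs with h1 h2 h2
  · simp; positivity
  · simp
  · simpa using h
  · exact absurd (h.trans (not_lt.1 h2)) h1

theorem rotDriftNorm_le {p : ℝ} (hp : 1 ≤ p) (θ : ℝ) : rotDriftNorm ν p θ ≤ pairNorm ν p := by
  have h := eLpNorm_integral_kernel_le (μ := (rotKernel ν θ).map Prod.fst)
    (k := (rotKernel ν).condKernel.sectR θ) hp (f := (Prod.snd : Euc d × Euc d → Euc d))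
    measurable_snd.stronglyMeasurable
  rw [rotKernel_disintegrate] at h
  exact h.trans (eLpNorm_snd_rotKernel_le ν p θ)

theorem pairNorm_lt_top {p : ℝ} (hν : MemLp (fun x : Euc d => x) (ENNReal.ofReal p) ν) :
    pairNorm ν p < ∞ :=
  ((hν.norm.comp_fst _).add (MemLp.comp_snd (memLp_id_stdGaussian d (ENNReal.ofReal p)
    ENNReal.ofReal_ne_top).norm ν)).2

theorem ChainState.rot_step {p : ℝ} (hp : 1 ≤ p) (hN : pairNorm ν p < ∞) {B V K : ℝ≥0∞}
    {θ δ δ' R : ℝ} (hR : 0 ≤ R) (hδ' : 0 ≤ δ') (hδ : δ' ≤ δ)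
    (h : ∃ Q, ChainState p ν ((rotKernel ν θ).map Prod.fst) B V K Q) :
    ∃ Q, ChainState p ν ((rotKernel ν (θ + δ')).map Prod.fst)
      (B + ENNReal.ofReal δ * rotDriftNorm ν p θ +
        (ENNReal.ofReal (δ ^ 2) * pairNorm ν p + ENNReal.ofReal δ * (2 * pairTail ν p R)))
      (V + ENNReal.ofReal ((2 * R * δ) ^ 2)) (K + ENNReal.ofReal (2 * R * δ)) Q := by
  obtain ⟨Q, hQ⟩ := h
  have hsnd : MemLp Prod.snd (ENNReal.ofReal p) (rotKernel ν θ) :=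
    ⟨by fun_prop, (eLpNorm_snd_rotKernel_le ν p θ).trans_lt hN⟩
  obtain ⟨Q', hQ'⟩ := ChainState.step hp (rotKernel_disintegrate ν θ) hsnd hQ hR
    (Real.cos δ') (Real.sin δ')
  rw [rotKernel_map_combination] at hQ'
  have hs : |Real.sin δ'| ≤ δ := by
    refine (Real.abs_sin_le_abs).trans ?_
    rwa [abs_of_nonneg hδ']
  have hc : |Real.cos δ' - 1| ≤ δ ^ 2 := by
    rw [abs_sub_comm, abs_of_nonneg (by linarith [Real.cos_le_one δ'])]
    nlinarith [Real.one_sub_sq_div_two_le_cos (x := δ')]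
  have hs' : ‖Real.sin δ'‖ₑ ≤ ENNReal.ofReal δ := by
    rw [← ofReal_norm]; exact ENNReal.ofReal_le_ofReal hs
  have hc' : ‖Real.cos δ' - 1‖ₑ ≤ ENNReal.ofReal (δ ^ 2) := by
    rw [← ofReal_norm]; exact ENNReal.ofReal_le_ofReal hc
  refine ⟨Q', hQ'.mono ?_ ?_ ?_⟩
  · calc _ ≤ B + ENNReal.ofReal (δ ^ 2) * pairNorm ν p +
          ENNReal.ofReal δ * (2 * pairTail ν p R + rotDriftNorm ν p θ) := by
          gcongr
          · exact eLpNorm_fst_rotKernel_le ν p θ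
          · exact eLpNorm_tail_rotKernel_le ν p θ R
          · exact le_rfl
      _ = _ := by ring
  · gcongr V + ENNReal.ofReal ?_
    rw [show (2 * R * δ) ^ 2 = (2 * R) ^ 2 * δ ^ 2 by ring, mul_pow, mul_comm]
    gcongr ?_ * ?_
    rw [← sq_abs]
    gcongr
  · gcongr K + ENNReal.ofReal ?_
    rw [mul_comm]
    gcongr

theorem ChainState.rot_iterate {p : ℝ} (hp : 1 ≤ p) (hN : pairNorm ν p < ∞) {t δ R : ℝ}
    (hR : 0 ≤ R) (ht : 0 ≤ t) (hδ : t ≤ δ) (n : ℕ) :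
    ∃ Q, ChainState p ν ((rotKernel ν (t + n * δ)).map Prod.fst)
      (ENNReal.ofReal δ * rotDriftNorm ν p 0 +
        ∑ i ∈ Finset.range n, ENNReal.ofReal δ * rotDriftNorm ν p (t + i * δ) + (n + 1) *
        (ENNReal.ofReal (δ ^ 2) * pairNorm ν p + ENNReal.ofReal δ * (2 * pairTail ν p R)))
      ((n + 1) * ENNReal.ofReal ((2 * R * δ) ^ 2)) ((n + 1) * ENNReal.ofReal (2 * R * δ)) Q := by
  induction n with
  | zero =>
    have h0 := ChainState.init p ν
    nth_rw 2 [← rotKernel_zero_map_fst ν] at h0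
    have h1 := ChainState.rot_step ν hp hN hR ht hδ h0
    simpa using h1
  | succ n ih =>
    obtain ⟨Q, hQ⟩ := ChainState.rot_step ν hp hN hR (ht.trans hδ) le_rfl ih
    refine ⟨Q, ?_⟩
    have e1 : t + n * δ + δ = t + ((n + 1 : ℕ) : ℝ) * δ := by push_cast; ring
    rw [e1] at hQ
    refine hQ.mono (le_of_eq ?_) (le_of_eq ?_) (le_of_eq ?_)
    · rw [Finset.sum_range_succ]; push_cast; ring
    · push_cast; ring
    · push_cast; ring

theorem wassersteinDist_le_sum_add {p : ℝ} (hp : 1 ≤ p) (hN : pairNorm ν p < ∞) {t δ R r : ℝ}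
    (hr : 2 ≤ r) (hpr : p ≤ r) (hR : 0 ≤ R) (ht : 0 ≤ t) (hδ : t ≤ δ) (n : ℕ)
    (hn : (n + 1) * δ = Real.pi / 2) :
    wassersteinDist p ν (ProbabilityTheory.stdGaussian (Euc d)) ≤
      ∑ i ∈ Finset.range (n + 1), ENNReal.ofReal δ * rotDriftNorm ν p (t + i * δ) +
      (ENNReal.ofReal δ * pairNorm ν p + ENNReal.ofReal (Real.pi * δ) * pairNorm ν p +
        ENNReal.ofReal Real.pi * (2 * pairTail ν p R) +
        (ENNReal.ofReal (2 * R * Real.pi) ^ (r - 2) *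
          ENNReal.ofReal (4 * R ^ 2 * Real.pi * δ)) ^ (1 / r)) := by
  have hδ0 : 0 ≤ δ := ht.trans hδ
  have hn2 : ((n : ℝ) + 2) * δ ≤ Real.pi := by
    have : 0 ≤ (n : ℝ) * δ := by positivity
    linarith
  obtain ⟨Q, hQ⟩ := ChainState.rot_step ν hp hN hR (sub_nonneg.2 hδ) (sub_le_self _ ht)
    (ChainState.rot_iterate ν hp hN hR ht hδ n)
  have e1 : t + n * δ + (δ - t) = Real.pi / 2 := by rw [← hn]; ring
  rw [e1, rotKernel_pi_div_two_map_fst] at hQ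
  have hcast : ((n : ℝ≥0∞) + 2) = ENNReal.ofReal (n + 2) := by
    rw [ENNReal.ofReal_add (by positivity) (by positivity)]; simp
  refine ((hQ.mono (B' := ∑ i ∈ Finset.range (n + 1),
    ENNReal.ofReal δ * rotDriftNorm ν p (t + i * δ) + (ENNReal.ofReal δ * pairNorm ν p +
      ENNReal.ofReal (Real.pi * δ) * pairNorm ν p + ENNReal.ofReal Real.pi * (2 * pairTail ν p R)))
    (K' := ENNReal.ofReal (2 * R * Real.pi)) (V' := ENNReal.ofReal (4 * R ^ 2 * Real.pi * δ))
    ?_ ?_ ?_).wassersteinDist_le hp hpr hr).trans (le_of_eq (by rw [add_assoc]))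
  · calc _ = ∑ i ∈ Finset.range (n + 1), ENNReal.ofReal δ * rotDriftNorm ν p (t + i * δ) +
          (ENNReal.ofReal δ * rotDriftNorm ν p 0 +
          ((n + 2) * ENNReal.ofReal (δ ^ 2)) * pairNorm ν p +
          ((n + 2) * ENNReal.ofReal δ) * (2 * pairTail ν p R)) := by
          rw [Finset.sum_range_succ]; ring
      _ ≤ _ := by
          rw [hcast, ← ENNReal.ofReal_mul (by positivity), ← ENNReal.ofReal_mul (by positivity)]
          gcongr _ + (ENNReal.ofReal δ * ?_ + ENNReal.ofReal ?_ * _ + ENNReal.ofReal ?_ * _)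
          · exact rotDriftNorm_le ν hp 0
          · calc _ = (n + 2) * δ * δ := by ring
            _ ≤ _ := by gcongr
  · calc _ = (n + 2) * ENNReal.ofReal ((2 * R * δ) ^ 2) := by ring
      _ ≤ _ := by
          rw [hcast, ← ENNReal.ofReal_mul (by positivity)]
          refine ENNReal.ofReal_le_ofReal ?_
          calc _ = 4 * R ^ 2 * ((n + 2) * δ) * δ := by ring
            _ ≤ _ := by gcongr
  · calc _ = (n + 2) * ENNReal.ofReal (2 * R * δ) := by ring
      _ ≤ _ := by
          rw [hcast, ← ENNReal.ofReal_mul (by positivity)]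
          refine ENNReal.ofReal_le_ofReal ?_
          calc _ = 2 * R * ((n + 2) * δ) := by ring
            _ ≤ _ := by gcongr

theorem sum_setLIntegral_shift {f : ℝ → ℝ≥0∞} (hf : Measurable f) {δ : ℝ} (hδ : 0 ≤ δ) (n : ℕ) :
    ∑ i ∈ Finset.range n, ∫⁻ t in Set.Ioc 0 δ, f (t + i * δ) =
      ∫⁻ t in Set.Ioc 0 (n * δ), f t := by
  induction n with
  | zero => simp
  | succ n ih =>
    have h : ∫⁻ t in Set.Ioc 0 δ, f (t + n * δ) =
        ∫⁻ t in Set.Ioc (n * δ) (((n + 1 : ℕ) : ℝ) * δ), f t := by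
      have := (measurePreserving_add_right volume (n * δ)).setLIntegral_comp_preimage
        (s := Set.Ioc (n * δ) (((n + 1 : ℕ) : ℝ) * δ)) measurableSet_Ioc hf
      rw [← this, Set.preimage_add_const_Ioc]
      congr 3
      · ring
      · push_cast; ring
    have hn : (n : ℝ) * δ ≤ ((n + 1 : ℕ) : ℝ) * δ := by push_cast; nlinarith
    rw [Finset.sum_range_succ, ih, h, ← lintegral_union measurableSet_Ioc
      (Set.Ioc_disjoint_Ioc_of_le le_rfl), Set.Ioc_union_Ioc_eq_Ioc (by positivity) hn]

theorem wassersteinDist_le_lintegral_add {p : ℝ} (hp : 1 ≤ p) (hN : pairNorm ν p < ∞) {δ R r : ℝ}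
    (hr : 2 ≤ r) (hpr : p ≤ r) (hR : 0 ≤ R) (n : ℕ) (hδ : 0 < δ)
    (hn : (n + 1) * δ = Real.pi / 2) :
    wassersteinDist p ν (ProbabilityTheory.stdGaussian (Euc d)) ≤
      (∫⁻ θ in Set.Ioc 0 (Real.pi / 2), rotDriftNorm ν p θ) +
      (ENNReal.ofReal δ * pairNorm ν p + ENNReal.ofReal (Real.pi * δ) * pairNorm ν p +
        ENNReal.ofReal Real.pi * (2 * pairTail ν p R) +
        (ENNReal.ofReal (2 * R * Real.pi) ^ (r - 2) *
          ENNReal.ofReal (4 * R ^ 2 * Real.pi * δ)) ^ (1 / r)) := by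
  have hJ := measurable_rotDriftNorm ν (p := p) (by linarith)
  generalize hC : (ENNReal.ofReal δ * pairNorm ν p + ENNReal.ofReal (Real.pi * δ) * pairNorm ν p +
    ENNReal.ofReal Real.pi * (2 * pairTail ν p R) + (ENNReal.ofReal (2 * R * Real.pi) ^ (r - 2) *
          ENNReal.ofReal (4 * R ^ 2 * Real.pi * δ)) ^ (1 / r)) = C
  have h0 : ENNReal.ofReal δ ≠ 0 := by simpa using hδ
  rw [← ENNReal.mul_le_mul_iff_right h0 ENNReal.ofReal_ne_top]
  have hvol : (volume : Measure ℝ) (Set.Ioc 0 δ) = ENNReal.ofReal δ := by simp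
  calc _ = ∫⁻ _ in Set.Ioc 0 δ,
        wassersteinDist p ν (ProbabilityTheory.stdGaussian (Euc d)) := by
        rw [setLIntegral_const, hvol, mul_comm]
    _ ≤ ∫⁻ t in Set.Ioc 0 δ, (∑ i ∈ Finset.range (n + 1),
          ENNReal.ofReal δ * rotDriftNorm ν p (t + i * δ) + C) := by
        refine setLIntegral_mono' measurableSet_Ioc fun t ht => ?_
        rw [← hC]
        exact wassersteinDist_le_sum_add ν hp hN hr hpr hR ht.1.le ht.2 n hn
    _ = _ := by
        rw [lintegral_add_right _ measurable_const, lintegral_finsetSum _ (fun i _ => by fun_prop),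
          setLIntegral_const, hvol]
        have hm : ∀ i ∈ Finset.range (n + 1), ∫⁻ t in Set.Ioc 0 δ,
            ENNReal.ofReal δ * rotDriftNorm ν p (t + i * δ) =
            ENNReal.ofReal δ * ∫⁻ t in Set.Ioc 0 δ, rotDriftNorm ν p (t + i * δ) :=
          fun i _ => lintegral_const_mul _ (by fun_prop)
        rw [Finset.sum_congr rfl hm]
        rw [← Finset.mul_sum, sum_setLIntegral_shift hJ hδ.le, ← hn]
        push_cast
        ring

theorem wassersteinDist_le_lintegral_rotDriftNorm {p : ℝ} (hp : 1 ≤ p)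
    (hν : MemLp (fun x : Euc d => x) (ENNReal.ofReal p) ν) :
    wassersteinDist p ν (ProbabilityTheory.stdGaussian (Euc d)) ≤
      ∫⁻ θ in Set.Ioc 0 (Real.pi / 2), rotDriftNorm ν p θ := by
  have hN := pairNorm_lt_top ν hν
  set I := ∫⁻ θ in Set.Ioc 0 (Real.pi / 2), rotDriftNorm ν p θ
  set r := max p 2
  have hr0 : 0 < r := lt_of_lt_of_le two_pos (le_max_right _ _)
  have hδ : Filter.Tendsto (fun n : ℕ => Real.pi / 2 * (1 / ((n : ℝ) + 1))) Filter.atTop (𝓝 0) := by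
    simpa using tendsto_one_div_add_atTop_nhds_zero_nat.const_mul (Real.pi / 2)
  have hlim : ∀ R : ℕ, wassersteinDist p ν (ProbabilityTheory.stdGaussian (Euc d)) ≤
      I + ENNReal.ofReal Real.pi * (2 * pairTail ν p R) := fun R => by
    have h1 : Filter.Tendsto (fun δ : ℝ => ENNReal.ofReal δ * pairNorm ν p) (𝓝 0) (𝓝 0) := by
      simpa using ENNReal.Tendsto.mul_const (b := pairNorm ν p)
        (ENNReal.continuous_ofReal.tendsto 0) (Or.inr hN.ne)
    have h2 : Filter.Tendsto (fun δ : ℝ => ENNReal.ofReal (Real.pi * δ) * pairNorm ν p) (𝓝 0)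
        (𝓝 0) := by
      refine h1.comp (Continuous.tendsto' (by fun_prop) _ _ (by simp))
    have h3 : Filter.Tendsto (fun δ : ℝ => (ENNReal.ofReal (2 * R * Real.pi) ^ (r - 2) *
          ENNReal.ofReal (4 * (R : ℝ) ^ 2 * Real.pi * δ)) ^ (1 / r)) (𝓝 0) (𝓝 0) := by
      have h4 : Filter.Tendsto (fun δ : ℝ => ENNReal.ofReal (2 * R * Real.pi) ^ (r - 2) *
          ENNReal.ofReal (4 * (R : ℝ) ^ 2 * Real.pi * δ)) (𝓝 0) (𝓝 0) := by
        have h5 : Filter.Tendsto (fun δ : ℝ => ENNReal.ofReal (4 * (R : ℝ) ^ 2 * Real.pi * δ))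
            (𝓝 0) (𝓝 0) :=
          (ENNReal.continuous_ofReal.comp (by fun_prop)).tendsto' _ _ (by simp)
        simpa using ENNReal.Tendsto.const_mul (a := ENNReal.ofReal (2 * R * Real.pi) ^ (r - 2)) h5
          (Or.inr (ENNReal.rpow_ne_top_of_nonneg (sub_nonneg.2 (le_max_right _ _))
            ENNReal.ofReal_ne_top))
      have := h4.ennrpow_const (1 / r)
      rwa [ENNReal.zero_rpow_of_pos (by positivity)] at this
    have hall := (((h1.add h2).add (tendsto_const_nhds
      (x := ENNReal.ofReal Real.pi * (2 * pairTail ν p R)))).add h3).const_add I |>.comp hδ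
    simp only [zero_add, add_zero] at hall
    refine ge_of_tendsto' hall fun n => ?_
    exact wassersteinDist_le_lintegral_add ν hp hN (le_max_right _ _) (le_max_left _ _)
      (Nat.cast_nonneg R) n (δ := Real.pi / 2 * (1 / ((n : ℝ) + 1))) (by positivity)
      (by have : (n : ℝ) + 1 ≠ 0 := by positivity
          field_simp)
  have hτ := ENNReal.Tendsto.const_mul (a := ENNReal.ofReal Real.pi)
    (ENNReal.Tendsto.const_mul (a := 2) (tendsto_pairTail ν (by linarith) hN)
      (Or.inr ENNReal.ofNat_ne_top)) (Or.inr ENNReal.ofReal_ne_top) |>.const_add I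
  simp only [mul_zero, add_zero] at hτ
  exact ge_of_tendsto' hτ hlim

end Rotation

/-- The density of the standard Gaussian measure translated by `a`. -/
def cmDensity {d : ℕ} (a z : Euc d) : ℝ := Real.exp (inner ℝ a z - ‖a‖ ^ 2 / 2)

theorem cmDensity_nonneg {d : ℕ} (a z : Euc d) : 0 ≤ cmDensity a z := Real.exp_nonneg _

theorem integrable_cmDensity {d : ℕ} (a : Euc d) :
    Integrable (cmDensity a) (ProbabilityTheory.stdGaussian (Euc d)) :=
  integrable_exp_stdGaussian a

theorem integral_cmDensity {d : ℕ} (a : Euc d) :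
    ∫ z, cmDensity a z ∂(ProbabilityTheory.stdGaussian (Euc d)) = 1 :=
  integral_exp_stdGaussian a

/-- The random vector field whose conditional expectation is the tangent drift. -/
def steinField {α : Type*} [MeasurableSpace α] {d : ℕ} (s lam : ℝ) (m : Measure α) (Δ : α → Euc d)
    (x z : Euc d) : Euc d :=
  x - lam • z + (1 / (2 * s)) • ∫ a, (1 + cmDensity (lam • Δ a) z) • Δ a ∂m

theorem integral_eq_zero_of_swap {α F : Type*} [MeasurableSpace α] [NormedAddCommGroup F]
    [NormedSpace ℝ F] {μ : Measure (α × α)} (hμ : μ.map Prod.swap = μ) {H : α × α → F}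
    (hH : ∀ w, H w.swap = -H w) : ∫ w, H w ∂μ = 0 := by
  have hmp : MeasurePreserving (MeasurableEquiv.prodComm : α × α ≃ᵐ α × α) μ μ :=
    ⟨MeasurableEquiv.prodComm.measurable, hμ⟩
  have h := hmp.integral_comp' H
  have h2 : ∫ w, H (MeasurableEquiv.prodComm w) ∂μ = - ∫ w, H w ∂μ := by
    rw [← integral_neg]
    exact integral_congr_ae (Filter.Eventually.of_forall fun w => hH w)
  rw [h2] at h
  have h3 : (2 : ℝ) • ∫ w, H w ∂μ = 0 := by
    rw [two_smul]; nth_rw 1 [← h]; simp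
  simpa using h3

section Exchangeable

variable {d : ℕ} {μ : Measure (Euc d × Euc d)}

theorem integrable_one_add_cmDensity_smul
    (hint : Integrable (fun w : Euc d × Euc d => w.2 - w.1) μ) (lam : ℝ) :
    Integrable (fun q : (Euc d × Euc d) × Euc d =>
      (1 + cmDensity (lam • (q.1.2 - q.1.1)) q.2) • (q.1.2 - q.1.1))
      (μ.prod (ProbabilityTheory.stdGaussian (Euc d))) := by
  have hm : Measurable fun q : (Euc d × Euc d) × Euc d =>
      (1 + cmDensity (lam • (q.1.2 - q.1.1)) q.2) • (q.1.2 - q.1.1) := by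
    unfold cmDensity; fun_prop
  have hz : ∀ w : Euc d × Euc d, Integrable
      (fun z => (1 + cmDensity (lam • (w.2 - w.1)) z) • (w.2 - w.1))
      (ProbabilityTheory.stdGaussian (Euc d)) := fun w => by
    have h1 : Integrable (fun z => 1 + cmDensity (lam • (w.2 - w.1)) z)
        (ProbabilityTheory.stdGaussian (Euc d)) :=
      (integrable_const (1 : ℝ)).add (integrable_cmDensity _)
    exact h1.smul_const _
  rw [integrable_prod_iff hm.aestronglyMeasurable]
  refine ⟨Filter.Eventually.of_forall hz, ?_⟩
  have h : (fun w : Euc d × Euc d => ∫ z, ‖(1 + cmDensity (lam • (w.2 - w.1)) z) • (w.2 - w.1)‖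
      ∂(ProbabilityTheory.stdGaussian (Euc d))) = fun w => 2 * ‖w.2 - w.1‖ := by
    ext1 w
    simp_rw [norm_smul, Real.norm_of_nonneg (add_nonneg zero_le_one (cmDensity_nonneg _ _))]
    rw [integral_mul_const, integral_add (integrable_const _) (integrable_cmDensity _),
      integral_cmDensity]
    norm_num
  dsimp only
  rw [h]
  exact hint.norm.const_mul 2

theorem integral_stein_swap [IsProbabilityMeasure μ] (hμ : μ.map Prod.swap = μ)
    (hint : Integrable (fun w : Euc d × Euc d => w.2 - w.1) μ) {φ : Euc d → ℝ} (hφ : Measurable φ)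
    (hφ1 : ∀ y, ‖φ y‖ ≤ 1) {c s : ℝ} (hs : s ≠ 0) :
    Integrable (fun q : (Euc d × Euc d) × Euc d => φ (c • q.1.1 + s • q.2) •
      (1 + cmDensity ((c / s) • (q.1.2 - q.1.1)) q.2) • (q.1.2 - q.1.1))
      (μ.prod (ProbabilityTheory.stdGaussian (Euc d))) ∧
    ∫ q, φ (c • q.1.1 + s • q.2) •
      (1 + cmDensity ((c / s) • (q.1.2 - q.1.1)) q.2) • (q.1.2 - q.1.1)
      ∂(μ.prod (ProbabilityTheory.stdGaussian (Euc d))) = 0 := by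
  have hi : Integrable (fun q : (Euc d × Euc d) × Euc d => φ (c • q.1.1 + s • q.2) •
      (1 + cmDensity ((c / s) • (q.1.2 - q.1.1)) q.2) • (q.1.2 - q.1.1))
      (μ.prod (ProbabilityTheory.stdGaussian (Euc d))) := by
    refine (integrable_one_add_cmDensity_smul hint (c / s)).mono ?_
      (Filter.Eventually.of_forall fun q => ?_)
    · refine Measurable.aestronglyMeasurable ?_
      unfold cmDensity; fun_prop
    · rw [norm_smul]
      exact mul_le_of_le_one_left (norm_nonneg _) (hφ1 _)
  refine ⟨hi, ?_⟩
  rw [integral_prod _ hi]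
  have hφi : ∀ x, Integrable (fun z => φ (c • x + s • z)) (ProbabilityTheory.stdGaussian (Euc d)) :=
    fun x => Integrable.of_bound
      (hφ.comp (by fun_prop : Measurable fun z : Euc d => c • x + s • z)).aestronglyMeasurable 1
      (Filter.Eventually.of_forall fun z => hφ1 _)
  have hin : ∀ w : Euc d × Euc d, ∫ z, φ (c • w.1 + s • z) •
      (1 + cmDensity ((c / s) • (w.2 - w.1)) z) • (w.2 - w.1)
      ∂(ProbabilityTheory.stdGaussian (Euc d)) =
      (∫ z, φ (c • w.1 + s • z) ∂(ProbabilityTheory.stdGaussian (Euc d)) +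
        ∫ z, φ (c • w.2 + s • z) ∂(ProbabilityTheory.stdGaussian (Euc d))) • (w.2 - w.1) :=
    fun w => by
    have hsh : ∀ z, φ (c • w.2 + s • z) = φ (c • w.1 + s • (z + (c / s) • (w.2 - w.1))) :=
      fun z => by
      congr 1
      rw [smul_add, smul_smul, mul_div_cancel₀ _ hs]
      module
    have hcm := integral_stdGaussian_add ((c / s) • (w.2 - w.1)) fun z => φ (c • w.1 + s • z)
    have hci := integrable_stdGaussian_add ((c / s) • (w.2 - w.1))
      (f := fun z => φ (c • w.1 + s • z)) (by
        simp_rw [← hsh]; exact hφi _)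
    simp_rw [← hsh] at hcm
    rw [hcm, ← integral_add (hφi _) hci, ← integral_smul_const]
    refine integral_congr_ae (Filter.Eventually.of_forall fun z => ?_)
    simp only [cmDensity, smul_eq_mul, smul_smul]
    ring_nf
  simp_rw [hin]
  refine integral_eq_zero_of_swap hμ fun w => ?_
  simp only [Prod.fst_swap, Prod.snd_swap]
  module

end Exchangeable

section Disintegration

variable {d : ℕ} {ν : Measure (Euc d)} [IsProbabilityMeasure ν] {k : Kernel (Euc d) (Euc d)}
  [IsMarkovKernel k]

theorem measurePreserving_prod_compProd (γ : Measure (Euc d)) [IsProbabilityMeasure γ] :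
    MeasurePreserving
      (fun w : (Euc d × Euc d) × Euc d => ((w.1.1, w.2), w.1.2))
      ((ν.prod γ) ⊗ₘ (k.comap Prod.fst measurable_fst)) ((ν ⊗ₘ k).prod γ) := by
  refine ⟨by fun_prop, Measure.ext_of_lintegral _ fun f hf => ?_⟩
  rw [lintegral_map hf (by fun_prop), Measure.lintegral_compProd (by fun_prop),
    lintegral_prod _ hf.aemeasurable, Measure.lintegral_compProd hf.lintegral_prod_right',
    lintegral_prod _ (Measurable.lintegral_kernel_prod_right'
      (κ := k.comap Prod.fst measurable_fst)
      (f := fun w : (Euc d × Euc d) × Euc d => f ((w.1.1, w.2), w.1.2))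
      (by fun_prop)).aemeasurable]
  refine lintegral_congr fun x => ?_
  simp only [Kernel.comap_apply]
  exact lintegral_lintegral_swap (f := fun z x' => f ((x, x'), z)) (by fun_prop)

theorem measurable_steinField_kernel (s lam : ℝ) :
    Measurable fun q : Euc d × Euc d => steinField s lam (k q.1) (fun x' => x' - q.1) q.1 q.2 := by
  have h : Measurable fun q : Euc d × Euc d =>
      ∫ x', (1 + cmDensity (lam • (x' - q.1)) q.2) • (x' - q.1) ∂(k q.1) :=
    (StronglyMeasurable.integral_kernel_prod_right' (κ := k.comap Prod.fst measurable_fst)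
      (f := fun w : (Euc d × Euc d) × Euc d =>
        (1 + cmDensity (lam • (w.2 - w.1.1)) w.1.2) • (w.2 - w.1.1))
      (Measurable.stronglyMeasurable (by unfold cmDensity; fun_prop))).measurable
  unfold steinField
  fun_prop

theorem integral_smul_steinField (hsw : (ν ⊗ₘ k).map Prod.swap = ν ⊗ₘ k)
    (hν : Integrable (fun x => x) ν)
    (hint : Integrable (fun w : Euc d × Euc d => w.2 - w.1) (ν ⊗ₘ k)) {φ : Euc d → ℝ}
    (hφ : Measurable φ) (hφ1 : ∀ y, ‖φ y‖ ≤ 1) (r : ℝ) {c s : ℝ} (hs : s ≠ 0) :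
    Integrable (fun q : Euc d × Euc d => steinField r (c / s) (k q.1) (fun x' => x' - q.1) q.1 q.2)
      (ν.prod (ProbabilityTheory.stdGaussian (Euc d))) ∧
    ∫ q, φ (c • q.1 + s • q.2) • steinField r (c / s) (k q.1) (fun x' => x' - q.1) q.1 q.2
      ∂(ν.prod (ProbabilityTheory.stdGaussian (Euc d))) =
    ∫ q, φ (c • q.1 + s • q.2) • (q.1 - (c / s) • q.2)
      ∂(ν.prod (ProbabilityTheory.stdGaussian (Euc d))) := by
  have hmp := measurePreserving_prod_compProd (ν := ν) (k := k)
    (ProbabilityTheory.stdGaussian (Euc d))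
  have key : ∀ {ψ : Euc d → ℝ}, Measurable ψ → (∀ y, ‖ψ y‖ ≤ 1) →
      Integrable (fun q : Euc d × Euc d => ψ (c • q.1 + s • q.2) • ∫ x',
        (1 + cmDensity ((c / s) • (x' - q.1)) q.2) • (x' - q.1) ∂(k q.1))
        (ν.prod (ProbabilityTheory.stdGaussian (Euc d))) ∧
      ∫ q, ψ (c • q.1 + s • q.2) • ∫ x',
        (1 + cmDensity ((c / s) • (x' - q.1)) q.2) • (x' - q.1) ∂(k q.1)
        ∂(ν.prod (ProbabilityTheory.stdGaussian (Euc d))) = 0 := by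
    intro ψ hψ hψ1
    obtain ⟨hi, h0⟩ := integral_stein_swap hsw hint hψ hψ1 (c := c) hs
    rw [← hmp.map_eq, integral_map hmp.measurable.aemeasurable
      (hmp.map_eq.symm ▸ hi.aestronglyMeasurable)] at h0
    have hi' := (hmp.integrable_comp hi.aestronglyMeasurable).2 hi
    replace h0 := (Measure.integral_compProd hi').symm.trans h0
    have hii := hi'.integral_compProd
    simp only [Function.comp_apply, Kernel.comap_apply, Kernel.prodMkLeft_apply, Kernel.const_apply,
      integral_smul] at h0 hii
    exact ⟨hii, h0⟩
  have hq1 : Integrable (fun q : Euc d × Euc d => q.1)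
      (ν.prod (ProbabilityTheory.stdGaussian (Euc d))) := hν.comp_fst _
  have hq2 : Integrable (fun q : Euc d × Euc d => q.2)
      (ν.prod (ProbabilityTheory.stdGaussian (Euc d))) :=
    ((memLp_id_stdGaussian d 1 (by simp)).integrable le_rfl).comp_snd ν
  have hlin : Integrable (fun q : Euc d × Euc d => q.1 - (c / s) • q.2)
      (ν.prod (ProbabilityTheory.stdGaussian (Euc d))) := hq1.sub (hq2.smul (c / s))
  obtain ⟨hG, -⟩ := key (ψ := fun _ => 1) measurable_const (by simp)
  simp only [one_smul] at hG
  refine ⟨hlin.add (hG.smul (1 / (2 * r))), ?_⟩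
  obtain ⟨hiφ, h0⟩ := key hφ hφ1
  have hlinφ : Integrable (fun q : Euc d × Euc d => φ (c • q.1 + s • q.2) • (q.1 - (c / s) • q.2))
      (ν.prod (ProbabilityTheory.stdGaussian (Euc d))) := by
    refine hlin.mono (by fun_prop) (Filter.Eventually.of_forall fun q => ?_)
    rw [norm_smul]
    exact mul_le_of_le_one_left (norm_nonneg _) (hφ1 _)
  have hsplit : ∀ q : Euc d × Euc d,
      φ (c • q.1 + s • q.2) • steinField r (c / s) (k q.1) (fun x' => x' - q.1) q.1 q.2 =
      φ (c • q.1 + s • q.2) • (q.1 - (c / s) • q.2) + (1 / (2 * r)) • (φ (c • q.1 + s • q.2) • ∫ x',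
        (1 + cmDensity ((c / s) • (x' - q.1)) q.2) • (x' - q.1) ∂(k q.1)) := fun q => by
    unfold steinField; module
  simp_rw [hsplit]
  refine (integral_add hlinφ (hiφ.smul (1 / (2 * r)))).trans ?_
  simp only [Pi.smul_apply]
  rw [integral_smul, h0, smul_zero, add_zero]

theorem rotDriftNorm_le_eLpNorm_steinField (hsw : (ν ⊗ₘ k).map Prod.swap = ν ⊗ₘ k)
    (hν : Integrable (fun x => x) ν)
    (hint : Integrable (fun w : Euc d × Euc d => w.2 - w.1) (ν ⊗ₘ k)) {p : ℝ} (hp : 1 ≤ p) (r : ℝ)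
    {θ : ℝ} (hs : Real.sin θ ≠ 0) :
    rotDriftNorm ν p θ ≤ ‖Real.sin θ‖ₑ * eLpNorm (fun q : Euc d × Euc d =>
      steinField r (Real.cos θ / Real.sin θ) (k q.1) (fun x' => x' - q.1) q.1 q.2)
      (ENNReal.ofReal p) (ν.prod (ProbabilityTheory.stdGaussian (Euc d))) := by
  set c := Real.cos θ with hc
  set s := Real.sin θ with hsdef
  set P := ν.prod (ProbabilityTheory.stdGaussian (Euc d)) with hP
  set U : Euc d × Euc d → Euc d := fun q =>
    steinField r (c / s) (k q.1) (fun x' => x' - q.1) q.1 q.2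
  have hrot := measurable_rotPair_right (d := d) θ
  let Y : Euc d × Euc d → Euc d := fun q => (rotPair θ q).1
  have hY : Measurable Y := by fun_prop
  have hUi : Integrable U P :=
    (integral_smul_steinField hsw hν hint (φ := fun _ => 1) measurable_const (by simp) r hs).1
  have hmap : (rotKernel ν θ).map Prod.fst = P.map Y := by
    rw [rotKernel_apply, Measure.map_map measurable_fst hrot]; rfl
  have hv := measurable_rotDrift ν
  have hvm : Measurable fun y => rotDrift ν (θ, y) := by fun_prop
  have hsndP : Integrable (fun q => (rotPair θ q).2) P := by
    have hq1 : Integrable (fun q : Euc d × Euc d => q.1) P := hν.comp_fst _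
    have hq2 : Integrable (fun q : Euc d × Euc d => q.2) P :=
      ((memLp_id_stdGaussian d 1 (by simp)).integrable le_rfl).comp_snd ν
    exact (hq1.smul (-s)).add (hq2.smul c)
  have hsnd : Integrable Prod.snd (rotKernel ν θ) := by
    rw [rotKernel_apply, integrable_map_measure (by fun_prop) hrot.aemeasurable]
    exact hsndP
  have hset : ∀ B, MeasurableSet B →
      ∫ q in Y ⁻¹' B, rotDrift ν (θ, Y q) ∂P = ∫ q in Y ⁻¹' B, (-s) • U q ∂P := fun B hB => by
    have h1 : ∫ q in Y ⁻¹' B, rotDrift ν (θ, Y q) ∂P =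
        ∫ y in B, rotDrift ν (θ, y) ∂((rotKernel ν θ).map Prod.fst) := by
      rw [hmap, setIntegral_map hB hvm.aestronglyMeasurable hY.aemeasurable]
    have h2 : ∫ y in B, rotDrift ν (θ, y) ∂((rotKernel ν θ).map Prod.fst) =
        ∫ w in B ×ˢ Set.univ, w.2 ∂(rotKernel ν θ) := by
      have := Measure.setIntegral_compProd (μ := (rotKernel ν θ).map Prod.fst)
        (κ := (rotKernel ν).condKernel.sectR θ) hB MeasurableSet.univ
        (f := (Prod.snd : Euc d × Euc d → Euc d))
        (by rw [rotKernel_disintegrate]; exact hsnd.integrableOn)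
      rw [rotKernel_disintegrate] at this
      rw [this]
      simp only [Measure.restrict_univ]
      rfl
    have h3 : ∫ w in B ×ˢ Set.univ, w.2 ∂(rotKernel ν θ) = ∫ q in Y ⁻¹' B, (rotPair θ q).2 ∂P := by
      rw [rotKernel_apply, setIntegral_map (hB.prod MeasurableSet.univ) (by fun_prop)
        hrot.aemeasurable]
      congr 2
      ext q; simp [Y]
    let φ : Euc d → ℝ := B.indicator fun _ => 1
    have hφ : Measurable φ := measurable_const.indicator hB
    have hφ1 : ∀ y, ‖φ y‖ ≤ 1 := fun y => by
      simp only [φ, Set.indicator]; split_ifs <;> simp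
    have h4 := (integral_smul_steinField hsw hν hint hφ hφ1 r (c := c) hs).2
    have h5 : ∀ f : Euc d × Euc d → Euc d,
        ∫ q, φ (c • q.1 + s • q.2) • f q ∂P = ∫ q in Y ⁻¹' B, f q ∂P := fun f => by
      rw [← integral_indicator (hY hB)]
      refine integral_congr_ae (Filter.Eventually.of_forall fun q => ?_)
      by_cases hq : Y q ∈ B
      · have hq' : c • q.1 + s • q.2 ∈ B := hq
        simp [φ, Set.indicator, hq, hq']
      · have hq' : c • q.1 + s • q.2 ∉ B := hq
        simp [φ, Set.indicator, hq, hq']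
    rw [h5, h5] at h4
    rw [h1, h2, h3, integral_smul, h4, ← integral_smul]
    refine integral_congr_ae (Filter.Eventually.of_forall fun q => ?_)
    simp only [rotPair]
    rw [smul_sub, smul_smul, show -s * (c / s) = -c by field_simp]
    module
  have hle : MeasurableSpace.comap Y inferInstance ≤
    (inferInstance : MeasurableSpace (Euc d × Euc d)) := hY.comap_le
  have hce : (fun q => rotDrift ν (θ, Y q)) =ᵐ[P]
      P[fun q => (-s) • U q | MeasurableSpace.comap Y inferInstance] := by
    have hvi : Integrable (fun q => rotDrift ν (θ, Y q)) P := by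
      have := hsnd
      rw [← rotKernel_disintegrate] at this
      have h6 := this.integral_compProd
      simp only [Kernel.const_apply, Kernel.prodMkLeft_apply] at h6
      rw [hmap] at h6
      exact h6.comp_measurable hY
    refine ae_eq_condExp_of_forall_setIntegral_eq hle (hUi.smul (-s))
      (fun _ _ _ => hvi.integrableOn) ?_ ?_
    · rintro _ ⟨B, hB, rfl⟩ -
      exact hset B hB
    · exact (hvm.comp (comap_measurable Y)).stronglyMeasurable.aestronglyMeasurable
  have h7 : rotDriftNorm ν p θ = eLpNorm (fun q => rotDrift ν (θ, Y q)) (ENNReal.ofReal p) P := by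
    rw [rotDriftNorm, hmap, eLpNorm_map_measure hvm.aestronglyMeasurable hY.aemeasurable]
    rfl
  rw [h7, eLpNorm_congr_ae hce]
  refine (eLpNorm_condExp_le_eLpNorm _ (by simpa using hp)).trans ?_
  have h8 := eLpNorm_const_smul (-s) U (ENNReal.ofReal p) P
  rw [enorm_neg] at h8
  exact h8.le

end Disintegration

theorem cmDensity_combination {d : ℕ} {c s : ℝ} (h : c ^ 2 + s ^ 2 = 1) (a z z' : Euc d) :
    cmDensity a (c • z + s • z') = cmDensity (c • a) z * cmDensity (s • a) z' := by
  simp only [cmDensity, ← Real.exp_add, norm_smul, inner_add_right, real_inner_smul_left,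
    real_inner_smul_right, mul_pow, Real.norm_eq_abs, sq_abs]
  congr 1
  linear_combination (‖a‖ ^ 2 / 2) * h

theorem cmDensity_le {d : ℕ} (a z : Euc d) : cmDensity a z ≤ Real.exp (‖z‖ ^ 2 / 2) := by
  refine Real.exp_le_exp.2 ?_
  nlinarith [real_inner_le_norm a z, sq_nonneg (‖a‖ - ‖z‖)]

section SteinField

variable {α : Type*} [MeasurableSpace α] {d : ℕ} {m : Measure α} {Δ : α → Euc d}

theorem integrable_cmDensity_smul (hΔ : Measurable Δ) (hi : Integrable Δ m) (lam : ℝ) (z : Euc d) :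
    Integrable (fun a => cmDensity (lam • Δ a) z • Δ a) m := by
  refine (hi.norm.const_mul (Real.exp (‖z‖ ^ 2 / 2))).mono' ?_
    (Filter.Eventually.of_forall fun a => ?_)
  · refine Measurable.aestronglyMeasurable ?_
    unfold cmDensity; fun_prop
  · rw [norm_smul, Real.norm_of_nonneg (cmDensity_nonneg _ _)]
    exact mul_le_mul_of_nonneg_right (cmDensity_le _ _) (norm_nonneg _)

theorem steinField_eq (hΔ : Measurable Δ) (hi : Integrable Δ m) (s lam : ℝ) (x z : Euc d) :
    steinField s lam m Δ x z = x + (1 / (2 * s)) • ∫ a, Δ a ∂m - lam • z +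
      (1 / (2 * s)) • ∫ a, cmDensity (lam • Δ a) z • Δ a ∂m := by
  simp only [steinField, add_smul, one_smul]
  rw [integral_add hi (integrable_cmDensity_smul hΔ hi lam z)]
  module

variable [IsProbabilityMeasure m]

theorem measurable_integral_cmDensity_smul (hΔ : Measurable Δ) (lam : ℝ) :
    Measurable fun z => ∫ a, cmDensity (lam • Δ a) z • Δ a ∂m := by
  refine (StronglyMeasurable.integral_prod_right
    (f := fun z a => cmDensity (lam • Δ a) z • Δ a) ?_).measurable
  refine Measurable.stronglyMeasurable ?_
  unfold Function.uncurry cmDensity; fun_prop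

theorem measurable_steinField (hΔ : Measurable Δ) (hi : Integrable Δ m) (s lam : ℝ) (x : Euc d) :
    Measurable (steinField s lam m Δ x) := by
  have h := measurable_integral_cmDensity_smul (m := m) hΔ lam
  rw [funext (steinField_eq hΔ hi s lam x)]
  fun_prop

theorem integral_steinField_combination (hΔ : Measurable Δ) (hi : Integrable Δ m) (r lam : ℝ)
    {c s : ℝ} (h : c ^ 2 + s ^ 2 = 1) (x z : Euc d) :
    ∫ z', steinField r lam m Δ x (c • z + s • z') ∂(ProbabilityTheory.stdGaussian (Euc d)) =
      steinField r (c * lam) m Δ x z := by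
  have hm : Measurable fun q : α × Euc d =>
      cmDensity (lam • Δ q.1) (c • z + s • q.2) • Δ q.1 := by
    unfold cmDensity; fun_prop
  have hz : ∀ a, ∫ z', cmDensity (lam • Δ a) (c • z + s • z')
      ∂(ProbabilityTheory.stdGaussian (Euc d)) = cmDensity ((c * lam) • Δ a) z := fun a => by
    simp_rw [cmDensity_combination h, smul_smul c lam]
    rw [integral_const_mul, integral_cmDensity, mul_one]
  have hzi : ∀ a, Integrable (fun z' => cmDensity (lam • Δ a) (c • z + s • z'))
      (ProbabilityTheory.stdGaussian (Euc d)) := fun a => by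
    simp_rw [cmDensity_combination h]
    exact (integrable_cmDensity _).const_mul _
  have hprod : Integrable (fun q : α × Euc d =>
      cmDensity (lam • Δ q.1) (c • z + s • q.2) • Δ q.1)
      (m.prod (ProbabilityTheory.stdGaussian (Euc d))) := by
    rw [integrable_prod_iff hm.aestronglyMeasurable]
    refine ⟨Filter.Eventually.of_forall fun a => (hzi a).smul_const (Δ a), ?_⟩
    refine (integrable_cmDensity_smul hΔ hi (c * lam) z).norm.congr
      (Filter.Eventually.of_forall fun a => ?_)
    simp_rw [norm_smul, Real.norm_of_nonneg (cmDensity_nonneg _ _)]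
    rw [integral_mul_const, hz]
  have hswap := integral_integral_swap
    (f := fun a z' => cmDensity (lam • Δ a) (c • z + s • z') • Δ a) hprod
  simp_rw [integral_smul_const, hz] at hswap
  simp_rw [steinField_eq hΔ hi]
  have hid : Integrable (fun z' : Euc d => z') (ProbabilityTheory.stdGaussian (Euc d)) :=
    (memLp_id_stdGaussian d 1 (by simp)).integrable le_rfl
  have hid0 : ∫ z' : Euc d, z' ∂(ProbabilityTheory.stdGaussian (Euc d)) = 0 := by
    simp
  have hlin : Integrable (fun z' : Euc d => lam • (c • z + s • z'))
      (ProbabilityTheory.stdGaussian (Euc d)) :=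
    ((integrable_const (c • z)).add (hid.smul s)).smul lam
  have hlin0 : ∫ z' : Euc d, lam • (c • z + s • z') ∂(ProbabilityTheory.stdGaussian (Euc d)) =
      (c * lam) • z := by
    have hs : Integrable (fun z' : Euc d => s • z') (ProbabilityTheory.stdGaussian (Euc d)) :=
      hid.smul s
    rw [integral_smul, integral_add (integrable_const _) hs, integral_smul s, hid0]
    simp [smul_smul, mul_comm]
  have hG : Integrable (fun z' => (1 / (2 * r)) •
      ∫ a, cmDensity (lam • Δ a) (c • z + s • z') • Δ a ∂m)
      (ProbabilityTheory.stdGaussian (Euc d)) := hprod.integral_prod_right.smul (1 / (2 * r))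
  have hB : Integrable (fun z' => x + (1 / (2 * r)) • ∫ a, Δ a ∂m - lam • (c • z + s • z'))
      (ProbabilityTheory.stdGaussian (Euc d)) := (integrable_const _).sub hlin
  rw [integral_add hB hG, integral_sub (integrable_const _) hlin, integral_smul (1 / (2 * r)),
    ← hswap, hlin0]
  simp

theorem lintegral_steinField_rpow_le (hΔ : Measurable Δ) (hi : Integrable Δ m) (r eta : ℝ) {p : ℝ}
    (hp : 1 ≤ p) (x : Euc d) :
    ∫⁻ z, ‖steinField r eta m Δ x z‖ₑ ^ p ∂(ProbabilityTheory.stdGaussian (Euc d)) ≤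
      (∫⁻ z, ‖steinField r (√(max 1 (p - 1)) * eta) m Δ x z‖ₑ ^ (2 : ℝ)
        ∂(ProbabilityTheory.stdGaussian (Euc d))) ^ (p / 2) := by
  have hp0 : 0 < p := by linarith
  rcases le_or_gt p 2 with hp2 | hp2
  · rw [max_eq_left (by linarith), Real.sqrt_one, one_mul]
    have hm : Measurable fun z => ‖steinField r eta m Δ x z‖ₑ ^ p :=
      (measurable_steinField hΔ hi r eta x).enorm.pow_const p
    have h := lintegral_rpow_le_lintegral_rpow
      (μ := ProbabilityTheory.stdGaussian (Euc d)) (p := 2 / p) (by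
        rw [le_div_iff₀ hp0]; linarith) hm
    simp_rw [← ENNReal.rpow_mul, mul_div_cancel₀ (2 : ℝ) hp0.ne'] at h
    have h2 := ENNReal.rpow_le_rpow h (by positivity : 0 ≤ p / 2)
    rwa [← ENNReal.rpow_mul, show 2 / p * (p / 2) = 1 by field_simp, ENNReal.rpow_one] at h2
  · rw [max_eq_right (by linarith)]
    have hr : 0 < √(p - 1) := Real.sqrt_pos.2 (by linarith)
    have hr2 : √(p - 1) ^ 2 = p - 1 := Real.sq_sqrt (by linarith)
    have hc : (1 / √(p - 1)) ^ 2 ≤ 1 := by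
      rw [div_pow, hr2, one_pow, div_le_one (by linarith)]; linarith
    have hcs : (1 / √(p - 1)) ^ 2 + √(1 - (1 / √(p - 1)) ^ 2) ^ 2 = 1 := by
      rw [Real.sq_sqrt (by linarith)]; ring
    have hV := measurable_steinField hΔ hi r (√(p - 1) * eta) x
    have h := ENNReal.rpow_le_rpow (hypercontractive_mehler hp2 hV.enorm) hp0.le
    rw [← ENNReal.rpow_mul, ← ENNReal.rpow_mul, one_div_mul_cancel hp0.ne', ENNReal.rpow_one] at h
    rw [show p / 2 = 1 / 2 * p by ring]
    refine (lintegral_mono fun z => ENNReal.rpow_le_rpow ?_ hp0.le).trans (h.trans_eq ?_)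
    · have he := integral_steinField_combination hΔ hi r (√(p - 1) * eta) hcs x z
      rw [← mul_assoc, one_div_mul_cancel hr.ne', one_mul] at he
      rw [← he]
      exact enorm_integral_le_lintegral_enorm _
    · norm_num

end SteinField

theorem inner_pow_eq_sum_monoE {d : ℕ} (u v : Euc d) (k : ℕ) :
    (inner ℝ u v : ℝ) ^ k = ∑ α ∈ Finset.piAntidiag (Finset.univ : Finset (Fin d)) k,
      ((k.factorial : ℝ) / (mfact α : ℝ)) * (monoE α u * monoE α v) := by
  have h : (inner ℝ u v : ℝ) = ∑ i, u i * v i := by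
    simp [PiLp.inner_apply, mul_comm]
  rw [h, Finset.sum_pow_eq_sum_piAntidiag]
  refine Finset.sum_congr rfl fun α hα => ?_
  have hk : ∑ i, α i = k := (Finset.mem_piAntidiag.1 hα).1
  have hf : (mfact α : ℝ) ≠ 0 := by
    unfold mfact; exact_mod_cast Finset.prod_ne_zero_iff.2 fun i _ => (α i).factorial_ne_zero
  have hmul : (mfact α : ℝ) * (Nat.multinomial Finset.univ α : ℝ) = (k.factorial : ℝ) := by
    rw [← hk]; exact_mod_cast Nat.multinomial_spec Finset.univ α
  rw [show ((k.factorial : ℝ) / (mfact α : ℝ)) = (Nat.multinomial Finset.univ α : ℝ) by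
    rw [← hmul]; field_simp]
  simp only [monoE, ← Finset.prod_mul_distrib, mul_pow]

theorem tsum_ite_mdeg_eq_sum {d : ℕ} (k : ℕ) (f : (Fin d → ℕ) → ℝ) :
    (∑' α : Fin d → ℕ, if mdeg α = k then f α else 0) =
      ∑ α ∈ Finset.piAntidiag (Finset.univ : Finset (Fin d)) k, f α := by
  have hmem : ∀ α : Fin d → ℕ, α ∈ Finset.piAntidiag (Finset.univ : Finset (Fin d)) k ↔
      mdeg α = k := fun α => by simp [mdeg]
  rw [tsum_eq_sum (s := Finset.piAntidiag Finset.univ k)]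
  · exact Finset.sum_congr rfl fun α hα => if_pos ((hmem α).1 hα)
  · exact fun α hα => if_neg fun h => hα ((hmem α).2 h)

theorem abs_monoE_le {d : ℕ} (α : Fin d → ℕ) (u : Euc d) : |monoE α u| ≤ ‖u‖ ^ mdeg α := by
  rw [monoE, Finset.abs_prod, mdeg, ← Finset.prod_pow_eq_pow_sum]
  refine Finset.prod_le_prod (fun _ _ => abs_nonneg _) fun i _ => ?_
  rw [abs_pow]
  exact pow_le_pow_left₀ (abs_nonneg _) (PiLp.norm_apply_le u i) _

theorem measurable_monoE {d : ℕ} (α : Fin d → ℕ) : Measurable (monoE α) := by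
  unfold monoE; fun_prop

theorem sum_inner_single_sq {d : ℕ} (f : (Fin d → ℕ) → ℝ) :
    ∑ α ∈ Finset.piAntidiag (Finset.univ : Finset (Fin d)) 2,
      ((2 : ℝ) / (mfact α : ℝ)) * (idFam α * f α) = ∑ i, f (Pi.single i 2) := by
  have hinj : Function.Injective fun i : Fin d => (Pi.single i 2 : Fin d → ℕ) := fun i j h => by
    by_contra hij
    have := congrFun h i
    simp [hij] at this
  have hsub : (Finset.univ.image fun i : Fin d => (Pi.single i 2 : Fin d → ℕ)) ⊆
      Finset.piAntidiag (Finset.univ : Finset (Fin d)) 2 := fun α hα => by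
    obtain ⟨i, -, rfl⟩ := Finset.mem_image.1 hα
    simp
  rw [← Finset.sum_subset hsub, Finset.sum_image hinj.injOn]
  · refine Finset.sum_congr rfl fun i _ => ?_
    have hfact : mfact (Pi.single i 2 : Fin d → ℕ) = 2 := by
      rw [mfact, Finset.prod_eq_single i] <;> simp +contextual
    rw [hfact, idFam, if_pos ⟨i, rfl⟩]
    norm_num
  · intro α _ hα
    rw [idFam, if_neg, zero_mul, mul_zero]
    rintro ⟨i, rfl⟩
    exact hα (Finset.mem_image_of_mem _ (Finset.mem_univ i))

theorem monoE_single_two {d : ℕ} (i : Fin d) (u : Euc d) : monoE (Pi.single i 2) u = u i ^ 2 := by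
  rw [monoE, Finset.prod_eq_single i] <;> simp +contextual

section Moments

variable {α : Type*} [MeasurableSpace α] {d : ℕ} {m : Measure α} {Δ : α → Euc d}

theorem integrable_monoE_comp (hΔ : Measurable Δ) (hi : ∀ k : ℕ, Integrable (fun a => ‖Δ a‖ ^ k) m)
    (β : Fin d → ℕ) : Integrable (fun a => monoE β (Δ a)) m :=
  (hi (mdeg β)).mono' ((measurable_monoE β).comp hΔ).aestronglyMeasurable
    (Filter.Eventually.of_forall fun a => abs_monoE_le β (Δ a))

theorem integral_inner_pow [IsProbabilityMeasure m] (hΔ : Measurable Δ)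
    (hi : ∀ k : ℕ, Integrable (fun a => ‖Δ a‖ ^ k) m)
    (k : ℕ) :
    ∫ w, (inner ℝ (Δ w.1) (Δ w.2) : ℝ) ^ k ∂(m.prod m) =
      ∑ β ∈ Finset.piAntidiag (Finset.univ : Finset (Fin d)) k,
        ((k.factorial : ℝ) / (mfact β : ℝ)) * (∫ a, monoE β (Δ a) ∂m) ^ 2 := by
  simp_rw [inner_pow_eq_sum_monoE]
  rw [integral_finsetSum]
  · refine Finset.sum_congr rfl fun β _ => ?_
    rw [integral_const_mul, integral_prod_mul (fun a => monoE β (Δ a)) fun a => monoE β (Δ a), sq]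
  · exact fun β _ => ((integrable_monoE_comp hΔ hi β).mul_prod
      (integrable_monoE_comp hΔ hi β)).const_mul _

theorem integrable_norm_mul_exp_prod (hΔ : Measurable Δ) {lam : ℝ}
    (he : Integrable (fun a => ‖Δ a‖ * Real.exp (lam ^ 2 * ‖Δ a‖ ^ 2 / 2)) m) :
    Integrable (fun w : α × α => |(inner ℝ (Δ w.1) (Δ w.2) : ℝ)| *
      Real.exp (lam ^ 2 * |(inner ℝ (Δ w.1) (Δ w.2) : ℝ)|)) (m.prod m) := by
  refine (he.mul_prod he).mono' (by fun_prop) (Filter.Eventually.of_forall fun w => ?_)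
  have hin := abs_real_inner_le_norm (Δ w.1) (Δ w.2)
  rw [Real.norm_of_nonneg (by positivity), mul_mul_mul_comm, ← Real.exp_add]
  refine mul_le_mul hin (Real.exp_le_exp.2 ?_) (by positivity) (by positivity)
  nlinarith [mul_le_mul_of_nonneg_left hin (sq_nonneg lam),
    mul_nonneg (sq_nonneg lam) (sq_nonneg (‖Δ w.1‖ - ‖Δ w.2‖))]

theorem hasSum_integral_inner_mul_exp [IsProbabilityMeasure m] (hΔ : Measurable Δ) {lam : ℝ}
    (he : Integrable (fun a => ‖Δ a‖ * Real.exp (lam ^ 2 * ‖Δ a‖ ^ 2 / 2)) m) :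
    HasSum (fun n : ℕ => lam ^ (2 * n) / (n.factorial : ℝ) *
      ∫ w, (inner ℝ (Δ w.1) (Δ w.2) : ℝ) ^ (n + 1) ∂(m.prod m))
      (∫ w, (inner ℝ (Δ w.1) (Δ w.2) : ℝ) * Real.exp (lam ^ 2 * (inner ℝ (Δ w.1) (Δ w.2) : ℝ))
        ∂(m.prod m)) := by
  have hser : ∀ u : ℝ, HasSum (fun n : ℕ => lam ^ (2 * n) / (n.factorial : ℝ) * u ^ (n + 1))
      (u * Real.exp (lam ^ 2 * u)) := fun u => by
    have h := (NormedSpace.expSeries_div_hasSum_exp (𝔸 := ℝ) (lam ^ 2 * u)).mul_left u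
    rw [← Real.exp_eq_exp_ℝ] at h
    refine h.congr_fun ?_
    intro n
    rw [mul_pow, ← pow_mul]; ring
  simp_rw [← integral_const_mul]
  refine hasSum_integral_of_dominated_convergence
    (fun n w => lam ^ (2 * n) / (n.factorial : ℝ) * |(inner ℝ (Δ w.1) (Δ w.2) : ℝ)| ^ (n + 1))
    (fun n => by fun_prop) (fun n => Filter.Eventually.of_forall fun w => ?_)
    (Filter.Eventually.of_forall fun w => (hser _).summable) ?_
    (Filter.Eventually.of_forall fun w => hser _)
  · rw [norm_mul, norm_pow, Real.norm_of_nonneg (by rw [pow_mul]; positivity), Real.norm_eq_abs]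
  · simp_rw [(hser _).tsum_eq]
    exact integrable_norm_mul_exp_prod hΔ he

end Moments

section SecondMoment

variable {α : Type*} [MeasurableSpace α] {d : ℕ} {m : Measure α} [IsProbabilityMeasure m]
  {Δ : α → Euc d}

theorem integral_cmDensity_mul (a b : Euc d) :
    Integrable (fun z => cmDensity a z * cmDensity b z) (ProbabilityTheory.stdGaussian (Euc d)) ∧
    ∫ z, cmDensity a z * cmDensity b z ∂(ProbabilityTheory.stdGaussian (Euc d)) =
      Real.exp (inner ℝ a b) := by
  have h : ∀ z, cmDensity a z * cmDensity b z = Real.exp (inner ℝ a b) * cmDensity (a + b) z :=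
    fun z => by
    simp only [cmDensity, ← Real.exp_add]
    rw [norm_add_sq_real, inner_add_left]
    ring_nf
  simp_rw [h]
  refine ⟨(integrable_cmDensity _).const_mul _, ?_⟩
  rw [integral_const_mul, integral_cmDensity, mul_one]

theorem integrable_sq_norm_integral_cmDensity_smul (hΔ : Measurable Δ) (hi : Integrable Δ m)
    {lam : ℝ} (he : Integrable (fun a => ‖Δ a‖ * Real.exp (lam ^ 2 * ‖Δ a‖ ^ 2 / 2)) m) :
    Integrable (fun z => ‖∫ a, cmDensity (lam • Δ a) z • Δ a ∂m‖ ^ 2)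
      (ProbabilityTheory.stdGaussian (Euc d)) ∧
    ∫ z, ‖∫ a, cmDensity (lam • Δ a) z • Δ a ∂m‖ ^ 2 ∂(ProbabilityTheory.stdGaussian (Euc d)) =
      ∫ w, (inner ℝ (Δ w.1) (Δ w.2) : ℝ) * Real.exp (lam ^ 2 * (inner ℝ (Δ w.1) (Δ w.2) : ℝ))
        ∂(m.prod m) := by
  set F : (α × α) → Euc d → ℝ := fun w z =>
    cmDensity (lam • Δ w.1) z * cmDensity (lam • Δ w.2) z * inner ℝ (Δ w.1) (Δ w.2) with hF
  have hFm : Measurable (Function.uncurry F) := by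
    unfold Function.uncurry; simp only [hF, cmDensity]; fun_prop
  have hz : ∀ w : α × α, ∫ z, cmDensity (lam • Δ w.1) z * cmDensity (lam • Δ w.2) z
      ∂(ProbabilityTheory.stdGaussian (Euc d)) =
      Real.exp (lam ^ 2 * (inner ℝ (Δ w.1) (Δ w.2) : ℝ)) := fun w => by
    rw [(integral_cmDensity_mul _ _).2, real_inner_smul_left, real_inner_smul_right]
    ring_nf
  have hFi : Integrable (Function.uncurry F)
      ((m.prod m).prod (ProbabilityTheory.stdGaussian (Euc d))) := by
    rw [integrable_prod_iff hFm.aestronglyMeasurable]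
    have hFz : ∀ w, Integrable (F w) (ProbabilityTheory.stdGaussian (Euc d)) := fun w =>
      (integral_cmDensity_mul (lam • Δ w.1) (lam • Δ w.2)).1.mul_const
        (inner ℝ (Δ w.1) (Δ w.2) : ℝ)
    refine ⟨Filter.Eventually.of_forall hFz, ?_⟩
    refine (integrable_norm_mul_exp_prod hΔ he).mono'
      hFm.norm.stronglyMeasurable.integral_prod_right'.aestronglyMeasurable
      (Filter.Eventually.of_forall fun w => ?_)
    simp only [Function.uncurry, hF, norm_mul, Real.norm_of_nonneg (cmDensity_nonneg _ _)]
    rw [integral_mul_const, hz, norm_mul, Real.norm_of_nonneg (Real.exp_nonneg _), norm_norm,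
      mul_comm, Real.norm_eq_abs]
    exact mul_le_mul_of_nonneg_left (Real.exp_le_exp.2
      (mul_le_mul_of_nonneg_left (le_abs_self _) (sq_nonneg _))) (abs_nonneg _)
  have hsq : ∀ z, ∫ w, F w z ∂(m.prod m) = ‖∫ a, cmDensity (lam • Δ a) z • Δ a ∂m‖ ^ 2 :=
      fun z => by
    have hg := integrable_cmDensity_smul hΔ hi lam z
    have hin : ∀ w : α × α, F w z = inner ℝ (cmDensity (lam • Δ w.1) z • Δ w.1)
        (cmDensity (lam • Δ w.2) z • Δ w.2) := fun w => by
      rw [real_inner_smul_left, real_inner_smul_right, ← mul_assoc]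
    simp_rw [hin]
    rw [integral_prod]
    · simp_rw [integral_inner hg]
      have hcomm : ∀ a, (inner ℝ (cmDensity (lam • Δ a) z • Δ a)
          (∫ a, cmDensity (lam • Δ a) z • Δ a ∂m) : ℝ) =
          inner ℝ (∫ a, cmDensity (lam • Δ a) z • Δ a ∂m) (cmDensity (lam • Δ a) z • Δ a) :=
        fun a => real_inner_comm _ _
      simp_rw [hcomm]
      rw [integral_inner hg, real_inner_self_eq_norm_sq]
    · refine (hg.norm.mul_prod hg.norm).mono' ?_
        (Filter.Eventually.of_forall fun w => abs_real_inner_le_norm _ _)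
      refine Measurable.aestronglyMeasurable ?_
      unfold cmDensity; fun_prop
  refine ⟨hFi.integral_prod_right.congr (Filter.Eventually.of_forall hsq), ?_⟩
  simp_rw [← hsq]
  rw [← integral_integral_swap hFi]
  refine integral_congr_ae (Filter.Eventually.of_forall fun w => ?_)
  simp only [hF]
  rw [integral_mul_const, hz, mul_comm]

theorem integral_inner_affine_integral_cmDensity_smul (hΔ : Measurable Δ)
    (hi : ∀ k : ℕ, Integrable (fun a => ‖Δ a‖ ^ k) m) (lam : ℝ) (b : Euc d) :
    ∫ z, (inner ℝ (b - lam • z) (∫ a, cmDensity (lam • Δ a) z • Δ a ∂m) : ℝ)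
      ∂(ProbabilityTheory.stdGaussian (Euc d)) =
      inner ℝ b (∫ a, Δ a ∂m) - lam ^ 2 * ∫ a, ‖Δ a‖ ^ 2 ∂m := by
  have hi1 : Integrable Δ m := by
    have h1 := hi 1
    simp only [pow_one] at h1
    exact (integrable_norm_iff hΔ.aestronglyMeasurable).1 h1
  have hid : Integrable (fun z : Euc d => z) (ProbabilityTheory.stdGaussian (Euc d)) :=
    (memLp_id_stdGaussian d 1 (by simp)).integrable le_rfl
  have haff : ∀ a : Euc d, Integrable (fun z => b - lam • (z + lam • a))
      (ProbabilityTheory.stdGaussian (Euc d)) := fun a =>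
    (integrable_const b).sub ((hid.add (integrable_const (lam • a))).smul lam)
  set H : α → Euc d → ℝ := fun a z =>
    inner ℝ (b - lam • z) (cmDensity (lam • Δ a) z • Δ a) with hH
  have hHm : Measurable (Function.uncurry H) := by
    unfold Function.uncurry; simp only [hH, cmDensity]; fun_prop
  have hHeq : ∀ a z, H a z = cmDensity (lam • Δ a) z • (inner ℝ (b - lam • z) (Δ a) : ℝ) :=
    fun a z => by simp only [hH, real_inner_smul_right, smul_eq_mul]
  have hHz : ∀ a, Integrable (H a) (ProbabilityTheory.stdGaussian (Euc d)) := fun a => by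
    rw [funext (hHeq a)]
    exact integrable_stdGaussian_add (lam • Δ a) (f := fun z => (inner ℝ (b - lam • z) (Δ a) : ℝ))
      ((haff (Δ a)).inner_const (Δ a))
  set C := ‖b‖ + |lam| * ∫ z : Euc d, ‖z‖ ∂(ProbabilityTheory.stdGaussian (Euc d)) with hC
  have hHi : Integrable (Function.uncurry H) (m.prod (ProbabilityTheory.stdGaussian (Euc d))) := by
    rw [integrable_prod_iff hHm.aestronglyMeasurable]
    refine ⟨Filter.Eventually.of_forall hHz, ?_⟩
    refine (((hi 1).const_mul C).add ((hi 2).const_mul (lam ^ 2))).mono'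
      hHm.norm.stronglyMeasurable.integral_prod_right'.aestronglyMeasurable
      (Filter.Eventually.of_forall fun a => ?_)
    rw [Real.norm_of_nonneg (integral_nonneg fun _ => norm_nonneg _)]
    have h1 : ∀ z, ‖H a z‖ = cmDensity (lam • Δ a) z • ‖(inner ℝ (b - lam • z) (Δ a) : ℝ)‖ :=
      fun z => by rw [hHeq, norm_smul, Real.norm_of_nonneg (cmDensity_nonneg _ _), smul_eq_mul]
    have h2 := integral_stdGaussian_add (lam • Δ a)
      fun z => ‖(inner ℝ (b - lam • z) (Δ a) : ℝ)‖
    have h3 : ∫ z, ‖H a z‖ ∂(ProbabilityTheory.stdGaussian (Euc d)) =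
        ∫ z, ‖(inner ℝ (b - lam • (z + lam • Δ a)) (Δ a) : ℝ)‖
          ∂(ProbabilityTheory.stdGaussian (Euc d)) := by
      simp_rw [h1]; exact h2.symm
    have hnorm : ∀ z : Euc d, ‖(inner ℝ (b - lam • (z + lam • Δ a)) (Δ a) : ℝ)‖ ≤
        (‖b‖ + lam ^ 2 * ‖Δ a‖) * ‖Δ a‖ + ‖z‖ * (|lam| * ‖Δ a‖) := fun z => by
      refine (norm_inner_le_norm _ _).trans ?_
      have h5 : ‖b - lam • (z + lam • Δ a)‖ ≤ ‖b‖ + |lam| * (‖z‖ + |lam| * ‖Δ a‖) := by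
        refine (norm_sub_le _ _).trans (add_le_add le_rfl ?_)
        rw [norm_smul, Real.norm_eq_abs]
        refine mul_le_mul_of_nonneg_left ((norm_add_le _ _).trans_eq ?_) (abs_nonneg _)
        rw [norm_smul, Real.norm_eq_abs]
      refine (mul_le_mul_of_nonneg_right h5 (norm_nonneg _)).trans_eq ?_
      rw [← sq_abs lam]; ring
    have hbi : Integrable (fun z : Euc d => ‖z‖ * (|lam| * ‖Δ a‖))
        (ProbabilityTheory.stdGaussian (Euc d)) := hid.norm.mul_const _
    have h4 := integral_mono ((haff (Δ a)).inner_const (Δ a)).norm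
      ((integrable_const ((‖b‖ + lam ^ 2 * ‖Δ a‖) * ‖Δ a‖)).add hbi) hnorm
    simp only [Pi.add_apply] at h4
    rw [integral_add (integrable_const _) hbi, integral_mul_const (|lam| * ‖Δ a‖), ← h3] at h4
    refine h4.trans_eq ?_
    simp only [hC, Pi.add_apply, integral_const, probReal_univ, one_smul]
    ring
  have hmean : ∀ a, ∫ z, H a z ∂(ProbabilityTheory.stdGaussian (Euc d)) =
      inner ℝ b (Δ a) - lam ^ 2 * ‖Δ a‖ ^ 2 := fun a => by
    have h2 := integral_stdGaussian_add (lam • Δ a) fun z => (inner ℝ (b - lam • z) (Δ a) : ℝ)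
    have h3 : ∫ z, H a z ∂(ProbabilityTheory.stdGaussian (Euc d)) =
        ∫ z, (inner ℝ (b - lam • (z + lam • Δ a)) (Δ a) : ℝ)
          ∂(ProbabilityTheory.stdGaussian (Euc d)) := by
      simp_rw [hHeq]; exact h2.symm
    have hlin : ∀ z : Euc d, (inner ℝ (b - lam • (z + lam • Δ a)) (Δ a) : ℝ) =
        (inner ℝ b (Δ a) - lam ^ 2 * ‖Δ a‖ ^ 2) - lam * inner ℝ (Δ a) z := fun z => by
      rw [inner_sub_left, real_inner_smul_left, inner_add_left, real_inner_smul_left,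
        real_inner_self_eq_norm_sq, real_inner_comm (Δ a) z]
      ring
    have hin : Integrable (fun z : Euc d => (inner ℝ (Δ a) z : ℝ))
        (ProbabilityTheory.stdGaussian (Euc d)) := hid.const_inner (Δ a)
    rw [h3]
    simp_rw [hlin]
    rw [integral_sub (integrable_const _) (hin.const_mul lam), integral_const_mul,
      integral_inner hid]
    simp
  have hin : ∀ z, (inner ℝ (b - lam • z) (∫ a, cmDensity (lam • Δ a) z • Δ a ∂m) : ℝ) =
      ∫ a, H a z ∂m := fun z => (integral_inner (integrable_cmDensity_smul hΔ hi1 lam z) _).symm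
  simp_rw [hin]
  rw [← integral_integral_swap hHi]
  simp_rw [hmean]
  rw [integral_sub (hi1.const_inner b) ((hi 2).const_mul _), integral_inner hi1, integral_const_mul]

theorem integral_norm_sq_steinField (hΔ : Measurable Δ)
    (hi : ∀ k : ℕ, Integrable (fun a => ‖Δ a‖ ^ k) m) {lam : ℝ}
    (he : Integrable (fun a => ‖Δ a‖ * Real.exp (lam ^ 2 * ‖Δ a‖ ^ 2 / 2)) m) {s : ℝ} (hs : s ≠ 0)
    (x : Euc d) :
    Integrable (fun z => ‖steinField s lam m Δ x z‖ ^ 2) (ProbabilityTheory.stdGaussian (Euc d)) ∧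
    ∫ z, ‖steinField s lam m Δ x z‖ ^ 2 ∂(ProbabilityTheory.stdGaussian (Euc d)) =
      ‖(1 / s) • ∫ a, Δ a ∂m + x‖ ^ 2 + lam ^ 2 * (d - (1 / s) * ∫ a, ‖Δ a‖ ^ 2 ∂m) +
        1 / (4 * s ^ 2) * (∫ w, (inner ℝ (Δ w.1) (Δ w.2) : ℝ) *
          Real.exp (lam ^ 2 * (inner ℝ (Δ w.1) (Δ w.2) : ℝ)) ∂(m.prod m) - ‖∫ a, Δ a ∂m‖ ^ 2) := by
  have hi1 : Integrable Δ m := by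
    have h1 := hi 1
    simp only [pow_one] at h1
    exact (integrable_norm_iff hΔ.aestronglyMeasurable).1 h1
  set m1 := ∫ a, Δ a ∂m with hm1
  set b := x + (1 / (2 * s)) • m1 with hb
  set G : Euc d → Euc d := fun z => ∫ a, cmDensity (lam • Δ a) z • Δ a ∂m with hG
  have hGm : Measurable G := measurable_integral_cmDensity_smul hΔ lam
  obtain ⟨hG2, hG_sq⟩ := integrable_sq_norm_integral_cmDensity_smul hΔ hi1 he
  have hBG := integral_inner_affine_integral_cmDensity_smul hΔ hi lam b
  have hid : Integrable (fun z : Euc d => z) (ProbabilityTheory.stdGaussian (Euc d)) :=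
    (memLp_id_stdGaussian d 1 (by simp)).integrable le_rfl
  have hid2 : Integrable (fun z : Euc d => ‖z‖ ^ 2) (ProbabilityTheory.stdGaussian (Euc d)) :=
    (memLp_id_stdGaussian d 2 (by simp)).integrable_norm_pow (by norm_num)
  have hin : Integrable (fun z : Euc d => (inner ℝ b z : ℝ))
      (ProbabilityTheory.stdGaussian (Euc d)) := hid.const_inner b
  have hBeq : ∀ z : Euc d, ‖b - lam • z‖ ^ 2 =
      ‖b‖ ^ 2 - (2 * lam) * inner ℝ b z + lam ^ 2 * ‖z‖ ^ 2 := fun z => by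
    rw [norm_sub_sq_real, real_inner_smul_right, norm_smul, mul_pow, Real.norm_eq_abs, sq_abs]
    ring
  have hB1 : Integrable (fun z : Euc d => ‖b‖ ^ 2 - (2 * lam) * (inner ℝ b z : ℝ))
      (ProbabilityTheory.stdGaussian (Euc d)) :=
    (integrable_const _).sub (hin.const_mul (2 * lam))
  have hB2 : Integrable (fun z : Euc d => ‖b - lam • z‖ ^ 2)
      (ProbabilityTheory.stdGaussian (Euc d)) := by
    simp_rw [hBeq]; exact hB1.add (hid2.const_mul (lam ^ 2))
  have hB_sq : ∫ z : Euc d, ‖b - lam • z‖ ^ 2 ∂(ProbabilityTheory.stdGaussian (Euc d)) =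
      ‖b‖ ^ 2 + lam ^ 2 * d := by
    simp_rw [hBeq]
    rw [integral_add hB1 (hid2.const_mul (lam ^ 2)), integral_sub (integrable_const _)
      (hin.const_mul (2 * lam)), integral_const_mul, integral_const_mul, integral_inner hid,
      integral_norm_sq_stdGaussian]
    simp
  have hBGi : Integrable (fun z => (inner ℝ (b - lam • z) (G z) : ℝ))
      (ProbabilityTheory.stdGaussian (Euc d)) := by
    refine (hB2.add hG2).mono' (by fun_prop) (Filter.Eventually.of_forall fun z => ?_)
    refine (abs_real_inner_le_norm _ _).trans ?_
    have : ‖b - lam • z‖ * ‖G z‖ ≤ ‖b - lam • z‖ ^ 2 + ‖G z‖ ^ 2 := by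
      nlinarith [sq_nonneg (‖b - lam • z‖ - ‖G z‖), sq_nonneg (‖b - lam • z‖), sq_nonneg ‖G z‖]
    exact this
  have hV : ∀ z, ‖steinField s lam m Δ x z‖ ^ 2 = ‖b - lam • z‖ ^ 2 +
      (1 / s) * inner ℝ (b - lam • z) (G z) + 1 / (4 * s ^ 2) * ‖G z‖ ^ 2 := fun z => by
    rw [steinField_eq hΔ hi1, norm_add_sq_real, real_inner_smul_right, norm_smul, mul_pow,
      Real.norm_eq_abs, sq_abs]
    field_simp
    ring
  simp_rw [hV]
  have h12 : Integrable (fun z => ‖b - lam • z‖ ^ 2 + (1 / s) * (inner ℝ (b - lam • z) (G z) : ℝ))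
      (ProbabilityTheory.stdGaussian (Euc d)) := hB2.add (hBGi.const_mul _)
  have h3 : Integrable (fun z => 1 / (4 * s ^ 2) * ‖G z‖ ^ 2)
      (ProbabilityTheory.stdGaussian (Euc d)) := hG2.const_mul _
  refine ⟨h12.add h3, ?_⟩
  rw [integral_add h12 h3, integral_add hB2 (hBGi.const_mul _), integral_const_mul,
    integral_const_mul, hB_sq, hBG, hG_sq, hb, norm_add_sq_real, norm_add_sq_real, inner_add_left,
    real_inner_smul_left, real_inner_smul_left, real_inner_smul_right, norm_smul, norm_smul,
    mul_pow, mul_pow, real_inner_self_eq_norm_sq, real_inner_comm m1 x]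
  simp only [Real.norm_eq_abs, sq_abs]
  field_simp
  ring

theorem lintegral_steinField_sq (hΔ : Measurable Δ)
    (hi : ∀ k : ℕ, Integrable (fun a => ‖Δ a‖ ^ k) m) {lam : ℝ}
    (he : Integrable (fun a => ‖Δ a‖ * Real.exp (lam ^ 2 * ‖Δ a‖ ^ 2 / 2)) m) {s : ℝ} (hs : s ≠ 0)
    (x : Euc d) :
    ∫⁻ z, ‖steinField s lam m Δ x z‖ₑ ^ (2 : ℝ) ∂(ProbabilityTheory.stdGaussian (Euc d)) =
      ENNReal.ofReal (∑ i, ((∫ a, Δ a i ∂m) / s + x i) ^ 2) +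
      ENNReal.ofReal (lam ^ 2 * ∑ β ∈ Finset.piAntidiag (Finset.univ : Finset (Fin d)) 2,
        ((2 : ℝ) / (mfact β : ℝ)) * ((∫ a, monoE β (Δ a) ∂m) / (2 * s) - idFam β) ^ 2) +
      ∑' k : ℕ, if 3 ≤ k then ENNReal.ofReal (lam ^ (2 * (k - 1)) / (4 * s ^ 2 * (k - 1).factorial) *
        ∑ β ∈ Finset.piAntidiag (Finset.univ : Finset (Fin d)) k,
          ((k.factorial : ℝ) / (mfact β : ℝ)) * (∫ a, monoE β (Δ a) ∂m) ^ 2) else 0 := by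
  have hi1 : Integrable Δ m := by
    have h1 := hi 1
    simp only [pow_one] at h1
    exact (integrable_norm_iff hΔ.aestronglyMeasurable).1 h1
  obtain ⟨hVi, hVeq⟩ := integral_norm_sq_steinField hΔ hi he hs x
  set I : ℕ → ℝ := fun k => ∑ β ∈ Finset.piAntidiag (Finset.univ : Finset (Fin d)) k,
    ((k.factorial : ℝ) / (mfact β : ℝ)) * (∫ a, monoE β (Δ a) ∂m) ^ 2 with hI
  set J := ∫ w, (inner ℝ (Δ w.1) (Δ w.2) : ℝ) *
    Real.exp (lam ^ 2 * (inner ℝ (Δ w.1) (Δ w.2) : ℝ)) ∂(m.prod m) with hJ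
  have hInn : ∀ k, 0 ≤ I k := fun k => Finset.sum_nonneg fun β _ => by positivity
  have hcoord : ∀ i, (∫ a, Δ a ∂m) i = ∫ a, Δ a i ∂m := fun i =>
    ((EuclideanSpace.proj (𝕜 := ℝ) i).integral_comp_comm hi1).symm
  have hIk : ∀ k, ∫ w, (inner ℝ (Δ w.1) (Δ w.2) : ℝ) ^ k ∂(m.prod m) = I k :=
    integral_inner_pow hΔ hi
  have hI1 : I 1 = ‖∫ a, Δ a ∂m‖ ^ 2 := by
    rw [← hIk 1]
    simp only [pow_one]
    have hp : Integrable (fun w : α × α => (inner ℝ (Δ w.1) (Δ w.2) : ℝ)) (m.prod m) :=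
      (hi1.norm.mul_prod hi1.norm).mono' (by fun_prop)
        (Filter.Eventually.of_forall fun w => abs_real_inner_le_norm _ _)
    rw [integral_prod _ hp]
    simp_rw [integral_inner hi1]
    have hcomm : ∀ a, (inner ℝ (Δ a) (∫ a, Δ a ∂m) : ℝ) = inner ℝ (∫ a, Δ a ∂m) (Δ a) :=
      fun a => real_inner_comm _ _
    simp_rw [hcomm]
    rw [integral_inner hi1, real_inner_self_eq_norm_sq]
  have hsum := hasSum_integral_inner_mul_exp (m := m) hΔ he
  simp_rw [hIk] at hsum
  set g : ℕ → ℝ := fun k =>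
    if 3 ≤ k then lam ^ (2 * (k - 1)) / (4 * s ^ 2 * (k - 1).factorial) * I k
    else 0 with hg
  have hgsum : HasSum g (1 / (4 * s ^ 2) * (J - I 1 - lam ^ 2 * I 2)) := by
    have h2 := ((hasSum_nat_add_iff' 2).2 hsum).mul_left (1 / (4 * s ^ 2))
    have h3 := (hasSum_nat_add_iff 3 (f := g) (g := 1 / (4 * s ^ 2) * (J - I 1 - lam ^ 2 * I 2))).1
    simp only [Finset.sum_range_succ, Finset.sum_range_zero] at h2 h3
    have h0 : g 0 = 0 ∧ g 1 = 0 ∧ g 2 = 0 := by simp [hg]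
    rw [h0.1, h0.2.1, h0.2.2] at h3
    simp only [add_zero] at h3
    refine h3 ?_
    have hterm : ∀ n : ℕ, g (n + 3) = 1 / (4 * s ^ 2) *
        (lam ^ (2 * (n + 2)) / ((n + 2).factorial : ℝ) * I (n + 2 + 1)) := fun n => by
      simp only [hg, if_pos (show 3 ≤ n + 3 by omega), show n + 3 - 1 = n + 2 by omega,
        show n + 2 + 1 = n + 3 by omega]
      field_simp
    have hval : 1 / (4 * s ^ 2) * (J - I 1 - lam ^ 2 * I 2) = 1 / (4 * s ^ 2) *
        (J - (0 + lam ^ (2 * 0) / (Nat.factorial 0 : ℝ) * I (0 + 1) +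
          lam ^ (2 * 1) / (Nat.factorial 1 : ℝ) * I (1 + 1))) := by
      simp only [Nat.factorial, zero_add, one_add_one_eq_two]
      push_cast
      ring
    rw [funext hterm, hval]
    exact h2
  have hgnn : ∀ k, 0 ≤ g k := fun k => by
    simp only [hg]
    split_ifs
    · exact mul_nonneg (div_nonneg (by rw [pow_mul]; positivity) (by positivity)) (hInn k)
    · exact le_rfl
  have hts : (∑' k : ℕ, if 3 ≤ k then ENNReal.ofReal (lam ^ (2 * (k - 1)) /
      (4 * s ^ 2 * (k - 1).factorial) * I k) else 0) =
      ENNReal.ofReal (1 / (4 * s ^ 2) * (J - I 1 - lam ^ 2 * I 2)) := by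
    rw [← hgsum.tsum_eq, ENNReal.ofReal_tsum_of_nonneg hgnn hgsum.summable]
    refine tsum_congr fun k => ?_
    simp only [hg]
    split_ifs <;> simp
  have hquad : ∑ β ∈ Finset.piAntidiag (Finset.univ : Finset (Fin d)) 2,
        ((2 : ℝ) / (mfact β : ℝ)) * ((∫ a, monoE β (Δ a) ∂m) / (2 * s) - idFam β) ^ 2 =
      d - (1 / s) * ∫ a, ‖Δ a‖ ^ 2 ∂m + 1 / (4 * s ^ 2) * I 2 := by
    have h1 := sum_inner_single_sq (d := d) idFam
    have h2 := sum_inner_single_sq (d := d) fun β => ∫ a, monoE β (Δ a) ∂m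
    have hd : ∑ i : Fin d, idFam (Pi.single i 2 : Fin d → ℕ) = d := by
      simp [idFam, show ∀ i j : Fin d, (Pi.single i 2 : Fin d → ℕ) = Pi.single j 2 ↔ i = j from
        fun i j => ⟨fun h => by
          by_contra hij
          have := congrFun h i
          simp [hij] at this, fun h => h ▸ rfl⟩]
    have hn : ∑ i : Fin d, ∫ a, monoE (Pi.single i 2) (Δ a) ∂m = ∫ a, ‖Δ a‖ ^ 2 ∂m := by
      rw [← integral_finsetSum _ fun i _ => integrable_monoE_comp hΔ hi _]
      simp_rw [monoE_single_two, EuclideanSpace.real_norm_sq_eq]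
    rw [hd] at h1
    rw [hn] at h2
    rw [← h1, ← h2, hI, Finset.mul_sum, Finset.mul_sum, ← Finset.sum_sub_distrib,
      ← Finset.sum_add_distrib]
    refine Finset.sum_congr rfl fun β _ => ?_
    simp only [Nat.factorial]
    push_cast
    field_simp
    ring
  have hnorm : ‖(1 / s) • ∫ a, Δ a ∂m + x‖ ^ 2 = ∑ i, ((∫ a, Δ a i ∂m) / s + x i) ^ 2 := by
    rw [EuclideanSpace.real_norm_sq_eq]
    refine Finset.sum_congr rfl fun i _ => ?_
    simp only [PiLp.add_apply, PiLp.smul_apply, smul_eq_mul, hcoord]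
    ring
  have hlhs : ∫⁻ z, ‖steinField s lam m Δ x z‖ₑ ^ (2 : ℝ)
      ∂(ProbabilityTheory.stdGaussian (Euc d)) =
      ENNReal.ofReal (∫ z, ‖steinField s lam m Δ x z‖ ^ 2
        ∂(ProbabilityTheory.stdGaussian (Euc d))) := by
    rw [ofReal_integral_eq_lintegral_ofReal hVi (Filter.Eventually.of_forall fun z => sq_nonneg _)]
    refine lintegral_congr fun z => ?_
    rw [ENNReal.ofReal_pow (norm_nonneg _), ofReal_norm, ENNReal.rpow_ofNat]
  have hB : 0 ≤ lam ^ 2 * ∑ β ∈ Finset.piAntidiag (Finset.univ : Finset (Fin d)) 2,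
        ((2 : ℝ) / (mfact β : ℝ)) * ((∫ a, monoE β (Δ a) ∂m) / (2 * s) - idFam β) ^ 2 :=
    mul_nonneg (sq_nonneg _) (Finset.sum_nonneg fun β _ => by positivity)
  have hA : 0 ≤ ∑ i, ((∫ a, Δ a i ∂m) / s + x i) ^ 2 := Finset.sum_nonneg fun i _ => sq_nonneg _
  rw [hlhs, hts, ← ENNReal.ofReal_add hA hB, ← ENNReal.ofReal_add (add_nonneg hA hB)
    (hgsum.nonneg hgnn), hVeq, ← hI1, hnorm, hquad]
  congr 1
  ring

end SecondMoment

section Kernel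

variable {d : ℕ} {ν : Measure (Euc d)} [IsProbabilityMeasure ν] {k : Kernel (Euc d) (Euc d)}
  [IsMarkovKernel k]

theorem measurable_lintegral_steinField_kernel (s lam : ℝ) :
    Measurable fun x => ∫⁻ z, ‖steinField s lam (k x) (fun x' => x' - x) x z‖ₑ ^ (2 : ℝ)
      ∂(ProbabilityTheory.stdGaussian (Euc d)) :=
  Measurable.lintegral_prod_right'
    (f := fun q : Euc d × Euc d =>
      ‖steinField s lam (k q.1) (fun x' => x' - q.1) q.1 q.2‖ₑ ^ (2 : ℝ))
    ((measurable_steinField_kernel s lam).enorm.pow_const _)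

theorem eLpNorm_steinField_kernel_le
    (hint : Integrable (fun w : Euc d × Euc d => w.2 - w.1) (ν ⊗ₘ k))
    {p : ℝ} (hp : 1 ≤ p) (s eta : ℝ) :
    eLpNorm (fun q : Euc d × Euc d => steinField s eta (k q.1) (fun x' => x' - q.1) q.1 q.2)
      (ENNReal.ofReal p) (ν.prod (ProbabilityTheory.stdGaussian (Euc d))) ≤
    (∫⁻ x, (∫⁻ z, ‖steinField s (√(max 1 (p - 1)) * eta) (k x) (fun x' => x' - x) x z‖ₑ ^ (2 : ℝ)
      ∂(ProbabilityTheory.stdGaussian (Euc d))) ^ (p / 2) ∂ν) ^ (1 / p) := by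
  have hp0 : 0 < p := by linarith
  have hm := measurable_steinField_kernel (k := k) s eta
  have h : eLpNorm (fun q : Euc d × Euc d => steinField s eta (k q.1) (fun x' => x' - q.1) q.1 q.2)
      (ENNReal.ofReal p) (ν.prod (ProbabilityTheory.stdGaussian (Euc d))) =
      (∫⁻ x, ∫⁻ z, ‖steinField s eta (k x) (fun x' => x' - x) x z‖ₑ ^ p
        ∂(ProbabilityTheory.stdGaussian (Euc d)) ∂ν) ^ (1 / p) := by
    rw [← lintegral_prod _ (hm.enorm.pow_const p).aemeasurable, ← eLpNorm_ofReal_rpow hp0,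
      ← ENNReal.rpow_mul, mul_one_div_cancel hp0.ne', ENNReal.rpow_one]
  rw [h]
  refine ENNReal.rpow_le_rpow (lintegral_mono_ae ?_) (by positivity)
  filter_upwards [((Measure.integrable_compProd_iff hint.aestronglyMeasurable).1 hint).1] with x hx
  exact lintegral_steinField_rpow_le (measurable_id.sub_const x) hx s eta hp x

end Kernel

theorem integrable_norm_pow_of_integrable_mul_exp {α E : Type*} [MeasurableSpace α]
    [NormedAddCommGroup E] {m : Measure α} [IsProbabilityMeasure m] {Δ : α → E}
    (hΔ : AEStronglyMeasurable Δ m) {lam : ℝ} (hlam : lam ≠ 0)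
    (he : Integrable (fun a => ‖Δ a‖ * Real.exp (lam ^ 2 * ‖Δ a‖ ^ 2 / 2)) m) (n : ℕ) :
    Integrable (fun a => ‖Δ a‖ ^ n) m := by
  rcases n with - | n
  · simp
  refine (he.const_mul (1 + (2 / lam ^ 2) ^ n * n.factorial)).mono' (hΔ.norm.pow _)
    (Filter.Eventually.of_forall fun a => ?_)
  set u := ‖Δ a‖
  have hu : 0 ≤ u := norm_nonneg _
  have hl : 0 < lam ^ 2 := by positivity
  have h1 : u ^ n ≤ 1 + (u ^ n) ^ 2 := by nlinarith [sq_nonneg (u ^ n - 1), sq_nonneg (u ^ n)]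
  have h2 := Real.pow_div_factorial_le_exp (lam ^ 2 * u ^ 2 / 2) (by positivity) n
  have h3 : (1 : ℝ) ≤ Real.exp (lam ^ 2 * u ^ 2 / 2) := Real.one_le_exp (by positivity)
  have h4 : (u ^ n) ^ 2 = (2 / lam ^ 2) ^ n * n.factorial *
      ((lam ^ 2 * u ^ 2 / 2) ^ n / n.factorial) := by
    have hf : (n.factorial : ℝ) ≠ 0 := by exact_mod_cast n.factorial_ne_zero
    rw [mul_assoc, mul_div_cancel₀ _ hf, ← mul_pow, ← pow_mul, mul_comm n 2, pow_mul]
    congr 1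
    field_simp
  rw [Real.norm_of_nonneg (by positivity), pow_succ, mul_comm _ u, mul_left_comm]
  refine mul_le_mul_of_nonneg_left (h1.trans ?_) hu
  rw [add_mul, one_mul, h4]
  exact add_le_add h3 (mul_le_mul_of_nonneg_left h2 (by positivity))

theorem integrable_mul_exp_of_lintegral_rpow_le {α E : Type*} [MeasurableSpace α]
    [NormedAddCommGroup E] {m : Measure α} [IsProbabilityMeasure m] {Δ : α → E}
    (hΔ : AEStronglyMeasurable Δ m) {q L D M : ℝ} (hq : 1 ≤ q)
    (h : ∫⁻ a, ENNReal.ofReal (‖Δ a‖ ^ q * Real.exp (q * L * ‖Δ a‖ ^ 2 / (2 * D))) ∂m ≤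
      ENNReal.ofReal M) :
    Integrable (fun a => ‖Δ a‖ * Real.exp (L / D * ‖Δ a‖ ^ 2 / 2)) m := by
  have hm : AEStronglyMeasurable (fun a => ‖Δ a‖ * Real.exp (L / D * ‖Δ a‖ ^ 2 / 2)) m :=
    hΔ.norm.mul (Real.continuous_exp.comp_aestronglyMeasurable
      (((hΔ.norm.pow 2).const_mul (L / D)).mul_const 2⁻¹))
  have hmem : MemLp (fun a => ‖Δ a‖ * Real.exp (L / D * ‖Δ a‖ ^ 2 / 2)) (ENNReal.ofReal q) m := by
    refine ⟨hm, ?_⟩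
    have hpow := eLpNorm_ofReal_rpow (by linarith : 0 < q)
      (fun a => ‖Δ a‖ * Real.exp (L / D * ‖Δ a‖ ^ 2 / 2)) (μ := m)
    have heq : ∀ a, ‖‖Δ a‖ * Real.exp (L / D * ‖Δ a‖ ^ 2 / 2)‖ₑ ^ q =
        ENNReal.ofReal (‖Δ a‖ ^ q * Real.exp (q * L * ‖Δ a‖ ^ 2 / (2 * D))) := fun a => by
      rw [Real.enorm_of_nonneg (by positivity), ENNReal.ofReal_rpow_of_nonneg (by positivity)
        (by linarith), Real.mul_rpow (norm_nonneg _) (Real.exp_nonneg _), ← Real.exp_mul]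
      congr 3
      rw [mul_comm (2 : ℝ) D, ← div_div]
      ring
    simp_rw [heq] at hpow
    by_contra hinf
    rw [not_lt_top_iff.1 hinf, ENNReal.top_rpow_of_pos (by linarith)] at hpow
    exact absurd (hpow ▸ h) (by simp)
  exact hmem.integrable (by simpa using hq)

/-- The conditional Stein discrepancy of the pair `(Y, Z)` given `Y`, with time step `s`, comparison
constant `L` and variance parameter `D`. -/
def condSteinSum {d : ℕ} {Ω : Type*} [MeasurableSpace Ω] (P : Measure Ω) (Y Z : Ω → Euc d)
    (s L D : ℝ) (ω : Ω) : ℝ≥0∞ :=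
  ENNReal.ofReal (∑ i, ((P[fun ω' => (Z ω' i - Y ω' i) / s + Y ω' i |
      MeasurableSpace.comap Y inferInstance]) ω) ^ 2)
  + ENNReal.ofReal (L / D *
      ∑' α : Fin d → ℕ, if mdeg α = 2 then
        ((2 : ℝ) / (mfact α : ℝ)) *
          ((P[fun ω' => monoE α (Z ω' - Y ω') / (2 * s) - idFam α |
            MeasurableSpace.comap Y inferInstance]) ω) ^ 2
      else 0)
  + ∑' k : ℕ, if 3 ≤ k then
      ENNReal.ofReal (L ^ (k - 1) / (4 * s ^ 2 * (k - 1).factorial * D ^ (k - 1)) *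
        ∑' α : Fin d → ℕ, if mdeg α = k then
          ((k.factorial : ℝ) / (mfact α : ℝ)) *
            ((P[fun ω' => monoE α (Z ω' - Y ω') |
              MeasurableSpace.comap Y inferInstance]) ω) ^ 2
        else 0)
    else 0

section CondDistrib

variable {d : ℕ} {Ω : Type*} [MeasurableSpace Ω] {P : Measure Ω} [IsProbabilityMeasure P]
  {Y Z : Ω → Euc d}

theorem ae_integrable_condDistrib (hY : Measurable Y) (hZ : Measurable Z) {F : Type*}
    [NormedAddCommGroup F] {f : Euc d → F} (hf : StronglyMeasurable f)
    (hi : Integrable (fun ω => f (Z ω - Y ω)) P) :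
    ∀ᵐ ω ∂P, Integrable (fun x' => f (x' - Y ω)) (condDistrib Z Y P (Y ω)) := by
  have hmeas : StronglyMeasurable fun w : Euc d × Euc d => f (w.2 - w.1) :=
    hf.comp_measurable (measurable_snd.sub measurable_fst)
  have h : Integrable (fun w : Euc d × Euc d => f (w.2 - w.1)) (P.map Y ⊗ₘ condDistrib Z Y P) := by
    rw [compProd_map_condDistrib hZ.aemeasurable]
    exact (integrable_map_measure hmeas.aestronglyMeasurable
      (hY.prodMk hZ).aemeasurable).2 hi
  exact ae_of_ae_map hY.aemeasurable
    ((Measure.integrable_compProd_iff h.aestronglyMeasurable).1 h).1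

theorem lintegral_steinField_sq_condDistrib_ae (hY : Measurable Y) (hZ : Measurable Z)
    (hYi : Integrable Y P) {s L D lam : ℝ} (hs : s ≠ 0) (hlam : lam ≠ 0) (hLD : lam ^ 2 = L / D)
    (he : Integrable (fun ω => ‖Z ω - Y ω‖ * Real.exp (L / D * ‖Z ω - Y ω‖ ^ 2 / 2)) P) :
    ∀ᵐ ω ∂P, ∫⁻ z, ‖steinField s lam (condDistrib Z Y P (Y ω)) (fun x' => x' - Y ω) (Y ω) z‖ₑ ^
      (2 : ℝ) ∂(ProbabilityTheory.stdGaussian (Euc d)) = condSteinSum P Y Z s L D ω := by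
  have hΔ : Measurable fun ω => Z ω - Y ω := hZ.sub hY
  rw [← hLD] at he
  have hpow := integrable_norm_pow_of_integrable_mul_exp hΔ.aestronglyMeasurable hlam he
  have hΔi : Integrable (fun ω => Z ω - Y ω) P := by
    rw [← integrable_norm_iff hΔ.aestronglyMeasurable]; simpa using hpow 1
  have hΔci : ∀ i, Integrable (fun ω => Z ω i - Y ω i) P := fun i =>
    (EuclideanSpace.proj (𝕜 := ℝ) i).integrable_comp hΔi
  have hYci : ∀ i, Integrable (fun ω => Y ω i) P := fun i =>
    (EuclideanSpace.proj (𝕜 := ℝ) i).integrable_comp hYi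
  have hmono := integrable_monoE_comp hΔ hpow
  have hexp := ae_integrable_condDistrib hY hZ
    (f := fun v => ‖v‖ * Real.exp (lam ^ 2 * ‖v‖ ^ 2 / 2)) (by fun_prop) he
  have h1 : ∀ᵐ ω ∂P, ∀ i, P[fun ω' => (Z ω' i - Y ω' i) / s + Y ω' i |
      MeasurableSpace.comap Y inferInstance] ω =
      ∫ x', ((x' i - Y ω i) / s + Y ω i) ∂(condDistrib Z Y P (Y ω)) :=
    ae_all_iff.2 fun i => condExp_prod_ae_eq_integral_condDistrib hY hZ.aemeasurable
      (f := fun w : Euc d × Euc d => (w.2 i - w.1 i) / s + w.1 i) (by fun_prop)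
      (((hΔci i).div_const s).add (hYci i))
  have h2 : ∀ᵐ ω ∂P, ∀ α : Fin d → ℕ, P[fun ω' => monoE α (Z ω' - Y ω') / (2 * s) - idFam α |
      MeasurableSpace.comap Y inferInstance] ω =
      ∫ x', (monoE α (x' - Y ω) / (2 * s) - idFam α) ∂(condDistrib Z Y P (Y ω)) :=
    ae_all_iff.2 fun α => condExp_prod_ae_eq_integral_condDistrib hY hZ.aemeasurable
      (f := fun w : Euc d × Euc d => monoE α (w.2 - w.1) / (2 * s) - idFam α)
      ((((measurable_monoE α).comp (measurable_snd.sub measurable_fst)).div_const _).sub_const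
        _).stronglyMeasurable
      (((hmono α).div_const _).sub (integrable_const _))
  have h3 : ∀ᵐ ω ∂P, ∀ α : Fin d → ℕ, P[fun ω' => monoE α (Z ω' - Y ω') |
      MeasurableSpace.comap Y inferInstance] ω =
      ∫ x', monoE α (x' - Y ω) ∂(condDistrib Z Y P (Y ω)) :=
    ae_all_iff.2 fun α => condExp_prod_ae_eq_integral_condDistrib hY hZ.aemeasurable
      (f := fun w : Euc d × Euc d => monoE α (w.2 - w.1))
      ((measurable_monoE α).comp (measurable_snd.sub measurable_fst)).stronglyMeasurable (hmono α)
  filter_upwards [hexp, h1, h2, h3] with ω hexp h1 h2 h3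
  have hsub : Measurable fun x' : Euc d => x' - Y ω := measurable_id.sub_const _
  have hpow' := integrable_norm_pow_of_integrable_mul_exp hsub.aestronglyMeasurable hlam hexp
  have hi : Integrable (fun x' => x' - Y ω) (condDistrib Z Y P (Y ω)) := by
    rw [← integrable_norm_iff hsub.aestronglyMeasurable]; simpa using hpow' 1
  rw [lintegral_steinField_sq hsub hpow' hexp hs, condSteinSum]
  have e1 : ∀ i, (∫ x', (x' - Y ω) i ∂(condDistrib Z Y P (Y ω))) / s + Y ω i =
      P[fun ω' => (Z ω' i - Y ω' i) / s + Y ω' i | MeasurableSpace.comap Y inferInstance] ω :=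
    fun i => by
    have hii : Integrable (fun x' => (x' i - Y ω i) / s) (condDistrib Z Y P (Y ω)) :=
      ((EuclideanSpace.proj (𝕜 := ℝ) i).integrable_comp hi).div_const s
    rw [h1, integral_add hii (integrable_const _), integral_div]
    simp
  have e2 : ∀ α : Fin d → ℕ, (∫ x', monoE α (x' - Y ω) ∂(condDistrib Z Y P (Y ω))) / (2 * s) -
      idFam α = P[fun ω' => monoE α (Z ω' - Y ω') / (2 * s) - idFam α |
        MeasurableSpace.comap Y inferInstance] ω := fun α => by
    rw [h2, integral_sub ((integrable_monoE_comp hsub hpow' α).div_const _) (integrable_const _),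
      integral_div]
    simp
  simp_rw [e1, e2, ← h3, tsum_ite_mdeg_eq_sum, pow_mul, hLD, div_pow]
  congr 1
  refine tsum_congr fun k => ?_
  congr 3
  rw [div_div, mul_comm (D ^ (k - 1))]

theorem rotDriftNorm_le_condSteinSum {ν : Measure (Euc d)} [IsProbabilityMeasure ν]
    (hν : P.map Y = ν) (hY : Measurable Y) (hZ : Measurable Z)
    (hYi : Integrable Y P) (hswap : P.map (fun ω => (Y ω, Z ω)) = P.map (fun ω => (Z ω, Y ω)))
    {p : ℝ} (hp : 1 ≤ p) {s D θ : ℝ} (hs : s ≠ 0) (hsin : sin θ ≠ 0) (hcos : cos θ ≠ 0)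
    (hD : (cos θ / sin θ) ^ 2 = 1 / D)
    (he : Integrable
      (fun ω => ‖Z ω - Y ω‖ * Real.exp (max 1 (p - 1) / D * ‖Z ω - Y ω‖ ^ 2 / 2)) P) :
    rotDriftNorm ν p θ ≤ ‖sin θ‖ₑ *
      (∫⁻ ω, condSteinSum P Y Z s (max 1 (p - 1)) D ω ^ (p / 2) ∂P) ^ (1 / p) := by
  subst hν
  have hmax : 0 < max 1 (p - 1) := lt_max_of_lt_left one_pos
  set lam := √(max 1 (p - 1)) * (cos θ / sin θ) with hlam_def
  have hlam : lam ≠ 0 := mul_ne_zero (Real.sqrt_ne_zero'.2 hmax) (div_ne_zero hcos hsin)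
  have hLD : lam ^ 2 = max 1 (p - 1) / D := by
    rw [hlam_def, mul_pow, Real.sq_sqrt hmax.le, hD, mul_one_div]
  have hsw : (P.map Y ⊗ₘ condDistrib Z Y P).map Prod.swap = P.map Y ⊗ₘ condDistrib Z Y P := by
    rw [compProd_map_condDistrib hZ.aemeasurable, Measure.map_map measurable_swap (hY.prodMk hZ),
      hswap]
    rfl
  have hΔ : Measurable fun ω => Z ω - Y ω := hZ.sub hY
  have hΔi : Integrable (fun ω => Z ω - Y ω) P := by
    rw [← integrable_norm_iff hΔ.aestronglyMeasurable]
    simpa using integrable_norm_pow_of_integrable_mul_exp hΔ.aestronglyMeasurable hlam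
      (hLD ▸ he) 1
  have hmeas : Measurable fun w : Euc d × Euc d => w.2 - w.1 := measurable_snd.sub measurable_fst
  have hint : Integrable (fun w : Euc d × Euc d => w.2 - w.1) (P.map Y ⊗ₘ condDistrib Z Y P) := by
    rw [compProd_map_condDistrib hZ.aemeasurable]
    exact (integrable_map_measure hmeas.aestronglyMeasurable (hY.prodMk hZ).aemeasurable).2 hΔi
  have hνi : Integrable (fun x => x) (P.map Y) :=
    (integrable_map_measure measurable_id.aestronglyMeasurable hY.aemeasurable).2 hYi
  refine (rotDriftNorm_le_eLpNorm_steinField hsw hνi hint hp s hsin).trans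
    (mul_le_mul_right ((eLpNorm_steinField_kernel_le hint hp s _).trans_eq ?_) _)
  rw [lintegral_map ((measurable_lintegral_steinField_kernel s lam).pow_const _) hY]
  congr 1
  refine lintegral_congr_ae ?_
  filter_upwards [lintegral_steinField_sq_condDistrib_ae hY hZ hYi hs hlam hLD he] with ω hω
  rw [hω]

end CondDistrib

theorem lintegral_Ioc_zero_pi_div_two_eq (f : ℝ → ℝ≥0∞) :
    ∫⁻ θ in Set.Ioc 0 (Real.pi / 2), f θ = ∫⁻ t in Set.Ioi (0 : ℝ),
      ENNReal.ofReal (Real.exp (-t) / √(1 - Real.exp (-t) ^ 2)) * f (arccos (Real.exp (-t))) := by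
  have hlt : ∀ t ∈ Set.Ioi (0 : ℝ), Real.exp (-t) < 1 := fun t ht =>
    Real.exp_lt_one_iff.2 (neg_lt_zero.2 ht)
  have himage : (fun t => arccos (Real.exp (-t))) '' Set.Ioi 0 = Set.Ioo 0 (Real.pi / 2) := by
    ext θ
    constructor
    · rintro ⟨t, ht, rfl⟩
      exact ⟨Real.arccos_pos.2 (hlt t ht), Real.arccos_lt_pi_div_two.2 (Real.exp_pos _)⟩
    · rintro ⟨h0, h1⟩
      have hc : 0 < cos θ := Real.cos_pos_of_mem_Ioo ⟨by linarith, h1⟩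
      have hc1 : cos θ < 1 := by
        simpa using Real.cos_lt_cos_of_nonneg_of_le_pi le_rfl (by linarith) h0
      refine ⟨-Real.log (cos θ), ?_, ?_⟩
      · exact neg_pos.2 (Real.log_neg hc hc1)
      · simp only [neg_neg, Real.exp_log hc]
        exact Real.arccos_cos h0.le (by linarith)
  have hderiv : ∀ t ∈ Set.Ioi (0 : ℝ), HasDerivWithinAt (fun t => arccos (Real.exp (-t)))
      (Real.exp (-t) / √(1 - Real.exp (-t) ^ 2)) (Set.Ioi 0) t := fun t ht => by
    have h := (Real.hasDerivAt_arccos (x := Real.exp (-t)) (by linarith [Real.exp_pos (-t)])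
      (hlt t ht).ne).comp t (hasDerivAt_neg t).exp
    refine (h.congr_deriv ?_).hasDerivWithinAt
    ring
  have hinj : Set.InjOn (fun t => arccos (Real.exp (-t))) (Set.Ioi 0) := fun a ha b hb hab => by
    have h := Real.arccos_injOn ⟨by linarith [Real.exp_pos (-a)], (hlt a ha).le⟩
      ⟨by linarith [Real.exp_pos (-b)], (hlt b hb).le⟩ hab
    exact neg_injective (Real.exp_injective h)
  rw [← setLIntegral_congr Ioo_ae_eq_Ioc, ← himage,
    lintegral_image_eq_lintegral_abs_deriv_mul measurableSet_Ioi hderiv hinj]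
  refine setLIntegral_congr_fun measurableSet_Ioi fun t _ => ?_
  rw [abs_of_nonneg (by positivity)]

theorem integrable_mul_exp_of_forall_Icc {d : ℕ} {Ω : Type*} [MeasurableSpace Ω] {P : Measure Ω}
    [IsProbabilityMeasure P] {p : ℝ} (hp : 1 ≤ p) {X : ℝ → Ω → Euc d}
    (hX : ∀ t, 0 ≤ t → Measurable (X t))
    (hcond : ∀ ε : ℝ, 0 < ε → ∃ ξ : ℝ, 0 < ξ ∧ ∃ M : ℝ, 0 < M ∧ ∀ t ∈ Set.Icc ε ε⁻¹,
      (∫⁻ ω, ENNReal.ofReal (‖X t ω - X 0 ω‖ ^ (p * (1 + ξ)) *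
          Real.exp (p * (1 + ξ) * max 1 (p - 1) * ‖X t ω - X 0 ω‖ ^ 2 /
            (2 * (Real.exp (2 * t) - 1)))) ∂P) ≤ ENNReal.ofReal M) {t : ℝ} (ht : 0 < t) :
    Integrable (fun ω => ‖X t ω - X 0 ω‖ *
      Real.exp (max 1 (p - 1) / (Real.exp (2 * t) - 1) * ‖X t ω - X 0 ω‖ ^ 2 / 2)) P := by
  obtain ⟨ξ, hξ, M, -, h⟩ := hcond (min t t⁻¹) (lt_min ht (inv_pos.2 ht))
  refine integrable_mul_exp_of_lintegral_rpow_le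
    ((hX t ht.le).sub (hX 0 le_rfl)).aestronglyMeasurable (q := p * (1 + ξ)) (by nlinarith)
    (h t ⟨min_le_left _ _, ?_⟩)
  exact le_inv_of_le_inv₀ (lt_min ht (inv_pos.2 ht)) (min_le_right _ _)

theorem stein_Wp_exchangeable
    {d : ℕ} {Ω : Type*} [MeasurableSpace Ω] (P : Measure Ω) [IsProbabilityMeasure P]
    (p : ℝ) (hp : 1 ≤ p)
    (ν : Measure (Euc d)) [IsProbabilityMeasure ν]
    (hmom : Integrable (fun x => ‖x‖ ^ p) ν)
    (X : ℝ → Ω → Euc d)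
    (hXmeas : ∀ t, 0 ≤ t → Measurable (X t))
    (hX0law : P.map (X 0) = ν)
    (hexch : ∀ t : ℝ, 0 < t →
      P.map (fun ω => (X 0 ω, X t ω)) = P.map (fun ω => (X t ω, X 0 ω)))
    (hcond : ∀ ε : ℝ, 0 < ε → ∃ ξ : ℝ, 0 < ξ ∧ ∃ M : ℝ, 0 < M ∧ ∀ t ∈ Set.Icc ε ε⁻¹,
      (∫⁻ ω, ENNReal.ofReal (‖X t ω - X 0 ω‖ ^ (p * (1 + ξ)) *
          Real.exp (p * (1 + ξ) * max 1 (p - 1) * ‖X t ω - X 0 ω‖ ^ 2 /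
            (2 * (Real.exp (2 * t) - 1)))) ∂P) ≤ ENNReal.ofReal M)
    (s : ℝ) (hs : 0 < s) :
    wassersteinDist p ν (stdGaussian d) ≤
      ∫⁻ t in Set.Ioi (0 : ℝ),
        ENNReal.ofReal (Real.exp (-t)) *
          (∫⁻ ω,
            (ENNReal.ofReal (∑ i, ((P[fun ω' => (X t ω' i - X 0 ω' i) / s + X 0 ω' i |
                MeasurableSpace.comap (X 0) inferInstance]) ω) ^ 2)
            + ENNReal.ofReal (max 1 (p - 1) / (Real.exp (2 * t) - 1) *
                ∑' α : Fin d → ℕ, if mdeg α = 2 then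
                  ((2 : ℝ) / (mfact α : ℝ)) *
                    ((P[fun ω' => monoE α (X t ω' - X 0 ω') / (2 * s) - idFam α |
                      MeasurableSpace.comap (X 0) inferInstance]) ω) ^ 2
                else 0)
            + ∑' k : ℕ, if 3 ≤ k then
                ENNReal.ofReal ((max 1 (p - 1)) ^ (k - 1) /
                    (4 * s ^ 2 * (k - 1).factorial * (Real.exp (2 * t) - 1) ^ (k - 1)) *
                  ∑' α : Fin d → ℕ, if mdeg α = k then
                    ((k.factorial : ℝ) / (mfact α : ℝ)) *
                      ((P[fun ω' => monoE α (X t ω' - X 0 ω') |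
                        MeasurableSpace.comap (X 0) inferInstance]) ω) ^ 2
                  else 0)
              else 0) ^ (p / 2) ∂P) ^ (1 / p) := by
  subst hX0law
  have hp0 : 0 < p := by linarith
  have hmem : MemLp (fun x : Euc d => x) (ENNReal.ofReal p) (P.map (X 0)) := by
    refine (integrable_norm_rpow_iff measurable_id.aestronglyMeasurable
      (by simpa using hp0) ENNReal.ofReal_ne_top).1 ?_
    rwa [ENNReal.toReal_ofReal hp0.le]
  have hX0 := hXmeas 0 le_rfl
  have hX0i : Integrable (X 0) P :=
    (integrable_map_measure measurable_id.aestronglyMeasurable hX0.aemeasurable).1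
      (hmem.integrable (by simpa using hp))
  rw [stdGaussian_eq_mathlib]
  refine (wassersteinDist_le_lintegral_rotDriftNorm _ hp hmem).trans ?_
  rw [lintegral_Ioc_zero_pi_div_two_eq]
  refine setLIntegral_mono' measurableSet_Ioi fun t ht => ?_
  have ht : 0 < t := ht
  have hlt : Real.exp (-t) < 1 := Real.exp_lt_one_iff.2 (neg_lt_zero.2 ht)
  have hsq : 0 < 1 - Real.exp (-t) ^ 2 := by nlinarith [Real.exp_pos (-t)]
  have hsin := Real.sin_arccos (Real.exp (-t))
  have hcos := Real.cos_arccos (by linarith [Real.exp_pos (-t)]) hlt.le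
  have hroot : √(1 - Real.exp (-t) ^ 2) ≠ 0 := Real.sqrt_ne_zero'.2 hsq
  have hD : (cos (arccos (Real.exp (-t))) / sin (arccos (Real.exp (-t)))) ^ 2 =
      1 / (Real.exp (2 * t) - 1) := by
    have h : Real.exp (2 * t) * Real.exp (-t) ^ 2 = 1 := by
      rw [← Real.exp_nat_mul, ← Real.exp_add]; simp
    have hD0 : Real.exp (2 * t) - 1 ≠ 0 := by
      have := Real.one_lt_exp_iff.2 (by linarith : 0 < 2 * t); linarith
    rw [hsin, hcos, div_pow, Real.sq_sqrt hsq.le, div_eq_div_iff hsq.ne' hD0]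
    linear_combination h
  have hbound := rotDriftNorm_le_condSteinSum rfl hX0 (hXmeas t ht.le) hX0i (hexch t ht) hp hs.ne'
    (by rwa [hsin]) (by rw [hcos]; positivity) hD
    (integrable_mul_exp_of_forall_Icc hp hXmeas hcond ht)
  refine (mul_le_mul_right hbound _).trans_eq ?_
  rw [← mul_assoc, hsin, Real.enorm_of_nonneg (Real.sqrt_nonneg _),
    ← ENNReal.ofReal_mul (by positivity), div_mul_cancel₀ _ hroot]
  rfl

end
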